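/- arXiv:0709.2042 — 8 statements merged into one kernel-verified Lean document; each statement's English description precedes it below -/
import Mathlib

section
/- There exists a unique globally defined, twice continuously differentiable function s : ℝ → ℝ satisfying the ordinary differential equation s''(u) = -2 s(u)^3 for all u ∈ ℝ, with initial conditions s(0) = 0 and s'(0) = 1. (This function is the Jacobi elliptic function sn(u, i) with modulus k = i, which underlies the classical solutions of the massless quartic scalar field theory.) -/
open Set Metric Filter Topology
open scoped NNReal

/-- A bounded, globally Lipschitz, autonomous vector field on a Banach space has a global integral
curve through every point. -/
theorem exists_hasDerivAt_of_lipschitzWith_of_norm_le {E : Type*} [NormedAddCommGroup E]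
    [NormedSpace ℝ E] [CompleteSpace E] {v : E → E} {K L : ℝ≥0} (hK : LipschitzWith K v)
    (hL : ∀ x, ‖v x‖ ≤ L) (x₀ : E) :
    ∃ γ : ℝ → E, γ 0 = x₀ ∧ ∀ t, HasDerivAt γ (v (γ t)) t := by
  have local_sol : ∀ T : ℝ≥0, ∃ γ : ℝ → E, γ 0 = x₀ ∧
      ∀ t ∈ Ioo (-T : ℝ) T, HasDerivAt γ (v (γ t)) t := by
    intro T
    have hPL : IsPicardLindelof (fun _ ↦ v)
        (⟨0, by simp, by simp⟩ : Icc (-T : ℝ) T) x₀ (L * T) 0 L K :=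
      .of_time_independent (fun x _ ↦ hL x) hK.lipschitzOnWith (by simp)
    obtain ⟨γ, h0, hγ⟩ := hPL.exists_eq_forall_mem_Icc_hasDerivWithinAt₀
    exact ⟨γ, h0, fun t ht ↦
      (hγ t (Ioo_subset_Icc_self ht)).hasDerivAt (Icc_mem_nhds ht.1 ht.2)⟩
  choose γ h0 hγ using local_sol
  have eqOn_of_le : ∀ S T : ℝ≥0, S ≤ T → EqOn (γ S) (γ T) (Ioo (-S : ℝ) S) := by
    intro S T hST t ht
    have hS : (0 : ℝ) < S := by linarith [ht.1, ht.2]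
    have hST' : (S : ℝ) ≤ T := hST
    exact ODE_solution_unique_of_mem_Ioo (v := fun _ ↦ v) (s := fun _ ↦ univ) (K := K)
      (fun _ _ ↦ hK.lipschitzOnWith) (t₀ := 0) ⟨by linarith, hS⟩
      (fun u hu ↦ ⟨hγ S u hu, mem_univ _⟩)
      (fun u hu ↦ ⟨hγ T u ⟨by linarith [hu.1], by linarith [hu.2]⟩, mem_univ _⟩)
      (by rw [h0, h0]) ht
  have eqOn_glued : ∀ T : ℝ≥0, EqOn (fun t ↦ γ (‖t‖₊ + 1) t) (γ T) (Ioo (-T : ℝ) T) := by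
    intro T t ht
    have ht' : t ∈ Ioo (-(‖t‖₊ + 1 : ℝ≥0) : ℝ) (‖t‖₊ + 1 : ℝ≥0) := by
      rw [mem_Ioo, ← abs_lt]; simp
    rcases le_total (‖t‖₊ + 1) T with h | h
    · exact eqOn_of_le _ _ h ht'
    · exact (eqOn_of_le _ _ h ht).symm
  refine ⟨fun t ↦ γ (‖t‖₊ + 1) t, h0 _, fun t ↦ ?_⟩
  have ht : t ∈ Ioo (-(‖t‖₊ + 1 : ℝ≥0) : ℝ) (‖t‖₊ + 1 : ℝ≥0) := by
    rw [mem_Ioo, ← abs_lt]; simp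
  exact (hγ _ t ht).congr_of_eventuallyEq
    ((eqOn_glued _).eventuallyEq_of_mem (Ioo_mem_nhds ht.1 ht.2))

/-- The retraction of the real line onto `[-1, 1]`. -/
noncomputable def unitClamp (x : ℝ) : ℝ := max (-1) (min x 1)

theorem unitClamp_of_abs_le {x : ℝ} (hx : |x| ≤ 1) : unitClamp x = x := by
  rw [abs_le] at hx
  rw [unitClamp, min_eq_left hx.2, max_eq_right hx.1]

theorem unitClamp_of_one_le {x : ℝ} (hx : 1 ≤ x) : unitClamp x = 1 := by
  rw [unitClamp, min_eq_right hx, max_eq_right (by norm_num)]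

theorem abs_unitClamp_le (x : ℝ) : |unitClamp x| ≤ 1 :=
  abs_le.2 ⟨le_max_left _ _, max_le (by norm_num) (min_le_right _ _)⟩

theorem unitClamp_neg (x : ℝ) : unitClamp (-x) = -unitClamp x := by
  unfold unitClamp
  grind

theorem unitClamp_nonneg {x : ℝ} (hx : 0 ≤ x) : 0 ≤ unitClamp x :=
  le_max_of_le_right (le_min hx zero_le_one)

theorem lipschitzWith_unitClamp : LipschitzWith 1 unitClamp :=
  (LipschitzWith.id.min_const 1).const_max (-1)

theorem continuous_unitClamp : Continuous unitClamp := lipschitzWith_unitClamp.continuous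

/-- The primitive of the `n`-th power of `unitClamp` vanishing at the origin. -/
noncomputable def clampPotential (n : ℕ) (x : ℝ) : ℝ := ∫ t in (0 : ℝ)..x, unitClamp t ^ n

theorem hasDerivAt_clampPotential (n : ℕ) (x : ℝ) :
    HasDerivAt (clampPotential n) (unitClamp x ^ n) x :=
  (continuous_unitClamp.pow n).integral_hasStrictDerivAt 0 x |>.hasDerivAt

@[simp] theorem clampPotential_zero (n : ℕ) : clampPotential n 0 = 0 := by
  simp [clampPotential]

theorem clampPotential_one (n : ℕ) : clampPotential n 1 = 1 / (n + 1) := by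
  have h : clampPotential n 1 = ∫ t in (0 : ℝ)..1, t ^ n := by
    refine intervalIntegral.integral_congr fun t ht ↦ ?_
    rw [uIcc_of_le zero_le_one] at ht
    simp only [unitClamp_of_abs_le (abs_le.2 ⟨by linarith [ht.1], ht.2⟩)]
  simp [h]

theorem clampPotential_neg {n : ℕ} (hn : Odd n) (x : ℝ) :
    clampPotential n (-x) = clampPotential n x := by
  have h := intervalIntegral.integral_comp_neg (a := 0) (b := x) fun t ↦ unitClamp t ^ n
  simp only [unitClamp_neg, hn.neg_pow, intervalIntegral.integral_neg, neg_zero] at h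
  rw [clampPotential, intervalIntegral.integral_symm, ← h, neg_neg, clampPotential]

theorem clampPotential_abs {n : ℕ} (hn : Odd n) (x : ℝ) :
    clampPotential n |x| = clampPotential n x := by
  rcases abs_choice x with h | h <;> rw [h]
  exact clampPotential_neg hn x

theorem clampPotential_nonneg {n : ℕ} (hn : Odd n) (x : ℝ) : 0 ≤ clampPotential n x := by
  rw [← clampPotential_abs hn]
  exact intervalIntegral.integral_nonneg (abs_nonneg x)
    fun t ht ↦ pow_nonneg (unitClamp_nonneg ht.1) n

theorem clampPotential_of_one_le (n : ℕ) {x : ℝ} (hx : 1 ≤ x) :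
    clampPotential n x = clampPotential n 1 + (x - 1) := by
  have hint : ∀ a b,
      IntervalIntegrable (fun t ↦ unitClamp t ^ n) MeasureTheory.volume a b := fun a b ↦
    (continuous_unitClamp.pow n).intervalIntegrable a b
  have h : ∫ t in (1 : ℝ)..x, unitClamp t ^ n = ∫ _ in (1 : ℝ)..x, (1 : ℝ) := by
    refine intervalIntegral.integral_congr fun t ht ↦ ?_
    rw [uIcc_of_le hx] at ht
    simp only [unitClamp_of_one_le ht.1, one_pow]
  rw [clampPotential, ← intervalIntegral.integral_add_adjacent_intervals (hint 0 1) (hint 1 x), h]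
  simp [clampPotential]

theorem abs_le_one_of_clampPotential_le {n : ℕ} (hn : Odd n) {x : ℝ}
    (hx : clampPotential n x ≤ clampPotential n 1) : |x| ≤ 1 := by
  by_contra! h
  rw [← clampPotential_abs hn, clampPotential_of_one_le n h.le] at hx
  linarith

/-- The phase-space vector field of `s'' = -2 s ^ 3`, truncated outside the square `[-1, 1] ^ 2`. -/
noncomputable def clampedField (z : ℝ × ℝ) : ℝ × ℝ := (unitClamp z.2, -2 * unitClamp z.1 ^ 3)

theorem clampedField_of_abs_le {x y : ℝ} (hx : |x| ≤ 1) (hy : |y| ≤ 1) :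
    clampedField (x, y) = (y, -2 * x ^ 3) := by
  simp only [clampedField, unitClamp_of_abs_le hx, unitClamp_of_abs_le hy]

theorem abs_pow_three_sub_pow_three_le {a b : ℝ} (ha : |a| ≤ 1) (hb : |b| ≤ 1) :
    |a ^ 3 - b ^ 3| ≤ 3 * |a - b| := by
  rw [abs_le] at ha hb
  rw [show a ^ 3 - b ^ 3 = (a ^ 2 + a * b + b ^ 2) * (a - b) by ring, abs_mul]
  refine mul_le_mul_of_nonneg_right (abs_le.2 ⟨?_, ?_⟩) (abs_nonneg _) <;> nlinarith

theorem lipschitzWith_clampedField : LipschitzWith 6 clampedField := by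
  refine LipschitzWith.of_dist_le_mul fun z w ↦ ?_
  have hc := fun a b ↦ lipschitzWith_unitClamp.dist_le_mul a b
  have h1 : dist z.1 w.1 ≤ dist z w := le_max_left _ _
  have h2 : dist z.2 w.2 ≤ dist z w := le_max_right _ _
  have h3 := hc z.1 w.1
  have h4 := hc z.2 w.2
  have h5 := abs_pow_three_sub_pow_three_le (abs_unitClamp_le z.1) (abs_unitClamp_le w.1)
  have h6 : dist (-2 * unitClamp z.1 ^ 3) (-2 * unitClamp w.1 ^ 3)
      = 2 * |unitClamp z.1 ^ 3 - unitClamp w.1 ^ 3| := by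
    rw [Real.dist_eq, ← mul_sub, abs_mul]; norm_num
  have h7 : (0 : ℝ) ≤ dist z w := dist_nonneg
  rw [Real.dist_eq (unitClamp z.1)] at h3
  simp only [NNReal.coe_one, one_mul] at h3 h4
  refine max_le ?_ ?_
  · change dist (unitClamp z.2) (unitClamp w.2) ≤ 6 * dist z w
    linarith
  · change dist (-2 * unitClamp z.1 ^ 3) (-2 * unitClamp w.1 ^ 3) ≤ 6 * dist z w
    linarith

theorem norm_clampedField_le (z : ℝ × ℝ) : ‖clampedField z‖ ≤ (2 : ℝ≥0) := by
  refine max_le ?_ ?_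
  · change |unitClamp z.2| ≤ 2
    linarith [abs_unitClamp_le z.2]
  · change |-2 * unitClamp z.1 ^ 3| ≤ 2
    rw [abs_mul, abs_pow]
    norm_num
    exact pow_le_one₀ (abs_nonneg _) (abs_unitClamp_le z.1)

/-- An integral curve of the truncated field starting at `(0, 1)` stays in `[-1, 1] ^ 2`, because
the truncated energy is conserved. -/
theorem abs_le_one_of_hasDerivAt_clampedField {γ : ℝ → ℝ × ℝ} (h0 : γ 0 = (0, 1))
    (hγ : ∀ t, HasDerivAt γ (clampedField (γ t)) t) (t : ℝ) :
    |(γ t).1| ≤ 1 ∧ |(γ t).2| ≤ 1 := by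
  have hE : ∀ t, HasDerivAt
      (fun t ↦ clampPotential 1 (γ t).2 + 2 * clampPotential 3 (γ t).1) 0 t := by
    intro t
    have h1 : HasDerivAt (fun t ↦ (γ t).1) (unitClamp (γ t).2) t := (hγ t).fst
    have h2 : HasDerivAt (fun t ↦ (γ t).2) (-2 * unitClamp (γ t).1 ^ 3) t := (hγ t).snd
    have h3 := ((hasDerivAt_clampPotential 1 _).comp t h2).add
      (((hasDerivAt_clampPotential 3 _).comp t h1).const_mul 2)
    exact h3.congr_deriv (by ring)
  have hconst := is_const_of_deriv_eq_zero (fun t ↦ (hE t).differentiableAt)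
    (fun t ↦ (hE t).deriv) t 0
  have n1 := clampPotential_nonneg (n := 1) (by decide) (γ t).2
  have n3 := clampPotential_nonneg (n := 3) (by decide) (γ t).1
  have e1 := clampPotential_one 1
  have e3 := clampPotential_one 3
  simp only [h0, clampPotential_zero] at hconst
  norm_num at e1 e3
  exact ⟨abs_le_one_of_clampPotential_le (n := 3) (by decide) (by linarith),
    abs_le_one_of_clampPotential_le (n := 1) (by decide) (by linarith)⟩

/-- Phase-space trajectories of the snoidal initial value problem are integral curves of the
truncated field, by conservation of the energy `s' ^ 2 + s ^ 4`. -/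
theorem hasDerivAt_clampedField_of_snoidal {s : ℝ → ℝ} (hs : ContDiff ℝ 2 s)
    (hode : ∀ u, deriv (deriv s) u = -2 * s u ^ 3) (h0 : s 0 = 0) (h1 : deriv s 0 = 1) (u : ℝ) :
    HasDerivAt (fun t ↦ (s t, deriv s t)) (clampedField (s u, deriv s u)) u := by
  have d1 : ∀ t, HasDerivAt s (deriv s t) t := fun t ↦
    (hs.differentiable (by norm_num) t).hasDerivAt
  have d2 : ∀ t, HasDerivAt (deriv s) (-2 * s t ^ 3) t := fun t ↦
    hode t ▸ (hs.differentiable_deriv_two t).hasDerivAt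
  have hE : ∀ t, HasDerivAt (fun t ↦ deriv s t ^ 2 + s t ^ 4) 0 t := by
    intro t
    exact (((d2 t).pow 2).add ((d1 t).pow 4)).congr_deriv (by push_cast; ring)
  have hconst := is_const_of_deriv_eq_zero (fun t ↦ (hE t).differentiableAt)
    (fun t ↦ (hE t).deriv) u 0
  simp only [h0, h1] at hconst
  have hsu : |s u| ≤ 1 := by
    rw [← sq_le_one_iff_abs_le_one]
    nlinarith [sq_nonneg (deriv s u), sq_nonneg (s u)]
  have hdu : |deriv s u| ≤ 1 := by
    rw [← sq_le_one_iff_abs_le_one]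
    nlinarith [sq_nonneg (s u ^ 2)]
  rw [clampedField_of_abs_le hsu hdu]
  exact (d1 u).prodMk (d2 u)

/-- **Existence and uniqueness of the snoidal function `sn(·, i)`.**
There is a unique globally defined, twice continuously differentiable
`s : ℝ → ℝ` with `s'' = -2 s³`, `s 0 = 0` and `s' 0 = 1`. -/
theorem snoidal_exists_unique :
    ∃! s : ℝ → ℝ, ContDiff ℝ 2 s ∧
      (∀ u : ℝ, deriv (deriv s) u = -2 * s u ^ 3) ∧
      s 0 = 0 ∧ deriv s 0 = 1 := by
  obtain ⟨γ, h0, hγ⟩ := exists_hasDerivAt_of_lipschitzWith_of_norm_le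
    lipschitzWith_clampedField norm_clampedField_le (0, 1)
  have hbound := abs_le_one_of_hasDerivAt_clampedField h0 hγ
  have d : ∀ t, HasDerivAt γ ((γ t).2, -2 * (γ t).1 ^ 3) t := fun t ↦
    clampedField_of_abs_le (hbound t).1 (hbound t).2 ▸ hγ t
  have d1 : ∀ t, HasDerivAt (fun t ↦ (γ t).1) (γ t).2 t := fun t ↦ (d t).fst
  have d2 : ∀ t, HasDerivAt (fun t ↦ (γ t).2) (-2 * (γ t).1 ^ 3) t := fun t ↦ (d t).snd
  have hd : deriv (fun t ↦ (γ t).1) = fun t ↦ (γ t).2 := funext fun t ↦ (d1 t).deriv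
  have hdd : deriv (fun t ↦ (γ t).2) = fun t ↦ -2 * (γ t).1 ^ 3 := funext fun t ↦ (d2 t).deriv
  refine ⟨fun t ↦ (γ t).1, ⟨?_, ?_, by simp [h0], by simp [hd, h0]⟩, ?_⟩
  · have hC1 : ContDiff ℝ 1 fun t ↦ (γ t).2 := by
      rw [contDiff_one_iff_deriv, hdd]
      have hc : Continuous fun t ↦ (γ t).1 :=
        continuous_iff_continuousAt.2 fun t ↦ (d1 t).continuousAt
      exact ⟨fun t ↦ (d2 t).differentiableAt, by fun_prop⟩
    rw [show (2 : WithTop ℕ∞) = 1 + 1 by norm_num, contDiff_succ_iff_deriv, hd]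
    exact ⟨fun t ↦ (d1 t).differentiableAt, by simp, hC1⟩
  · intro u
    rw [hd, hdd]
  · rintro s ⟨hs, hode, hs0, hs1⟩
    have h := ODE_solution_unique_univ (v := fun _ ↦ clampedField) (s := fun _ ↦ univ) (t₀ := 0)
      (fun _ ↦ lipschitzWith_clampedField.lipschitzOnWith)
      (fun t ↦ ⟨hasDerivAt_clampedField_of_snoidal hs hode hs0 hs1 t, mem_univ _⟩)
      (fun t ↦ ⟨hγ t, mem_univ _⟩) (by rw [hs0, hs1, h0])
    exact funext fun t ↦ congrArg Prod.fst (congrFun h t)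
end

section
/- Let s : ℝ → ℝ be twice differentiable with s''(u) = -2 s(u)^3 for all u, s(0) = 0, s'(0) = 1, and let K = ∫₀^{π/2} dθ / √(1 + sin²θ). Then s is strictly increasing on the interval [0, K], s(K) = 1, and s'(K) = 0; that is, s first attains its maximum value 1 exactly at u = K, so K is the quarter period of sn(·, i). -/
open Real

/-- The nonlinear field `x ↦ x ^ 3` is Lipschitz with constant `3` on `[-1, 1]`, which bounds the
growth of the squared distance between two solutions of `s'' = -2 s³`. -/
theorem cubic_field_energy_bound {x y p q t : ℝ} (hx : |x| ≤ 1) (hy : |y| ≤ 1)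
    (ht0 : 0 ≤ t) (ht1 : t ≤ 1) :
    2 * (x - y) * ((p - q) * t) + 2 * (p - q) * (-2 * (x ^ 3 - y ^ 3) * t) ≤
      7 * ((x - y) ^ 2 + (p - q) ^ 2) := by
  obtain ⟨m, hm⟩ : ∃ m, m = 1 - 2 * (x ^ 2 + x * y + y ^ 2) := ⟨_, rfl⟩
  have hm7 : |m * t| ≤ 7 := by
    have hm' : |m| ≤ 7 := by
      rw [abs_le] at hx hy ⊢
      constructor <;> nlinarith
    rw [abs_mul, abs_of_nonneg ht0]
    nlinarith [abs_nonneg m]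
  have heq : 2 * (x - y) * ((p - q) * t) + 2 * (p - q) * (-2 * (x ^ 3 - y ^ 3) * t) =
      m * t * (2 * (x - y) * (p - q)) := by rw [hm]; ring
  have hab : |2 * (x - y) * (p - q)| ≤ (x - y) ^ 2 + (p - q) ^ 2 := by
    rw [abs_le]
    constructor <;> nlinarith [sq_nonneg (x - y + (p - q)), sq_nonneg (x - y - (p - q))]
  rw [heq]
  calc m * t * (2 * (x - y) * (p - q)) ≤ |m * t| * |2 * (x - y) * (p - q)| := by
        rw [← abs_mul]; exact le_abs_self _
    _ ≤ 7 * ((x - y) ^ 2 + (p - q) ^ 2) := by gcongr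

/-- A nonnegative function with `E' ≤ C E` that vanishes at `0` vanishes on `[0, ∞)`. -/
theorem eq_zero_of_hasDerivAt_le_mul {E E' : ℝ → ℝ} {C : ℝ} (hE : ∀ t, HasDerivAt E (E' t) t)
    (hle : ∀ t, E' t ≤ C * E t) (hnn : ∀ t, 0 ≤ E t) (h0 : E 0 = 0) {t : ℝ} (ht : 0 ≤ t) :
    E t = 0 := by
  have hd : ∀ x, HasDerivAt (fun x => E x * Real.exp (-C * x))
      (E' x * Real.exp (-C * x) + E x * (Real.exp (-C * x) * (-C))) x := fun x => by
    refine (hE x).mul ?_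
    simpa using ((hasDerivAt_id x).const_mul (-C)).exp
  have hanti : Antitone fun x => E x * Real.exp (-C * x) :=
    antitone_of_hasDerivAt_nonpos hd fun x => by
      have := mul_nonneg (sub_nonneg.2 (hle x)) (Real.exp_pos (-C * x)).le
      rw [Pi.zero_apply]
      linarith
  have := hanti ht
  simp only [h0, zero_mul] at this
  exact le_antisymm (nonpos_of_mul_nonpos_left this (Real.exp_pos _)) (hnn t)

/-- Conservation of energy for `s'' = -2 s³`. -/
theorem snoidal_energy {s : ℝ → ℝ}
    (hs : Differentiable ℝ s) (hs' : Differentiable ℝ (deriv s))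
    (hode : ∀ u : ℝ, deriv (deriv s) u = -2 * s u ^ 3)
    (h0 : s 0 = 0) (h1 : deriv s 0 = 1) (u : ℝ) : deriv s u ^ 2 + s u ^ 4 = 1 := by
  have hd : ∀ x, HasDerivAt (fun x => deriv s x ^ 2 + s x ^ 4) 0 x := fun x => by
    have h := ((hs' x).hasDerivAt.pow 2).add ((hs x).hasDerivAt.pow 4)
    rw [hode] at h
    refine h.congr_deriv ?_
    norm_num
    ring
  have := is_const_of_deriv_eq_zero (fun x => (hd x).differentiableAt) (fun x => (hd x).deriv) u 0
  simpa [h0, h1] using this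

theorem abs_snoidal_le_one {s : ℝ → ℝ}
    (hs : Differentiable ℝ s) (hs' : Differentiable ℝ (deriv s))
    (hode : ∀ u : ℝ, deriv (deriv s) u = -2 * s u ^ 3)
    (h0 : s 0 = 0) (h1 : deriv s 0 = 1) (u : ℝ) : |s u| ≤ 1 := by
  have h := snoidal_energy hs hs' hode h0 h1 u
  rw [← sq_le_one_iff_abs_le_one]
  nlinarith [sq_nonneg (deriv s u)]

theorem hasDerivAt_sqrt_one_add_sin_sq (θ : ℝ) :
    HasDerivAt (fun θ => Real.sqrt (1 + Real.sin θ ^ 2))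
      (Real.sin θ * Real.cos θ / Real.sqrt (1 + Real.sin θ ^ 2)) θ := by
  have hpos : 0 < 1 + Real.sin θ ^ 2 := by positivity
  refine ((((Real.hasDerivAt_sin θ).pow 2).const_add 1).sqrt hpos.ne').congr_deriv ?_
  simp only [Nat.cast_ofNat, Nat.add_one_sub_one, pow_one, Pi.pow_apply]
  rw [mul_assoc, mul_div_mul_left _ _ two_ne_zero]

theorem continuous_inv_sqrt_one_add_sin_sq :
    Continuous fun θ : ℝ => 1 / Real.sqrt (1 + Real.sin θ ^ 2) :=
  continuous_const.div (by fun_prop) fun θ => by positivity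

/-- The incomplete elliptic integral of the first kind inverts the snoidal function:
`s (F θ) = sin θ` and `s' (F θ) = cos θ √(1 + sin² θ)`. -/
theorem snoidal_comp_elliptic_integral {s F : ℝ → ℝ}
    (hs : Differentiable ℝ s) (hs' : Differentiable ℝ (deriv s))
    (hode : ∀ u : ℝ, deriv (deriv s) u = -2 * s u ^ 3)
    (h0 : s 0 = 0) (h1 : deriv s 0 = 1) (hF0 : F 0 = 0)
    (hF : ∀ θ, HasDerivAt F (1 / Real.sqrt (1 + Real.sin θ ^ 2)) θ) {θ : ℝ} (hθ : 0 ≤ θ) :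
    s (F θ) = Real.sin θ ∧
      deriv s (F θ) = Real.cos θ * Real.sqrt (1 + Real.sin θ ^ 2) := by
  set r : ℝ → ℝ := fun θ => Real.sqrt (1 + Real.sin θ ^ 2) with hr
  have hr1 : ∀ t, 1 ≤ r t := fun t => Real.one_le_sqrt.2 (by nlinarith [sq_nonneg (Real.sin t)])
  have hrsq : ∀ t, r t ^ 2 = 1 + Real.sin t ^ 2 := fun t => Real.sq_sqrt (by positivity)
  have hg : ∀ t, HasDerivAt (fun t => s (F t)) (deriv s (F t) * (1 / r t)) t := fun t =>
    (hs (F t)).hasDerivAt.comp t (hF t)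
  have hh : ∀ t, HasDerivAt (fun t => deriv s (F t)) (-2 * s (F t) ^ 3 * (1 / r t)) t := fun t => by
    rw [← hode]
    exact (hs' (F t)).hasDerivAt.comp t (hF t)
  have hsin : ∀ t, HasDerivAt Real.sin (Real.cos t * r t * (1 / r t)) t := fun t => by
    have := hr1 t
    refine (Real.hasDerivAt_sin t).congr_deriv ?_
    field_simp
  have hcos : ∀ t, HasDerivAt (fun t => Real.cos t * r t)
      (-2 * Real.sin t ^ 3 * (1 / r t)) t := fun t => by
    have := hr1 t
    refine ((Real.hasDerivAt_cos t).mul (hasDerivAt_sqrt_one_add_sin_sq t)).congr_deriv ?_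
    change -Real.sin t * r t + Real.cos t * (Real.sin t * Real.cos t / r t) = _
    field_simp
    rw [hrsq, Real.cos_sq']
    ring
  have hE := eq_zero_of_hasDerivAt_le_mul
    (E := fun t => (s (F t) - Real.sin t) ^ 2 + (deriv s (F t) - Real.cos t * r t) ^ 2) (C := 7)
    (fun t => (((hg t).sub (hsin t)).pow 2).add (((hh t).sub (hcos t)).pow 2))
    (fun t => by
      have hrt := hr1 t
      refine le_trans (le_of_eq ?_) (cubic_field_energy_bound (t := 1 / r t)
        (abs_snoidal_le_one hs hs' hode h0 h1 (F t)) (Real.abs_sin_le_one t) (by positivity)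
        ((div_le_one (by positivity)).2 hrt))
      simp only [Pi.sub_apply]
      norm_num
      ring)
    (fun t => by positivity) (by simp [hF0, h0, h1, hr]) hθ
  constructor <;> nlinarith [sq_nonneg (s (F θ) - Real.sin θ),
    sq_nonneg (deriv s (F θ) - Real.cos θ * r θ)]

/-- **`K(i)` is the quarter period of `sn(·, i)`.**
With `K = ∫₀^{π/2} dθ/√(1+sin²θ)`, the solution of `s'' = -2 s³`, `s 0 = 0`,
`s' 0 = 1` is strictly increasing on `[0, K]`, attains the value `1` at `K`
with `s' K = 0`, and stays strictly below `1` before `K`. -/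
theorem snoidal_quarter_period (s : ℝ → ℝ)
    (hs : Differentiable ℝ s) (hs' : Differentiable ℝ (deriv s))
    (hode : ∀ u : ℝ, deriv (deriv s) u = -2 * s u ^ 3)
    (h0 : s 0 = 0) (h1 : deriv s 0 = 1)
    (K : ℝ) (hK : K = ∫ θ in (0:ℝ)..(π / 2), 1 / Real.sqrt (1 + Real.sin θ ^ 2)) :
    StrictMonoOn s (Set.Icc 0 K) ∧ s K = 1 ∧ deriv s K = 0 ∧
      ∀ u ∈ Set.Ico (0:ℝ) K, s u < 1 := by
  set F : ℝ → ℝ := fun φ => ∫ θ in (0:ℝ)..φ, 1 / Real.sqrt (1 + Real.sin θ ^ 2) with hFdef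
  have hF : ∀ θ, HasDerivAt F (1 / Real.sqrt (1 + Real.sin θ ^ 2)) θ := fun θ =>
    continuous_inv_sqrt_one_add_sin_sq.integral_hasStrictDerivAt 0 θ |>.hasDerivAt
  have hF0 : F 0 = 0 := by simp [hFdef]
  have hFmono : StrictMono F := strictMono_of_hasDerivAt_pos hF fun θ => by positivity
  have hFcont : Continuous F := continuous_iff_continuousAt.2 fun θ => (hF θ).continuousAt
  have key : ∀ θ : ℝ, 0 ≤ θ → s (F θ) = Real.sin θ ∧
      deriv s (F θ) = Real.cos θ * Real.sqrt (1 + Real.sin θ ^ 2) := fun θ hθ =>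
    snoidal_comp_elliptic_integral hs hs' hode h0 h1 hF0 hF hθ
  have hKF : F (π / 2) = K := hK.symm
  have hsurj : ∀ u ∈ Set.Icc 0 K, ∃ θ ∈ Set.Icc 0 (π / 2), F θ = u := fun u hu =>
    intermediate_value_Icc (by positivity) hFcont.continuousOn (by rwa [hF0, hKF])
  have hmono : StrictMonoOn s (Set.Icc 0 K) := by
    intro u hu v hv huv
    obtain ⟨θ, hθ, rfl⟩ := hsurj u hu
    obtain ⟨φ, hφ, rfl⟩ := hsurj v hv
    rw [(key θ hθ.1).1, (key φ hφ.1).1]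
    exact Real.strictMonoOn_sin ⟨by linarith [hθ.1, Real.pi_pos], hθ.2⟩
      ⟨by linarith [hφ.1, Real.pi_pos], hφ.2⟩ (hFmono.lt_iff_lt.1 huv)
  obtain ⟨hsK, hsK'⟩ := key (π / 2) (by positivity)
  rw [hKF, Real.sin_pi_div_two] at hsK
  rw [hKF, Real.cos_pi_div_two, zero_mul] at hsK'
  refine ⟨hmono, hsK, hsK', fun u hu => ?_⟩
  rw [← hsK]
  exact hmono ⟨hu.1, hu.2.le⟩ ⟨hu.1.trans hu.2.le, le_rfl⟩ hu.2
end

section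
/- Let s : ℝ → ℝ be twice differentiable with s''(u) = -2 s(u)^3 for all u, s(0) = 0, s'(0) = 1, and let K = ∫₀^{π/2} dθ / √(1 + sin²θ). Then s is odd (s(−u) = −s(u) for all u), satisfies the reflection identity s(2K − u) = s(u) for all u, and is periodic with period 4K: s(u + 4K) = s(u) for all u ∈ ℝ. -/
open Real

/-- Uniqueness for the time-rescaled system `x' = w y`, `y' = -2 w x³` among solutions
with `|x| ≤ 1`. -/
theorem snoidal_system_unique {w x y X Y : ℝ → ℝ} (hw : ∀ t, |w t| ≤ 1)
    (hx : ∀ t, HasDerivAt x (w t * y t) t) (hy : ∀ t, HasDerivAt y (w t * (-2 * x t ^ 3)) t)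
    (hX : ∀ t, HasDerivAt X (w t * Y t) t) (hY : ∀ t, HasDerivAt Y (w t * (-2 * X t ^ 3)) t)
    (hx1 : ∀ t, |x t| ≤ 1) (hX1 : ∀ t, |X t| ≤ 1) {t₀ : ℝ}
    (hxX : x t₀ = X t₀) (hyY : y t₀ = Y t₀) (t : ℝ) : x t = X t ∧ y t = Y t := by
  have hlip : ∀ t, LipschitzOnWith 6
      (fun p : ℝ × ℝ ↦ (w t * p.2, w t * (-2 * p.1 ^ 3))) {p | |p.1| ≤ 1} := by
    refine fun t ↦ LipschitzOnWith.of_dist_le_mul fun p hp q hq ↦ ?_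
    have hp' : |p.1| ≤ 1 := hp
    have hq' : |q.1| ≤ 1 := hq
    have h₁ : |p.1 - q.1| ≤ dist p q := le_max_left _ _
    have h₂ : |p.2 - q.2| ≤ dist p q := le_max_right _ _
    rw [Prod.dist_eq]
    simp only [NNReal.coe_ofNat, Real.dist_eq]
    refine max_le ?_ ?_
    · rw [← mul_sub, abs_mul]
      nlinarith [hw t, abs_nonneg (w t), abs_nonneg (p.2 - q.2)]
    · have hquad : |p.1 ^ 2 + p.1 * q.1 + q.1 ^ 2| ≤ 3 := by
        rw [abs_le] at hp' hq' ⊢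
        constructor <;> nlinarith
      have hcube : |-2 * p.1 ^ 3 - -2 * q.1 ^ 3| ≤ 6 * |p.1 - q.1| := by
        rw [show -2 * p.1 ^ 3 - -2 * q.1 ^ 3 =
          -2 * ((p.1 ^ 2 + p.1 * q.1 + q.1 ^ 2) * (p.1 - q.1)) by ring, abs_mul, abs_mul]
        norm_num
        nlinarith [abs_nonneg (p.1 - q.1)]
      rw [← mul_sub, abs_mul]
      nlinarith [hw t, abs_nonneg (w t), abs_nonneg (-2 * p.1 ^ 3 - -2 * q.1 ^ 3)]
  have heq : (fun t ↦ (x t, y t)) = fun t ↦ (X t, Y t) :=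
    ODE_solution_unique_univ (v := fun t p ↦ (w t * p.2, w t * (-2 * p.1 ^ 3)))
      (s := fun _ ↦ {p | |p.1| ≤ 1}) (t₀ := t₀) hlip
      (fun t ↦ ⟨(hx t).prodMk (hy t), hx1 t⟩) (fun t ↦ ⟨(hX t).prodMk (hY t), hX1 t⟩)
      (by simp [hxX, hyY])
  exact Prod.ext_iff.mp (congrFun heq t)

/-- The second component of the trajectory `(sin θ, cos θ √(1 + sin² θ))` satisfies
`y' = -2 w x³` with `w = 1 / √(1 + sin² θ)`. -/
theorem hasDerivAt_cos_mul_sqrt (θ : ℝ) :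
    HasDerivAt (fun θ ↦ cos θ * √(1 + sin θ ^ 2))
      (1 / √(1 + sin θ ^ 2) * (-2 * sin θ ^ 3)) θ := by
  have hpos : 0 < 1 + sin θ ^ 2 := by positivity
  have hsq : √(1 + sin θ ^ 2) ^ 2 = 1 + sin θ ^ 2 := sq_sqrt hpos.le
  have hne : √(1 + sin θ ^ 2) ≠ 0 := (sqrt_pos.mpr hpos).ne'
  refine ((hasDerivAt_cos θ).mul
    ((((hasDerivAt_sin θ).fun_pow 2).const_add 1).sqrt hpos.ne')).congr_deriv ?_
  field_simp
  rw [hsq]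
  have hcs := sin_sq_add_cos_sq θ
  push_cast
  linear_combination (2 * sin θ) * hcs

/-- **Symmetries and periodicity of `sn(·, i)`.**
With `K = ∫₀^{π/2} dθ/√(1+sin²θ)`, the solution of `s'' = -2 s³`, `s 0 = 0`,
`s' 0 = 1` is odd, satisfies the reflection identity `s (2K - u) = s u`,
and is periodic with period `4K`. -/
theorem snoidal_symmetries (s : ℝ → ℝ)
    (hs : Differentiable ℝ s) (hs' : Differentiable ℝ (deriv s))
    (hode : ∀ u : ℝ, deriv (deriv s) u = -2 * s u ^ 3)
    (h0 : s 0 = 0) (h1 : deriv s 0 = 1)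
    (K : ℝ) (hK : K = ∫ θ in (0:ℝ)..(π / 2), 1 / Real.sqrt (1 + Real.sin θ ^ 2)) :
    (∀ u : ℝ, s (-u) = -s u) ∧ (∀ u : ℝ, s (2 * K - u) = s u) ∧
      (∀ u : ℝ, s (u + 4 * K) = s u) := by
  have hd : ∀ u, HasDerivAt s (deriv s u) u := fun u ↦ (hs u).hasDerivAt
  have hd' : ∀ u, HasDerivAt (deriv s) (-2 * s u ^ 3) u := fun u ↦
    hode u ▸ (hs' u).hasDerivAt
  have henergy : ∀ u, deriv s u ^ 2 + s u ^ 4 = 1 := by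
    have hder : ∀ u, HasDerivAt (fun u ↦ deriv s u ^ 2 + s u ^ 4) 0 u := fun u ↦
      (((hd' u).fun_pow 2).fun_add ((hd u).fun_pow 4)).congr_deriv (by push_cast; ring)
    intro u
    have := is_const_of_deriv_eq_zero (fun u ↦ (hder u).differentiableAt)
      (fun u ↦ (hder u).deriv) u 0
    simpa [h0, h1] using this
  have hbound : ∀ u, |s u| ≤ 1 := fun u ↦ by
    rw [← pow_le_one_iff_of_nonneg (abs_nonneg _) (n := 4) (by norm_num),
      Even.pow_abs (by decide)]
    nlinarith [henergy u, sq_nonneg (deriv s u)]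
  have hodd : ∀ u, s (-u) = -s u := fun u ↦ by
    have hx : ∀ t, HasDerivAt (fun t ↦ -s (-t)) (1 * deriv s (-t)) t := fun t ↦
      ((hd (-t)).comp t (hasDerivAt_neg t)).neg.congr_deriv (by ring)
    have hy : ∀ t, HasDerivAt (fun t ↦ deriv s (-t)) (1 * (-2 * (-s (-t)) ^ 3)) t := fun t ↦
      ((hd' (-t)).comp t (hasDerivAt_neg t)).congr_deriv (by ring)
    have := (snoidal_system_unique (w := fun _ ↦ 1) (t₀ := 0) (by simp) hx hy
      (by simpa only [one_mul] using hd) (by simpa only [one_mul] using hd')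
      (by simpa using fun t ↦ hbound (-t)) hbound
      (by simp [h0]) (by simp) u).1
    linarith
  have hcont : Continuous fun θ : ℝ ↦ 1 / √(1 + sin θ ^ 2) :=
    continuous_const.div (by fun_prop) fun θ ↦ (sqrt_pos.mpr (by positivity)).ne'
  have hsK : deriv s K = 0 := by
    let F : ℝ → ℝ := fun t ↦ ∫ θ in (0:ℝ)..t, 1 / √(1 + sin θ ^ 2)
    have hF : ∀ t, HasDerivAt F (1 / √(1 + sin t ^ 2)) t := fun t ↦
      intervalIntegral.integral_hasDerivAt_right (hcont.intervalIntegrable _ _)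
        (hcont.stronglyMeasurableAtFilter _ _) hcont.continuousAt
    have hw : ∀ t : ℝ, |1 / √(1 + sin t ^ 2)| ≤ 1 := fun t ↦ by
      rw [abs_of_nonneg (by positivity)]
      exact div_le_one_of_le₀ (one_le_sqrt.mpr (by nlinarith [sq_nonneg (sin t)]))
        (sqrt_nonneg _)
    have hsin : ∀ t, HasDerivAt sin (1 / √(1 + sin t ^ 2) * (cos t * √(1 + sin t ^ 2))) t :=
      fun t ↦ by
        have hne : √(1 + sin t ^ 2) ≠ 0 := (sqrt_pos.mpr (by positivity)).ne'
        convert hasDerivAt_sin t using 1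
        field_simp
    have := (snoidal_system_unique (x := s ∘ F) (y := deriv s ∘ F) (t₀ := 0) hw
      (fun t ↦ by simpa only [mul_comm, Function.comp] using (hd (F t)).comp t (hF t))
      (fun t ↦ by
        rw [mul_comm]
        exact (hd' (F t)).comp t (hF t))
      hsin hasDerivAt_cos_mul_sqrt (fun t ↦ hbound _) abs_sin_le_one
      (by simp [F, h0]) (by simp [F, h1]) (π / 2)).2
    simpa [F, hK] using this
  have hrefl : ∀ u, s (2 * K - u) = s u := fun u ↦ by
    have hx : ∀ t, HasDerivAt (fun t ↦ s (2 * K - t)) (1 * -deriv s (2 * K - t)) t := fun t ↦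
      ((hd (2 * K - t)).comp t ((hasDerivAt_id t).const_sub (2 * K))).congr_deriv (by ring)
    have hy : ∀ t, HasDerivAt (fun t ↦ -deriv s (2 * K - t))
        (1 * (-2 * s (2 * K - t) ^ 3)) t := fun t ↦
      ((hd' (2 * K - t)).comp t ((hasDerivAt_id t).const_sub (2 * K))).neg.congr_deriv (by ring)
    have hKK : 2 * K - K = K := by ring
    exact (snoidal_system_unique (w := fun _ ↦ 1) (t₀ := K) (by simp) hx hy
      (by simpa only [one_mul] using hd) (by simpa only [one_mul] using hd')
      (fun t ↦ hbound _) hbound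
      (by simp only [hKK]) (by simp only [hKK, hsK, neg_zero]) u).1
  refine ⟨hodd, hrefl, fun u ↦ ?_⟩
  rw [← hrefl, show 2 * K - (u + 4 * K) = -(2 * K - -u) by ring, hodd, hrefl, hodd, neg_neg]
end

section
/- Let s : ℝ → ℝ be twice differentiable with s''(u) = -2 s(u)^3 for all u, s(0) = 0, s'(0) = 1, and let K = ∫₀^{π/2} dθ / √(1 + sin²θ). Then for every u ∈ ℝ the Fourier (q-series) expansion holds: s(u) = (2π/K) · Σ_{n=0}^∞ [ (−1)ⁿ e^{−(n+1/2)π} / (1 + e^{−(2n+1)π}) ] · sin( (2n+1) π u / (2K) ), the series converging absolutely and uniformly on ℝ. -/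
open Real Filter

/-- The telescoping sum over `ℤ` of a sequence with limits `1` at `+∞` and `-1` at `-∞`. -/
theorem tsum_shift_sub_self {t : ℤ → ℂ} (hs : Summable fun m => t (m + 1) - t m)
    (htop : Tendsto (fun n : ℕ => t n) atTop (nhds 1))
    (hbot : Tendsto (fun n : ℕ => t (-n)) atTop (nhds (-1))) :
    ∑' m, (t (m + 1) - t m) = 2 := by
  have hinj : Function.Injective fun n : ℕ => -((n : ℤ) + 1) := fun a b h => by
    simp only at h; omega
  have h1 : HasSum (fun n : ℕ => t ((n : ℤ) + 1) - t n) (1 - t 0) := by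
    have hs' : Summable fun n : ℕ => t ((n : ℤ) + 1) - t n :=
      hs.comp_injective Nat.cast_injective
    rw [hs'.hasSum_iff_tendsto_nat]
    have h := fun n : ℕ => Finset.sum_range_sub (fun i : ℕ => t i) n
    push_cast at h
    simp only [h]
    exact htop.sub_const _
  have h2 : HasSum (fun n : ℕ => t (-((n : ℤ) + 1) + 1) - t (-((n : ℤ) + 1))) (t 0 + 1) := by
    have hs' : Summable fun n : ℕ => t (-((n : ℤ) + 1) + 1) - t (-((n : ℤ) + 1)) :=
      hs.comp_injective hinj
    rw [hs'.hasSum_iff_tendsto_nat]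
    have h := fun n : ℕ => Finset.sum_range_sub' (fun i : ℕ => t (-i)) n
    push_cast at h
    have h' : ∀ n : ℕ, -((n : ℤ) + 1) + 1 = -n := fun n => by ring
    simp only [h', h, neg_zero]
    simpa using hbot.const_sub (t 0)
  rw [(HasSum.of_nat_of_neg_add_one (f := fun m : ℤ => t (m + 1) - t m) h1 h2).tsum_eq]
  ring

/-- Sums over a shear of `ℤ × ℤ`: a product of two series as an iterated sum along diagonals. -/
theorem tsum_mul_tsum_shear {c d : ℤ → ℂ} (hc : Summable fun m => ‖c m‖)
    (hd : Summable fun m => ‖d m‖) :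
    HasSum (fun k => ∑' m, c (m + k) * d m) ((∑' m, c m) * ∑' m, d m) := by
  let e : ℤ × ℤ ≃ ℤ × ℤ :=
    { toFun := fun p => (p.2 + p.1, p.2)
      invFun := fun p => (p.1 - p.2, p.2)
      left_inv := fun p => by simp
      right_inv := fun p => by simp }
  have hs : Summable fun p : ℤ × ℤ => c p.1 * d p.2 := summable_mul_of_summable_norm hc hd
  have hs' : HasSum (fun p : ℤ × ℤ => c (p.2 + p.1) * d p.2) ((∑' m, c m) * ∑' m, d m) := by
    rw [tsum_mul_tsum_of_summable_norm hc hd]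
    exact (e.hasSum_iff (f := fun p : ℤ × ℤ => c p.1 * d p.2)).2 hs.hasSum
  exact hs'.prod_fiberwise fun k => (hs'.summable.prod_factor k).hasSum

/-- If the products `c (m + k) * c m` and `c (m + k) * c m ^ 2` split into partial fractions with
coefficients `r`, `p`, `q` depending only on the distance `k`, then the cube of `∑ c` is
`∑ c ^ 3` plus a multiple of `∑ c` determined by `r`, `p`, `q` alone. -/
theorem tsum_cube_of_partialFractions {c t r p q : ℤ → ℂ} (hc : Summable fun m => ‖c m‖)
    (hct : Summable fun m => c m * t m)
    (hr0 : r 0 = 0) (hp0 : p 0 = 0) (hq0 : q 0 = 0) (hr1 : r 1 ≠ 0)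
    (hr : ∀ k, r (-k) = -r k)
    (htop : Tendsto (fun n : ℕ => t n) atTop (nhds 1))
    (hbot : Tendsto (fun n : ℕ => t (-n)) atTop (nhds (-1)))
    (h2 : ∀ k ≠ 0, ∀ m, c (m + k) * c m = r k * (t (m + k) - t m))
    (h3 : ∀ k ≠ 0, ∀ m, c (m + k) * c m ^ 2 =
      p k * c m - q k * c (m + k) - r k * (c m * t m)) :
    (∑' m, c m) ^ 3 = ∑' m, c m ^ 3 +
      (∑' k : ℤ, 2 * k * r k + (∑' k, (p k - q k + p (-k) - q (-k))) / 2) * ∑' m, c m := by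
  have hcs : Summable c := hc.of_norm
  have hcc : ∀ k, Summable fun m => c (m + k) * c m := fun k => by
    have h := (summable_mul_of_summable_norm hc hc).comp_injective
      (i := fun m : ℤ => (m + k, m)) (fun a b h => (Prod.mk.inj h).2)
    exact h
  have hd1 : Summable fun m => t (m + 1) - t m := by
    refine ((hcc 1).mul_left (r 1)⁻¹).congr fun m => ?_
    rw [h2 1 one_ne_zero m, inv_mul_cancel_left₀ hr1]
  have hd1k : ∀ k, Summable fun m => t (m + k + 1) - t (m + k) := fun k =>
    hd1.comp_injective (i := fun m : ℤ => m + k) (fun a b h => by simpa using h)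
  have hT : ∀ k : ℤ, HasSum (fun m => t (m + k) - t m) (2 * k) := by
    have hstep : ∀ k : ℤ, HasSum (fun m => t (m + k + 1) - t (m + k)) 2 := fun k => by
      have := (Equiv.addRight k).tsum_eq (fun m => t (m + 1) - t m)
      rw [tsum_shift_sub_self hd1 htop hbot] at this
      rw [← this]
      exact (hd1k k).hasSum
    intro k
    induction k using Int.induction_on with
    | zero => simp
    | succ k ih =>
      convert! (hstep k).add ih using 1
      · funext m; rw [← add_assoc]; ring
      · push_cast; ring
    | pred k ih =>
      convert! ih.sub (hstep (-k - 1)) using 1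
      · funext m; rw [show m + (-(k : ℤ) - 1) + 1 = m + -k by ring]; ring
      · push_cast; ring
  set f := ∑' m, c m with hf
  -- the square
  have hsq : f * f = ∑' m, c m ^ 2 + ∑' k : ℤ, 2 * k * r k := by
    have h := tsum_mul_tsum_shear hc hc
    have h' := h.sub (hasSum_ite_eq (0 : ℤ) (∑' m, c m ^ 2))
    have h'' := h'.tsum_eq
    rw [eq_sub_iff_add_eq] at h''
    rw [← h'', add_comm]
    congr 1
    refine tsum_congr fun k => ?_
    by_cases hk : k = 0
    · subst hk; simp [sq]
    · rw [tsum_congr (h2 k hk), tsum_mul_left, (hT k).tsum_eq, if_neg hk]; ring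
  -- the product of the sum with the sum of squares
  have hsqs : Summable fun m => ‖c m ^ 2‖ := by
    have := (hcc 0).norm
    simpa [sq] using this
  have hcub : f * ∑' m, c m ^ 2 =
      ∑' m, c m ^ 3 + (∑' k, (p k - q k + p (-k) - q (-k))) / 2 * f := by
    have h := tsum_mul_tsum_shear hc hsqs
    have h' := h.sub (hasSum_ite_eq (0 : ℤ) (∑' m, c m ^ 3))
    have h'' := h'.add ((Equiv.neg ℤ).hasSum_iff.2 h')
    have key : ∀ k, ((∑' m, c (m + k) * c m ^ 2) - if k = 0 then ∑' m, c m ^ 3 else 0) =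
        (p k - q k) * f - r k * ∑' m, c m * t m := by
      intro k
      by_cases hk : k = 0
      · subst hk
        have : ∀ m, c m * c m ^ 2 = c m ^ 3 := fun m => by ring
        simp [hr0, hp0, hq0, this]
      · have hsh : HasSum (fun m => c (m + k)) f := (Equiv.addRight k).hasSum_iff.2 hcs.hasSum
        rw [tsum_congr (h3 k hk), if_neg hk,
          (((hcs.hasSum.mul_left (p k)).sub (hsh.mul_left (q k))).sub
            (hct.hasSum.mul_left (r k))).tsum_eq]
        ring
    simp only [Function.comp_def, Equiv.neg_apply, key, hr] at h''
    have h4 := h''.tsum_eq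
    rw [tsum_congr (g := fun k => (p k - q k + p (-k) - q (-k)) * f) (fun k => by ring),
      tsum_mul_right] at h4
    linear_combination -h4 / 2
  calc f ^ 3 = f * (f * f) := by ring
    _ = _ := by rw [hsq, mul_add, hcub]; ring

/-- The nodes `(m + 1/2) π`. -/
noncomputable def halfNode (m : ℤ) : ℝ := ((m : ℝ) + 1 / 2) * π

/-- The alternating translates of the hyperbolic secant. -/
noncomputable def altSech (m : ℤ) (z : ℂ) : ℂ := (-1) ^ m / Complex.cosh (z + halfNode m)

/-- The alternating sum of the translates of the hyperbolic secant by `(m + 1/2) π`. -/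
noncomputable def sechSum (z : ℂ) : ℂ := ∑' m : ℤ, altSech m z

theorem halfNode_nonneg (n : ℕ) : 0 ≤ halfNode n := by
  unfold halfNode; positivity

theorem halfNode_neg_add_one (n : ℤ) : halfNode (-(n + 1)) = -halfNode n := by
  unfold halfNode; push_cast; ring

theorem halfNode_add (m k : ℤ) : halfNode (m + k) = halfNode m + k * π := by
  unfold halfNode; push_cast; ring

theorem pi_div_two_le_abs_halfNode (m : ℤ) : π / 2 ≤ |halfNode m| := by
  have h : (1 : ℝ) / 2 ≤ |(m : ℝ) + 1 / 2| := by
    rcases le_or_gt 0 m with h | h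
    · have : (0 : ℝ) ≤ m := by exact_mod_cast h
      rw [abs_of_nonneg (by linarith)]; linarith
    · have : (m : ℝ) ≤ -1 := by exact_mod_cast Int.le_sub_one_of_lt h
      rw [abs_of_neg (by linarith)]; linarith
  unfold halfNode
  rw [abs_mul, abs_of_pos pi_pos]
  nlinarith [pi_pos]

theorem summable_exp_neg_halfNode : Summable fun n : ℕ => Real.exp (-halfNode n) := by
  have h : ∀ n : ℕ, Real.exp (-halfNode n) = Real.exp (-(π / 2)) * Real.exp (-π) ^ n := fun n => by
    rw [← Real.exp_nat_mul, ← Real.exp_add]; unfold halfNode; congr 1; push_cast; ring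
  simp only [h]
  exact (summable_geometric_of_lt_one (Real.exp_pos _).le
    (Real.exp_zero ▸ Real.exp_lt_exp.2 (neg_lt_zero.2 pi_pos))).mul_left _

theorem summable_exp_neg_abs_halfNode : Summable fun m : ℤ => Real.exp (-|halfNode m|) := by
  refine Summable.of_nat_of_neg_add_one ?_ ?_
  · simpa only [abs_of_nonneg (halfNode_nonneg _)] using summable_exp_neg_halfNode
  · simpa only [halfNode_neg_add_one, abs_neg, abs_of_nonneg (halfNode_nonneg _)]
      using summable_exp_neg_halfNode

/-- A lower bound for the denominators of `altSech`, with the growth of the hyperbolic cosine. -/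
def CoshBound (c : ℝ) (z : ℂ) : Prop :=
  ∀ m : ℤ, c * Real.exp |halfNode m| ≤ ‖Complex.cosh (z + halfNode m)‖

namespace CoshBound

variable {c : ℝ} {z : ℂ}

theorem cosh_ne_zero (hc : 0 < c) (h : CoshBound c z) (m : ℤ) :
    Complex.cosh (z + halfNode m) ≠ 0 :=
  norm_pos_iff.1 ((mul_pos hc (Real.exp_pos _)).trans_le (h m))

theorem norm_altSech_le (hc : 0 < c) (h : CoshBound c z) (m : ℤ) :
    ‖altSech m z‖ ≤ c⁻¹ * Real.exp (-|halfNode m|) := by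
  rw [altSech, norm_div, norm_zpow, norm_neg, norm_one, one_zpow, one_div, Real.exp_neg,
    ← mul_inv]
  exact inv_anti₀ (mul_pos hc (Real.exp_pos _)) (h m)

theorem norm_tanh_le (hc : 0 < c) (h : CoshBound c z) (m : ℤ) :
    ‖Complex.tanh (z + halfNode m)‖ ≤ 1 + c⁻¹ := by
  have hne := h.cosh_ne_zero hc m
  have hle : ‖(Complex.cosh (z + halfNode m))⁻¹‖ ≤ c⁻¹ := by
    rw [norm_inv]
    refine inv_anti₀ hc (le_trans ?_ (h m))
    nlinarith [Real.one_le_exp (abs_nonneg (halfNode m))]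
  have hsq : Complex.tanh (z + halfNode m) ^ 2 =
      1 - (Complex.cosh (z + halfNode m))⁻¹ ^ 2 := by
    rw [Complex.tanh_eq_sinh_div_cosh]
    field_simp
    linear_combination -Complex.cosh_sq (z + halfNode m)
  have hn : ‖Complex.tanh (z + halfNode m)‖ ^ 2 ≤ 1 + c⁻¹ ^ 2 := by
    rw [← norm_pow, hsq]
    refine (norm_sub_le _ _).trans ?_
    rw [norm_one, norm_pow]
    gcongr
  have hci : 0 < c⁻¹ := inv_pos.2 hc
  refine le_of_sq_le_sq ?_ (by positivity)
  nlinarith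

theorem summable_altSech (hc : 0 < c) (h : CoshBound c z) : Summable fun m => ‖altSech m z‖ :=
  (summable_exp_neg_abs_halfNode.mul_left c⁻¹).of_nonneg_of_le (fun _ => norm_nonneg _)
    (h.norm_altSech_le hc)

theorem tendsto_tanh_atTop (hc : 0 < c) (h : CoshBound c z) :
    Tendsto (fun n : ℕ => Complex.tanh (z + halfNode n)) atTop (nhds 1) := by
  rw [tendsto_iff_norm_sub_tendsto_zero]
  have hlim := summable_exp_neg_halfNode.tendsto_atTop_zero.const_mul (Real.exp (-z.re) * c⁻¹)
  rw [mul_zero] at hlim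
  refine squeeze_zero (fun _ => norm_nonneg _) (fun n => ?_) hlim
  have hne := h.cosh_ne_zero hc n
  have heq : Complex.tanh (z + halfNode n) - 1 =
      -(Complex.exp (-(z + halfNode n)) / Complex.cosh (z + halfNode n)) := by
    rw [← Complex.cosh_sub_sinh, Complex.tanh_eq_sinh_div_cosh]
    field_simp
    ring
  have hb := h n
  rw [abs_of_nonneg (halfNode_nonneg n)] at hb
  rw [heq, norm_neg, norm_div, Complex.norm_exp]
  have hre : (-(z + (halfNode n : ℂ))).re = -z.re - halfNode n := by simp; ring
  have h1 : 1 ≤ Real.exp (halfNode n) := Real.one_le_exp (halfNode_nonneg n)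
  rw [hre, sub_eq_add_neg, Real.exp_add, div_le_iff₀ (norm_pos_iff.2 hne)]
  calc Real.exp (-z.re) * Real.exp (-halfNode n)
      = Real.exp (-z.re) * c⁻¹ * Real.exp (-halfNode n) * (c * 1) := by field_simp
    _ ≤ Real.exp (-z.re) * c⁻¹ * Real.exp (-halfNode n) * (c * Real.exp (halfNode n)) := by gcongr
    _ ≤ _ := by gcongr

theorem neg (h : CoshBound c z) : CoshBound c (-z) := fun m => by
  have := h (-(m + 1))
  rw [halfNode_neg_add_one, abs_neg] at this
  rwa [← Complex.cosh_neg, neg_add, neg_neg, ← Complex.ofReal_neg]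

theorem tendsto_tanh_atBot (hc : 0 < c) (h : CoshBound c z) :
    Tendsto (fun n : ℕ => Complex.tanh (z + halfNode (-n))) atTop (nhds (-1)) := by
  rw [← tendsto_add_atTop_iff_nat 1]
  refine (h.neg.tendsto_tanh_atTop hc).neg.congr fun n => ?_
  rw [← Complex.tanh_neg]
  push_cast
  rw [halfNode_neg_add_one]
  push_cast
  ring_nf

end CoshBound

theorem sinh_int_mul_pi_ne_zero {k : ℤ} (hk : k ≠ 0) : Complex.sinh ((k * π : ℝ) : ℂ) ≠ 0 := by
  rw [← Complex.ofReal_sinh, Complex.ofReal_ne_zero, Ne, Real.sinh_eq_zero]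
  exact mul_ne_zero (Int.cast_ne_zero.2 hk) pi_ne_zero

theorem inv_cosh_mul_inv_cosh {w d : ℂ} (h1 : Complex.cosh w ≠ 0) (h2 : Complex.cosh (w + d) ≠ 0)
    (hd : Complex.sinh d ≠ 0) :
    (Complex.cosh (w + d))⁻¹ * (Complex.cosh w)⁻¹ =
      (Complex.tanh (w + d) - Complex.tanh w) / Complex.sinh d := by
  have h : Complex.sinh d = Complex.sinh (w + d) * Complex.cosh w -
      Complex.cosh (w + d) * Complex.sinh w := by
    rw [← Complex.sinh_sub]; ring_nf
  rw [Complex.tanh_eq_sinh_div_cosh, Complex.tanh_eq_sinh_div_cosh]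
  field_simp
  rw [h]
  ring

theorem inv_cosh_mul_inv_cosh_sq {w d : ℂ} (h1 : Complex.cosh w ≠ 0)
    (h2 : Complex.cosh (w + d) ≠ 0) (hd : Complex.sinh d ≠ 0) :
    (Complex.cosh (w + d))⁻¹ * (Complex.cosh w)⁻¹ ^ 2 =
      Complex.cosh d / Complex.sinh d ^ 2 * (Complex.cosh w)⁻¹ -
      1 / Complex.sinh d ^ 2 * (Complex.cosh (w + d))⁻¹ -
      1 / Complex.sinh d * ((Complex.cosh w)⁻¹ * Complex.tanh w) := by
  have h := Complex.cosh_add w d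
  have hw := Complex.cosh_sq w
  have hdd := Complex.cosh_sq d
  rw [Complex.tanh_eq_sinh_div_cosh]
  field_simp
  rw [h]
  linear_combination (-(Complex.cosh w)^2) * hdd - Complex.sinh d ^ 2 * hw

theorem exists_sechSum_cube : ∃ C : ℂ, ∀ c > 0, ∀ z, CoshBound c z →
    sechSum z ^ 3 = ∑' m, altSech m z ^ 3 + C * sechSum z := by
  let S : ℤ → ℂ := fun k => Complex.sinh ((k * π : ℝ) : ℂ)
  let r : ℤ → ℂ := fun k => (-1) ^ k / S k
  let p : ℤ → ℂ := fun k => (-1) ^ k * Complex.cosh ((k * π : ℝ) : ℂ) / S k ^ 2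
  let q : ℤ → ℂ := fun k => 1 / S k ^ 2
  have hS0 : S 0 = 0 := by simp [S]
  have hsq : ∀ m : ℤ, ((-1 : ℂ) ^ m) ^ 2 = 1 := fun m => by
    rw [← zpow_natCast, ← zpow_mul, mul_comm, zpow_mul]; simp
  refine ⟨∑' k : ℤ, 2 * k * r k + (∑' k, (p k - q k + p (-k) - q (-k))) / 2, fun c hc z hz => ?_⟩
  have hne := hz.cosh_ne_zero hc
  refine tsum_cube_of_partialFractions (t := fun m => Complex.tanh (z + halfNode m))
    (hz.summable_altSech hc) ?_ (by simp [r, hS0]) (by simp [p, hS0]) (by simp [q, hS0]) ?_ ?_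
    (hz.tendsto_tanh_atTop hc) (hz.tendsto_tanh_atBot hc) ?_ ?_
  · refine Summable.of_norm_bounded ((hz.summable_altSech hc).mul_right (1 + c⁻¹)) fun m => ?_
    rw [norm_mul]
    exact mul_le_mul_of_nonneg_left (hz.norm_tanh_le hc m) (norm_nonneg _)
  · exact div_ne_zero (zpow_ne_zero _ (by norm_num)) (sinh_int_mul_pi_ne_zero one_ne_zero)
  · intro k
    simp only [r, S, Int.cast_neg, neg_mul, Complex.ofReal_neg, Complex.sinh_neg, div_neg]
    rw [zpow_neg, ← inv_zpow, inv_neg, inv_one]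
  · intro k hk m
    have h := hne (m + k)
    simp only [altSech, halfNode_add, Complex.ofReal_add, ← add_assoc] at h ⊢
    have := inv_cosh_mul_inv_cosh (hne m) h (sinh_int_mul_pi_ne_zero hk)
    simp only [r, S]
    rw [zpow_add₀ (by norm_num), div_eq_mul_inv, div_eq_mul_inv]
    linear_combination (-1) ^ k * ((-1) ^ m) ^ 2 * this +
      (-1) ^ k * (Complex.tanh (z + halfNode m + (k * π : ℝ)) - Complex.tanh (z + halfNode m)) /
        Complex.sinh (k * π : ℝ) * hsq m
  · intro k hk m
    have h := hne (m + k)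
    simp only [altSech, halfNode_add, Complex.ofReal_add, ← add_assoc] at h ⊢
    have := inv_cosh_mul_inv_cosh_sq (hne m) h (sinh_int_mul_pi_ne_zero hk)
    simp only [r, p, q, S]
    have hm : ((-1 : ℂ) ^ m) ^ 3 = (-1) ^ m := by linear_combination (-1) ^ m * hsq m
    rw [zpow_add₀ (by norm_num)]
    linear_combination (-1) ^ m * (-1) ^ k * this + (-1) ^ k *
      ((Complex.cosh (z + halfNode m + (k * π : ℝ)))⁻¹ * (Complex.cosh (z + halfNode m))⁻¹ ^ 2) * hm

theorem CoshBound.hasDerivAt_altSech {c : ℝ} {z : ℂ} (hc : 0 < c) (h : CoshBound c z) (m : ℤ) :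
    HasDerivAt (altSech m) (-(altSech m z * Complex.tanh (z + halfNode m))) z := by
  have hne := h.cosh_ne_zero hc m
  have hd := (hasDerivAt_const z ((-1 : ℂ) ^ m)).div ((hasDerivAt_id z).add_const _).ccosh hne
  refine hd.congr_deriv ?_
  simp only [altSech, Complex.tanh_eq_sinh_div_cosh, id]
  field_simp
  ring

theorem CoshBound.hasDerivAt_altSech_mul_tanh {c : ℝ} {z : ℂ} (hc : 0 < c) (h : CoshBound c z)
    (m : ℤ) :
    HasDerivAt (fun z => -(altSech m z * Complex.tanh (z + halfNode m)))
      (altSech m z - 2 * altSech m z ^ 3) z := by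
  have hne := h.cosh_ne_zero hc m
  have hsq : ((-1 : ℂ) ^ m) ^ 3 = (-1) ^ m := by
    have : ((-1 : ℂ) ^ m) ^ 2 = 1 := by
      rw [← zpow_natCast, ← zpow_mul, mul_comm, zpow_mul]; simp
    linear_combination (-1) ^ m * this
  have hadd := (hasDerivAt_id z).add_const (halfNode m : ℂ)
  have ht := hadd.csinh.div hadd.ccosh hne
  have hd := ((h.hasDerivAt_altSech hc m).mul ht).neg
  have hfun : (fun z => -(altSech m z * Complex.tanh (z + halfNode m))) =
      -(altSech m * ((fun x => Complex.sinh (id x + (halfNode m : ℂ))) /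
        fun x => Complex.cosh (id x + (halfNode m : ℂ)))) := by
    funext w; simp [Complex.tanh_eq_sinh_div_cosh]
  rw [hfun]
  refine hd.congr_deriv ?_
  simp only [altSech, Complex.tanh_eq_sinh_div_cosh, id, Pi.div_apply, div_pow, hsq]
  field_simp
  linear_combination -2 * Complex.cosh_sq (z + halfNode m)

/-- The differential equation of `sechSum`, with a constant independent of the point. -/
theorem exists_sechSum_ode : ∃ α : ℂ, ∀ (U : Set ℂ) (c : ℝ), IsOpen U → 0 < c →
    (∀ z ∈ U, CoshBound c z) → ∀ z ∈ U,
      HasDerivAt sechSum (deriv sechSum z) z ∧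
      HasDerivAt (deriv sechSum) (α * sechSum z - 2 * sechSum z ^ 3) z := by
  obtain ⟨C, hC⟩ := exists_sechSum_cube
  refine ⟨1 + 2 * C, fun U c hU hc hb z hz => ?_⟩
  have hsum := summable_exp_neg_abs_halfNode.mul_left c⁻¹
  have hd1 : ∀ m, ∀ w ∈ U, HasDerivAt (altSech m)
      (-(altSech m w * Complex.tanh (w + halfNode m))) w :=
    fun m w hw => (hb w hw).hasDerivAt_altSech hc m
  have hdiff : ∀ m, DifferentiableOn ℂ (altSech m) U :=
    fun m w hw => (hd1 m w hw).differentiableAt.differentiableWithinAt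
  have hle : ∀ m, ∀ w ∈ U, ‖altSech m w‖ ≤ c⁻¹ * Real.exp (-|halfNode m|) :=
    fun m w hw => (hb w hw).norm_altSech_le hc m
  have hD : DifferentiableOn ℂ sechSum U :=
    Complex.differentiableOn_tsum_of_summable_norm hsum hdiff hU hle
  let F : ℤ → ℂ → ℂ := fun m w => -(altSech m w * Complex.tanh (w + halfNode m))
  have hF : ∀ m, ∀ w ∈ U, HasDerivAt (F m) (altSech m w - 2 * altSech m w ^ 3) w :=
    fun m w hw => (hb w hw).hasDerivAt_altSech_mul_tanh hc m
  have hFle : ∀ m, ∀ w ∈ U, ‖F m w‖ ≤ c⁻¹ * Real.exp (-|halfNode m|) * (1 + c⁻¹) :=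
    fun m w hw => by
      rw [norm_neg, norm_mul]
      exact mul_le_mul (hle m w hw) ((hb w hw).norm_tanh_le hc m) (norm_nonneg _) (by positivity)
  have hFdiff : ∀ m, DifferentiableOn ℂ (F m) U :=
    fun m w hw => (hF m w hw).differentiableAt.differentiableWithinAt
  have hderiv : Set.EqOn (deriv sechSum) (fun w => ∑' m, F m w) U := fun w hw => by
    have h := Complex.hasSum_deriv_of_summable_norm hsum hdiff hU hle hw
    simp only [(hd1 _ w hw).deriv] at h
    exact h.tsum_eq.symm
  have hD2 :=
    Complex.differentiableOn_tsum_of_summable_norm (hsum.mul_right (1 + c⁻¹)) hFdiff hU hFle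
  have hnhds : U ∈ nhds z := hU.mem_nhds hz
  refine ⟨(hD.differentiableAt hnhds).hasDerivAt, ?_⟩
  have h2 := (hD2.differentiableAt hnhds).hasDerivAt.congr_of_eventuallyEq
    (Filter.eventuallyEq_of_mem hnhds hderiv)
  refine h2.congr_deriv ?_
  have h := Complex.hasSum_deriv_of_summable_norm (hsum.mul_right (1 + c⁻¹)) hFdiff hU hFle hz
  simp only [(hF _ z hz).deriv] at h
  have hs := (hb z hz).summable_altSech hc
  have hs3 : Summable fun m => altSech m z ^ 3 := by
    have h' := (hs.of_norm.hasSum.sub h)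
    refine (h'.summable.mul_left (1 / 2)).congr fun m => ?_
    ring
  rw [← h.tsum_eq, hs.of_norm.tsum_sub (hs3.mul_left 2), tsum_mul_left]
  have := hC c hc z (hb z hz)
  change sechSum z - _ = _
  linear_combination 2 * this

theorem norm_cosh_sq (w : ℂ) :
    ‖Complex.cosh w‖ ^ 2 = Real.sinh w.re ^ 2 + Real.cos w.im ^ 2 := by
  have h : Complex.cosh w = ((Real.cosh w.re * Real.cos w.im : ℝ) : ℂ) +
      ((Real.sinh w.re * Real.sin w.im : ℝ) : ℂ) * Complex.I := by
    conv_lhs => rw [← Complex.re_add_im w, Complex.cosh_add, Complex.cosh_mul_I, Complex.sinh_mul_I]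
    push_cast
    ring
  rw [h, ← Complex.normSq_eq_norm_sq, Complex.normSq_add_mul_I, mul_pow, mul_pow, Real.cosh_sq,
    Real.sin_sq]
  ring

theorem exp_div_four_le_sinh {u : ℝ} (hu : 1 / 2 ≤ u) : Real.exp u / 4 ≤ Real.sinh u := by
  rw [Real.sinh_eq]
  have h1 : 2 ≤ Real.exp u * Real.exp u := by
    rw [← Real.exp_add]
    linarith [Real.add_one_le_exp (u + u)]
  have h2 : Real.exp u * Real.exp (-u) = 1 := by rw [← Real.exp_add]; simp
  nlinarith [Real.exp_pos u, Real.exp_pos (-u)]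

theorem exp_sub_le_exp_abs_add {r x a : ℝ} (hx : |x| ≤ r) :
    Real.exp (-r) * Real.exp |a| ≤ Real.exp |x + a| := by
  rw [← Real.exp_add]
  refine Real.exp_le_exp.2 ?_
  have := abs_sub_abs_le_abs_sub a (-x)
  rw [abs_neg, sub_neg_eq_add, add_comm a x] at this
  linarith

theorem coshBound_of_abs_re_lt_one {z : ℂ} (hz : |z.re| < 1) :
    CoshBound (Real.exp (-1) / 4) z := fun m => by
  have hre : (z + (halfNode m : ℂ)).re = z.re + halfNode m := by simp
  have habs : 1 / 2 ≤ |z.re + halfNode m| := by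
    have h1 := abs_sub_abs_le_abs_sub (halfNode m) (-z.re)
    rw [abs_neg, sub_neg_eq_add, add_comm (halfNode m)] at h1
    linarith [pi_div_two_le_abs_halfNode m, pi_gt_three]
  have h := norm_cosh_sq (z + halfNode m)
  rw [hre] at h
  have h2 : |Real.sinh (z.re + halfNode m)| ≤ ‖Complex.cosh (z + halfNode m)‖ := by
    refine abs_le_of_sq_le_sq' ?_ (norm_nonneg _) |> abs_le.2
    rw [h]; linarith [sq_nonneg (Real.cos (z + (halfNode m : ℂ)).im)]
  rw [Real.abs_sinh] at h2
  have := exp_div_four_le_sinh habs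
  have := exp_sub_le_exp_abs_add (a := halfNode m) hz.le
  linarith

theorem coshBound_of_abs_im_lt_one {z : ℂ} {r : ℝ} (hr : |z.re| < r) (hz : |z.im| < 1) :
    CoshBound (Real.exp (-r) / 4) z := fun m => by
  have hre : (z + (halfNode m : ℂ)).re = z.re + halfNode m := by simp
  have him : (z + (halfNode m : ℂ)).im = z.im := by simp
  have h := norm_cosh_sq (z + halfNode m)
  rw [hre, him] at h
  set x := z.re + halfNode m with hx
  have hcos : 1 / 2 ≤ Real.cos z.im := by
    have := Real.one_sub_sq_div_two_le_cos (x := z.im)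
    have : z.im ^ 2 ≤ 1 := by rw [← sq_abs]; exact pow_le_one₀ (abs_nonneg _) hz.le
    linarith
  have hcosh : Real.exp |x| / 2 ≤ Real.cosh x := by
    rw [← Real.cosh_abs, Real.cosh_eq]
    linarith [Real.exp_pos (-|x|)]
  have h2 : Real.cosh x * Real.cos z.im ≤ ‖Complex.cosh (z + halfNode m)‖ := by
    refine le_of_sq_le_sq ?_ (norm_nonneg _)
    rw [h, mul_pow, Real.cosh_sq]
    nlinarith [sq_nonneg (Real.sinh x), Real.cos_sq_le_one z.im]
  have h3 := exp_sub_le_exp_abs_add (a := halfNode m) hr.le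
  have h4 : Real.exp |x| / 2 * (1 / 2) ≤ Real.cosh x * Real.cos z.im :=
    mul_le_mul hcosh hcos (by norm_num) (Real.cosh_pos x).le
  linarith

/-- The alternating series `∑ (-1)ⁿ sinh aₙ / (sinh² aₙ + w)` over the positive nodes `aₙ`. -/
noncomputable def nodeSeries (w : ℝ) : ℝ :=
  ∑' n : ℕ, (-1) ^ n * (Real.sinh (halfNode n) / (Real.sinh (halfNode n) ^ 2 + w))

theorem pi_div_two_le_halfNode (n : ℕ) : π / 2 ≤ halfNode n := by
  simpa only [abs_of_nonneg (halfNode_nonneg n)] using pi_div_two_le_abs_halfNode n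

theorem sinh_halfNode_pos (n : ℕ) : 0 < Real.sinh (halfNode n) :=
  Real.sinh_pos_iff.2 ((by positivity : (0 : ℝ) < π / 2).trans_le (pi_div_two_le_halfNode n))

theorem summable_nodeSeries {w : ℝ} (hw : 0 ≤ w) :
    Summable fun n : ℕ =>
      (-1 : ℝ) ^ n * (Real.sinh (halfNode n) / (Real.sinh (halfNode n) ^ 2 + w)) := by
  refine Summable.of_norm_bounded (summable_exp_neg_halfNode.mul_left 4) fun n => ?_
  have hS := sinh_halfNode_pos n
  rw [norm_mul, norm_pow, norm_neg, norm_one, one_pow, one_mul, Real.norm_of_nonneg (by positivity),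
    Real.exp_neg, div_le_iff₀ (by positivity)]
  have h := exp_div_four_le_sinh (u := halfNode n)
    (by linarith [pi_div_two_le_halfNode n, pi_gt_three])
  have he := Real.exp_pos (halfNode n)
  rw [← div_eq_mul_inv, div_mul_eq_mul_div, le_div_iff₀ he]
  nlinarith

theorem three_mul_sinh_halfNode_le (n : ℕ) :
    3 * Real.sinh (halfNode n) ≤ Real.sinh (halfNode (n + 1)) := by
  have hlt : halfNode n + 3 / 2 ≤ halfNode (n + 1) := by
    rw [halfNode_add]; push_cast; linarith [pi_gt_three]
  have hsum := Real.sinh_add (halfNode n) (3 / 2)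
  have hmono := Real.sinh_strictMono.monotone hlt
  have hs : 3 / 2 ≤ Real.sinh (3 / 2 : ℝ) := (Real.self_le_sinh_iff).2 (by norm_num)
  have hch : Real.sinh (3 / 2) ≤ Real.cosh (3 / 2 : ℝ) := (Real.sinh_lt_cosh _).le
  have hcn : Real.sinh (halfNode n) ≤ Real.cosh (halfNode n) := (Real.sinh_lt_cosh _).le
  have := sinh_halfNode_pos n
  nlinarith

/-- The alternating series is positive as long as its terms decrease. -/
theorem nodeSeries_pos {w : ℝ} (hw : 0 ≤ w) (hw' : w ≤ Real.cosh (π / 2) ^ 2) :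
    0 < nodeSeries w := by
  set b : ℕ → ℝ := fun n => Real.sinh (halfNode n) / (Real.sinh (halfNode n) ^ 2 + w) with hb
  have hbase : 1 ≤ Real.sinh (π / 2) :=
    le_trans (by linarith [pi_gt_three]) ((Real.self_le_sinh_iff).2 (by positivity : 0 ≤ π / 2))
  have hlt : ∀ n, b (n + 1) < b n := fun n => by
    have hS := sinh_halfNode_pos n
    have h3 := three_mul_sinh_halfNode_le n
    have hge : Real.sinh (π / 2) ≤ Real.sinh (halfNode n) :=
      Real.sinh_strictMono.monotone (pi_div_two_le_halfNode n)
    simp only [hb]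
    push_cast
    set S := Real.sinh (halfNode n)
    set S' := Real.sinh (halfNode (n + 1))
    rw [Real.cosh_sq] at hw'
    have hSS : w < S * S' := by nlinarith
    have hS' : 0 < S' := by linarith
    rw [div_lt_div_iff₀ (by positivity) (by positivity)]
    nlinarith [mul_pos (sub_pos.2 hSS) (by linarith : 0 < S' - S)]
  have h := (antitone_nat_of_succ_le fun n => (hlt n).le).alternating_series_le_tendsto
    (summable_nodeSeries hw).hasSum.tendsto_sum_nat 1
  have h01 := hlt 0
  simp only [Finset.sum_range_succ, Finset.sum_range_zero, mul_one, pow_zero, pow_one, one_mul,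
    zero_add] at h
  change _ ≤ nodeSeries w at h
  simp only [hb] at h01
  push_cast at h h01
  linarith

theorem sinh_sq_add_cosh_sq (z a : ℂ) :
    Complex.sinh a ^ 2 + Complex.cosh z ^ 2 = Complex.cosh (z + a) * Complex.cosh (z - a) := by
  rw [Complex.cosh_add, Complex.cosh_sub]
  linear_combination (-Complex.cosh z ^ 2) * Complex.cosh_sq a -
    Complex.sinh a ^ 2 * Complex.cosh_sq z

theorem altSech_add_altSech_neg (z : ℂ) (n : ℕ) :
    altSech n z + altSech (-((n : ℤ) + 1)) z =
      (-1) ^ n * ((Complex.cosh (z + halfNode n))⁻¹ - (Complex.cosh (z - halfNode n))⁻¹) := by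
  have h : (-1 : ℂ) ^ (-((n : ℤ) + 1)) = -(-1) ^ n := by
    rw [zpow_neg, ← inv_zpow, inv_neg, inv_one, zpow_add₀ (by norm_num), zpow_natCast, zpow_one]
    ring
  simp only [altSech, halfNode_neg_add_one, h, zpow_natCast, Complex.ofReal_neg, ← sub_eq_add_neg]
  ring

theorem CoshBound.hasSum_sechSum {c : ℝ} {z : ℂ} (hc : 0 < c) (h : CoshBound c z) :
    HasSum (fun n : ℕ => (-1 : ℂ) ^ n *
      ((Complex.cosh (z + halfNode n))⁻¹ - (Complex.cosh (z - halfNode n))⁻¹)) (sechSum z) := by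
  have hs := (h.summable_altSech hc).of_norm
  have h1 : Summable fun n : ℕ => altSech n z := hs.comp_injective Nat.cast_injective
  have h2 : Summable fun n : ℕ => altSech (-((n : ℤ) + 1)) z :=
    hs.comp_injective (i := fun n : ℕ => -((n : ℤ) + 1)) fun a b h => by
      simp only at h; omega
  have h3 := h1.hasSum.add h2.hasSum
  have h4 : sechSum z = _ :=
    (HasSum.of_nat_of_neg_add_one (f := fun m => altSech m z) h1.hasSum h2.hasSum).tsum_eq
  rw [h4]
  exact h3.congr_fun fun n => (altSech_add_altSech_neg z n).symm

theorem CoshBound.sechSum_eq {c w : ℝ} {z : ℂ} (hc : 0 < c) (h : CoshBound c z)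
    (hw : (w : ℂ) = Complex.cosh z ^ 2) :
    sechSum z = -2 * Complex.sinh z * nodeSeries w := by
  rw [← (h.hasSum_sechSum hc).tsum_eq, nodeSeries, Complex.ofReal_tsum, ← tsum_mul_left]
  refine tsum_congr fun n => ?_
  have h1 := h.cosh_ne_zero hc n
  have h2 : Complex.cosh (z - halfNode n) ≠ 0 := by
    have := h.cosh_ne_zero hc (-((n : ℤ) + 1))
    rwa [halfNode_neg_add_one, Complex.ofReal_neg, ← sub_eq_add_neg] at this
  push_cast
  rw [hw, sinh_sq_add_cosh_sq]
  field_simp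
  rw [Complex.cosh_add, Complex.cosh_sub]
  ring

/-- The elliptic function on the imaginary axis. -/
noncomputable def circSn (y : ℝ) : ℝ := 2 * Real.sin y * nodeSeries (Real.cos y ^ 2)

/-- The elliptic function on the real axis. -/
noncomputable def hypSn (x : ℝ) : ℝ := 2 * Real.sinh x * nodeSeries (Real.cosh x ^ 2)

theorem coshBound_I_mul (y : ℝ) : CoshBound (Real.exp (-1) / 4) (Complex.I * y) :=
  coshBound_of_abs_re_lt_one (by simp)

theorem coshBound_ofReal (x : ℝ) : CoshBound (Real.exp (-(|x| + 1)) / 4) x :=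
  coshBound_of_abs_im_lt_one (by simp) (by simp)

theorem circSn_eq (y : ℝ) : (circSn y : ℂ) = Complex.I * sechSum (Complex.I * y) := by
  rw [(coshBound_I_mul y).sechSum_eq (w := Real.cos y ^ 2) (by positivity)
    (by rw [mul_comm, Complex.cosh_mul_I]; push_cast; rfl), mul_comm Complex.I (y : ℂ),
    Complex.sinh_mul_I, circSn]
  push_cast
  linear_combination (2 * Complex.sin y * nodeSeries (Real.cos y ^ 2)) * Complex.I_sq

theorem hypSn_eq (x : ℝ) : (hypSn x : ℂ) = -sechSum x := by
  rw [(coshBound_ofReal x).sechSum_eq (w := Real.cosh x ^ 2) (by positivity)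
    (by push_cast; rfl), hypSn]
  push_cast
  ring

theorem sechSum_add_pi (z : ℂ) : sechSum (z + π) = -sechSum z := by
  unfold sechSum
  rw [← (Equiv.addRight (1 : ℤ)).tsum_eq (fun m => altSech m z), ← tsum_neg]
  refine tsum_congr fun m => ?_
  simp only [altSech, Equiv.coe_addRight, halfNode_add]
  rw [zpow_add₀ (by norm_num), show z + π + (halfNode m : ℂ) =
    z + ((halfNode m + ((1 : ℤ) : ℝ) * π : ℝ) : ℂ) by push_cast; ring]
  ring

theorem circSn_zero : circSn 0 = 0 := by simp [circSn]

theorem circSn_pi : circSn π = 0 := by simp [circSn]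

theorem circSn_pos {y : ℝ} (h0 : 0 < y) (h1 : y < π) : 0 < circSn y := by
  refine mul_pos (mul_pos two_pos (Real.sin_pos_of_pos_of_lt_pi h0 h1)) (nodeSeries_pos
    (sq_nonneg _) ((Real.cos_sq_le_one y).trans ?_))
  exact one_le_pow₀ (Real.one_le_cosh _)

theorem hypSn_zero : hypSn 0 = 0 := by simp [hypSn]

theorem hypSn_pi_sub (x : ℝ) : hypSn (π - x) = hypSn x := by
  have h1 : hypSn (-x + π) = -hypSn (-x) := by
    have h := hypSn_eq (-x + π)
    rw [Complex.ofReal_add, sechSum_add_pi, ← hypSn_eq] at h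
    exact_mod_cast h
  rw [show π - x = -x + π by ring, h1]
  simp [hypSn]

theorem hypSn_pi : hypSn π = 0 := by
  rw [← hypSn_zero, ← hypSn_pi_sub, sub_self]

theorem hypSn_pos {x : ℝ} (h0 : 0 < x) (h1 : x < π) : 0 < hypSn x := by
  have key : ∀ x, 0 < x → x ≤ π / 2 → 0 < hypSn x := fun x h0 h1 => by
    refine mul_pos (mul_pos two_pos (Real.sinh_pos_iff.2 h0)) (nodeSeries_pos (sq_nonneg _) ?_)
    refine pow_le_pow_left₀ (Real.cosh_pos x).le (Real.cosh_le_cosh.2 ?_) 2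
    rwa [abs_of_pos h0, abs_of_pos (by positivity)]
  rcases le_total x (π / 2) with h | h
  · exact key x h0 h
  · rw [← hypSn_pi_sub]
    exact key _ (by linarith) (by linarith)

/-- The two real differential equations, with opposite linear terms and equal initial slopes. -/
theorem exists_circSn_hypSn_ode : ∃ α γ : ℝ, ∃ g h : ℝ → ℝ, g 0 = γ ∧ h 0 = γ ∧
    (∀ y, HasDerivAt circSn (g y) y) ∧
    (∀ y, HasDerivAt g (-α * circSn y - 2 * circSn y ^ 3) y) ∧
    (∀ x, HasDerivAt hypSn (h x) x) ∧
    (∀ x, HasDerivAt h (α * hypSn x - 2 * hypSn x ^ 3) x) := by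
  obtain ⟨α, hα⟩ := exists_sechSum_ode
  have hI : ∀ y : ℝ, HasDerivAt sechSum (deriv sechSum (Complex.I * y)) (Complex.I * y) ∧
      HasDerivAt (deriv sechSum) (α * sechSum (Complex.I * y) - 2 * sechSum (Complex.I * y) ^ 3)
        (Complex.I * y) := fun y =>
    hα {z | |z.re| < 1} (Real.exp (-1) / 4)
      (isOpen_lt (Complex.continuous_re.abs) continuous_const) (by positivity)
      (fun z hz => coshBound_of_abs_re_lt_one hz) _ (by simp)
  have hR : ∀ x : ℝ, HasDerivAt sechSum (deriv sechSum x) x ∧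
      HasDerivAt (deriv sechSum) (α * sechSum x - 2 * sechSum x ^ 3) x := fun x =>
    hα ({z | |z.re| < |x| + 1} ∩ {z | |z.im| < 1}) (Real.exp (-(|x| + 1)) / 4)
      ((isOpen_lt (Complex.continuous_re.abs) continuous_const).inter
        (isOpen_lt (Complex.continuous_im.abs) continuous_const)) (by positivity)
      (fun z hz => coshBound_of_abs_im_lt_one hz.1 hz.2) _ (by simp)
  have hline : ∀ y : ℝ, HasDerivAt (fun y : ℂ => Complex.I * y) Complex.I y := fun y => by
    simpa using (hasDerivAt_id (y : ℂ)).const_mul Complex.I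
  refine ⟨α.re, -(deriv sechSum 0).re, fun y => (-deriv sechSum (Complex.I * y)).re,
    fun x => (-deriv sechSum x).re, by simp, by simp, fun y => ?_, fun y => ?_, fun x => ?_,
    fun x => ?_⟩
  · have h := (((hI y).1.comp (y : ℂ) (hline y)).const_mul Complex.I).real_of_complex
    refine (h.congr_deriv ?_).congr_of_eventuallyEq (.of_forall fun y => ?_)
    · congr 1
      linear_combination deriv sechSum (Complex.I * y) * Complex.I_sq
    · simp only [Function.comp, ← circSn_eq, Complex.ofReal_re]
  · have h := ((hI y).2.comp (y : ℂ) (hline y)).neg.real_of_complex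
    refine h.congr_deriv ?_
    have hs : sechSum (Complex.I * y) = -Complex.I * circSn y := by
      rw [circSn_eq]
      linear_combination sechSum (Complex.I * y) * Complex.I_sq
    rw [hs]
    have : -((α * (-Complex.I * circSn y) - 2 * (-Complex.I * circSn y) ^ 3) * Complex.I) =
        -α * circSn y - 2 * ((circSn y ^ 3 : ℝ) : ℂ) := by
      push_cast
      linear_combination (α * circSn y - 2 * (circSn y : ℂ) ^ 3 * (Complex.I ^ 2 - 1)) *
        Complex.I_sq
    rw [this]
    simp [-Complex.ofReal_pow]
  · have h := (hR x).1.neg.real_of_complex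
    refine h.congr_of_eventuallyEq (.of_forall fun y => ?_)
    simp only [Pi.neg_apply, ← hypSn_eq, Complex.ofReal_re]
  · have h := (hR x).2.neg.real_of_complex
    refine h.congr_deriv ?_
    have hs : sechSum x = -hypSn x := by rw [hypSn_eq, neg_neg]
    rw [hs]
    have : -(α * -(hypSn x : ℂ) - 2 * (-(hypSn x : ℂ)) ^ 3) =
        α * hypSn x - 2 * ((hypSn x ^ 3 : ℝ) : ℂ) := by push_cast; ring
    rw [this]
    simp [-Complex.ofReal_pow]

/-- Uniqueness of the zero solution of a planar linear system with off-diagonal coefficients. -/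
theorem eq_zero_of_hasDerivAt_mul_swap {e z c d : ℝ → ℝ} (hc : Continuous c) (hd : Continuous d)
    (he : ∀ t, HasDerivAt e (c t * z t) t) (hz : ∀ t, HasDerivAt z (d t * e t) t)
    (he0 : e 0 = 0) (hz0 : z 0 = 0) (t : ℝ) : e t = 0 := by
  have key : ∀ {e z c d : ℝ → ℝ}, Continuous c → Continuous d →
      (∀ t, HasDerivAt e (c t * z t) t) → (∀ t, HasDerivAt z (d t * e t) t) →
      e 0 = 0 → z 0 = 0 → ∀ t ≥ 0, e t = 0 := by
    intro e z c d hc hd he hz he0 hz0 t ht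
    obtain ⟨K, hK⟩ := (isCompact_Icc (a := (0 : ℝ)) (b := t)).exists_bound_of_continuousOn
      (f := fun s => |c s| + |d s|) (hc.abs.add hd.abs).continuousOn
    have hder : ∀ s, HasDerivAt (fun s => (e s, z s)) (c s * z s, d s * e s) s :=
      fun s => (he s).prodMk (hz s)
    have h := eq_zero_of_abs_deriv_le_mul_abs_self_of_eq_zero_right (K := K)
      (fun s _ => (hder s).continuousAt.continuousWithinAt) (fun s _ => (hder s).hasDerivWithinAt)
      (by simp [he0, hz0]) (fun s hs => ?_) t ⟨ht, le_rfl⟩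
    · exact (Prod.mk.inj h).1
    · have hb := hK s ⟨hs.1, hs.2.le⟩
      rw [Real.norm_of_nonneg (by positivity)] at hb
      have h1 : |z s| ≤ ‖(e s, z s)‖ := norm_snd_le (e s, z s)
      have h2 : |e s| ≤ ‖(e s, z s)‖ := norm_fst_le (e s, z s)
      rw [Prod.norm_mk, Real.norm_eq_abs, Real.norm_eq_abs, abs_mul, abs_mul]
      refine max_le (mul_le_mul ?_ h1 (abs_nonneg _) ?_) (mul_le_mul ?_ h2 (abs_nonneg _) ?_) <;>
        linarith [abs_nonneg (c s), abs_nonneg (d s)]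
  rcases le_total 0 t with ht | ht
  · exact key hc hd he hz he0 hz0 t ht
  · have hneg : ∀ s : ℝ, HasDerivAt (fun s : ℝ => -s) (-1) s := fun s => (hasDerivAt_id s).neg
    have h := key (e := fun s => e (-s)) (z := fun s => z (-s)) (c := fun s => -c (-s))
      (d := fun s => -d (-s)) (by fun_prop) (by fun_prop)
      (fun s => ((he (-s)).comp s (hneg s)).congr_deriv (by ring))
      (fun s => ((hz (-s)).comp s (hneg s)).congr_deriv (by ring))
      (by simpa using he0) (by simpa using hz0) (-t) (by linarith)
    simpa using h

/-- Two solutions of a cubic second-order equation with equal initial data coincide. -/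
theorem eq_of_cubic_ode {a b : ℝ} {x y v w : ℝ → ℝ} (hx : ∀ t, HasDerivAt x (v t) t)
    (hv : ∀ t, HasDerivAt v (a * x t + b * x t ^ 3) t) (hy : ∀ t, HasDerivAt y (w t) t)
    (hw : ∀ t, HasDerivAt w (a * y t + b * y t ^ 3) t) (h0 : x 0 = y 0) (h1 : v 0 = w 0) (t : ℝ) :
    x t = y t := by
  have hxc : Continuous x := continuous_iff_continuousAt.2 fun t => (hx t).continuousAt
  have hyc : Continuous y := continuous_iff_continuousAt.2 fun t => (hy t).continuousAt
  refine sub_eq_zero.1 (eq_zero_of_hasDerivAt_mul_swap (e := fun t => x t - y t)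
    (z := fun t => v t - w t) (c := fun _ => 1)
    (d := fun t => a + b * (x t ^ 2 + x t * y t + y t ^ 2)) continuous_const (by fun_prop)
    (fun t => ((hx t).sub (hy t)).congr_deriv (by ring))
    (fun t => ((hv t).sub (hw t)).congr_deriv (by ring)) (by simp [h0]) (by simp [h1]) t)

/-- The elliptic integral with integrand `1 / √(A + B sin²)`. -/
noncomputable def ellipticIntegral (A B φ : ℝ) : ℝ :=
  ∫ θ in (0 : ℝ)..φ, 1 / √(A + B * Real.sin θ ^ 2)

theorem continuous_ellipticIntegrand {A B : ℝ} (hA : 0 < A) (hB : 0 ≤ B) :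
    Continuous fun θ : ℝ => 1 / √(A + B * Real.sin θ ^ 2) :=
  continuous_const.div (by fun_prop) fun θ => (Real.sqrt_pos.2 (by positivity)).ne'

theorem hasDerivAt_ellipticIntegral {A B : ℝ} (hA : 0 < A) (hB : 0 ≤ B) (φ : ℝ) :
    HasDerivAt (ellipticIntegral A B) (1 / √(A + B * Real.sin φ ^ 2)) φ :=
  (continuous_ellipticIntegrand hA hB).integral_hasStrictDerivAt 0 φ |>.hasDerivAt

theorem ellipticIntegral_zero (A B : ℝ) : ellipticIntegral A B 0 = 0 := by
  simp [ellipticIntegral]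

theorem strictMono_ellipticIntegral {A B : ℝ} (hA : 0 < A) (hB : 0 ≤ B) :
    StrictMono (ellipticIntegral A B) :=
  strictMono_of_hasDerivAt_pos (hasDerivAt_ellipticIntegral hA hB) fun θ => by positivity

theorem ellipticIntegral_swap_lt {A B : ℝ} (hB : 0 < B) (h : B < A) :
    ellipticIntegral A B π < ellipticIntegral B A π := by
  have hA := hB.trans h
  refine intervalIntegral.integral_lt_integral_of_continuousOn_of_le_of_exists_lt pi_pos
    (continuous_ellipticIntegrand hA hB.le).continuousOn
    (continuous_ellipticIntegrand hB hA.le).continuousOn (fun θ _ => ?_)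
    ⟨0, ⟨le_rfl, pi_pos.le⟩, ?_⟩
  · refine one_div_le_one_div_of_le (Real.sqrt_pos.2 (by positivity)) (Real.sqrt_le_sqrt ?_)
    nlinarith [Real.sin_sq_le_one θ]
  · refine one_div_lt_one_div_of_lt (Real.sqrt_pos.2 (by positivity)) (Real.sqrt_lt_sqrt ?_ ?_)
    · positivity
    · simpa using h

/-- The elliptic integral inverts the solutions of the cubic equation. -/
theorem comp_ellipticIntegral_eq {A B : ℝ} (hA : 0 < A) (hB : 0 < B) {y v : ℝ → ℝ}
    (hy : ∀ t, HasDerivAt y (v t) t) (hv : ∀ t, HasDerivAt v ((B - A) * y t - 2 * y t ^ 3) t)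
    (h0 : y 0 = 0) (h1 : v 0 = √B * √A) (θ : ℝ) :
    y (ellipticIntegral A B θ) = √B * Real.sin θ := by
  have hyc : Continuous y := continuous_iff_continuousAt.2 fun t => (hy t).continuousAt
  have hΦ := hasDerivAt_ellipticIntegral hA hB.le
  have hΦc : Continuous (ellipticIntegral A B) :=
    continuous_iff_continuousAt.2 fun t => (hΦ t).continuousAt
  have hDpos : ∀ θ, 0 < √(A + B * Real.sin θ ^ 2) := fun θ => Real.sqrt_pos.2 (by positivity)
  have hDc := continuous_ellipticIntegrand hA hB.le
  have hD2 : ∀ θ, √(A + B * Real.sin θ ^ 2) ^ 2 = A + B * Real.sin θ ^ 2 :=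
    fun θ => Real.sq_sqrt (by positivity)
  have hB2 : √B ^ 2 = B := Real.sq_sqrt hB.le
  have hD : ∀ θ, HasDerivAt (fun θ => √(A + B * Real.sin θ ^ 2))
      (B * Real.sin θ * Real.cos θ / √(A + B * Real.sin θ ^ 2)) θ := fun θ => by
    have h := ((((Real.hasDerivAt_sin θ).pow 2).const_mul B).const_add A).sqrt
      (by positivity : A + B * Real.sin θ ^ 2 ≠ 0)
    refine h.congr_deriv ?_
    have := (hDpos θ).ne'
    simp only [Pi.pow_apply]
    field_simp
    push_cast
    ring
  refine sub_eq_zero.1 (eq_zero_of_hasDerivAt_mul_swap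
    (e := fun θ => y (ellipticIntegral A B θ) - √B * Real.sin θ)
    (z := fun θ => v (ellipticIntegral A B θ) -
      √B * (Real.cos θ * √(A + B * Real.sin θ ^ 2)))
    (c := fun θ => 1 / √(A + B * Real.sin θ ^ 2))
    (d := fun θ => (B - A - 2 * (y (ellipticIntegral A B θ) ^ 2 +
      y (ellipticIntegral A B θ) * (√B * Real.sin θ) + (√B * Real.sin θ) ^ 2)) *
        (1 / √(A + B * Real.sin θ ^ 2))) hDc (by fun_prop) (fun θ => ?_) (fun θ => ?_) ?_ ?_ θ)
  · refine (((hy _).comp θ (hΦ θ)).sub ((Real.hasDerivAt_sin θ).const_mul √B)).congr_deriv ?_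
    have := (hDpos θ).ne'
    field_simp
  · refine (((hv _).comp θ (hΦ θ)).sub
      (((Real.hasDerivAt_cos θ).mul (hD θ)).const_mul √B)).congr_deriv ?_
    have := (hDpos θ).ne'
    have h2 := hD2 θ
    have hs := Real.sin_sq_add_cos_sq θ
    field_simp
    linear_combination √B * Real.sin θ * (h2 - B * hs - 2 * Real.sin θ ^ 2 * hB2)
  · simp [ellipticIntegral_zero, h0]
  · simp [ellipticIntegral_zero, h1]

/-- The first positive zero of a solution of the cubic equation is `ellipticIntegral A B π`. -/
theorem ellipticIntegral_pi_eq {A B T : ℝ} (hA : 0 < A) (hB : 0 < B) {y v : ℝ → ℝ}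
    (hy : ∀ t, HasDerivAt y (v t) t) (hv : ∀ t, HasDerivAt v ((B - A) * y t - 2 * y t ^ 3) t)
    (h0 : y 0 = 0) (h1 : v 0 = √B * √A) (hT : 0 < T) (hyT : y T = 0)
    (hpos : ∀ t, 0 < t → t < T → 0 < y t) : ellipticIntegral A B π = T := by
  have h := comp_ellipticIntegral_eq hA hB hy hv h0 h1
  have hmono := strictMono_ellipticIntegral hA hB.le
  have hc : Continuous (ellipticIntegral A B) :=
    continuous_iff_continuousAt.2 fun t => (hasDerivAt_ellipticIntegral hA hB.le t).continuousAt
  have hΦ0 := ellipticIntegral_zero A B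
  have hπ : 0 < ellipticIntegral A B π := by rw [← hΦ0]; exact hmono pi_pos
  rcases lt_trichotomy (ellipticIntegral A B π) T with hlt | heq | hgt
  · have := hpos _ hπ hlt
    rw [h] at this
    simp at this
  · exact heq
  · obtain ⟨θ, hθ, hθT⟩ := intermediate_value_Ioo pi_pos.le hc.continuousOn
      (show T ∈ Set.Ioo (ellipticIntegral A B 0) (ellipticIntegral A B π) by
        rw [hΦ0]; exact ⟨hT, hgt⟩)
    have h' := h θ
    rw [hθT, hyT] at h'
    have := mul_pos (Real.sqrt_pos.2 hB) (Real.sin_pos_of_pos_of_lt_pi hθ.1 hθ.2)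
    linarith

/-- The slope at the origin of a nonzero solution which is positive to the right of it. -/
theorem initial_slope_pos {α T : ℝ} {y v : ℝ → ℝ} (hT : 0 < T) (hy : ∀ t, HasDerivAt y (v t) t)
    (hv : ∀ t, HasDerivAt v (α * y t - 2 * y t ^ 3) t) (h0 : y 0 = 0)
    (hpos : ∀ t, 0 < t → t < T → 0 < y t) : 0 < v 0 := by
  refine lt_of_le_of_ne ?_ fun hv0 => ?_
  · have h := (hasDerivWithinAt_iff_tendsto_slope' (s := Set.Ioi (0 : ℝ)) (by simp)).1
      (hy 0).hasDerivWithinAt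
    refine ge_of_tendsto h ?_
    filter_upwards [Ioo_mem_nhdsGT hT] with t ht
    rw [slope_def_field, h0]
    have := hpos t ht.1 ht.2
    exact div_nonneg (by linarith) (by linarith [ht.1])
  · have hz : ∀ t : ℝ, HasDerivAt (fun _ : ℝ => (0 : ℝ)) 0 t := fun t => hasDerivAt_const t 0
    have h := eq_of_cubic_ode (a := α) (b := -2) (y := fun _ => 0) (w := fun _ => 0) hy
      (fun t => (hv t).congr_deriv (by ring)) hz (fun t => (hz t).congr_deriv (by ring)) h0
      hv0.symm (T / 2)
    have := hpos (T / 2) (by linarith) (by linarith)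
    linarith

/-- The linear term of the differential equation vanishes: `circSn` is a lemniscate sine, and its
slope at the origin is determined by the half period. -/
theorem exists_circSn_lemniscate : ∃ γ : ℝ, 0 < γ ∧ ellipticIntegral γ γ π = π ∧
    ∃ g : ℝ → ℝ, g 0 = γ ∧ (∀ y, HasDerivAt circSn (g y) y) ∧
      ∀ y, HasDerivAt g (-2 * circSn y ^ 3) y := by
  obtain ⟨α, γ, g, h, hg0, hh0, hg, hg', hh, hh'⟩ := exists_circSn_hypSn_ode
  have hγ : 0 < γ := hg0 ▸ initial_slope_pos pi_pos hg hg' circSn_zero fun _ => circSn_pos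
  set R := √(α ^ 2 + 4 * γ ^ 2) with hR
  have hR2 : R ^ 2 = α ^ 2 + 4 * γ ^ 2 := Real.sq_sqrt (by positivity)
  have hRα : |α| < R := by
    rw [← Real.sqrt_sq_eq_abs]
    exact Real.sqrt_lt_sqrt (sq_nonneg _) (by nlinarith)
  have hα := abs_lt.1 hRα
  obtain ⟨A, hA⟩ : ∃ A, A = (R + α) / 2 := ⟨_, rfl⟩
  obtain ⟨B, hB⟩ : ∃ B, B = (R - α) / 2 := ⟨_, rfl⟩
  have hA0 : 0 < A := by linarith
  have hB0 : 0 < B := by linarith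
  have hAB : √B * √A = γ := by
    rw [← Real.sqrt_mul hB0.le, show B * A = γ ^ 2 by rw [hA, hB]; linarith, Real.sqrt_sq hγ.le]
  have h1 := ellipticIntegral_pi_eq hA0 hB0 hg
    (fun t => (hg' t).congr_deriv (by rw [hA, hB]; ring)) circSn_zero (hg0.trans hAB.symm) pi_pos
    circSn_pi fun _ => circSn_pos
  have h2 := ellipticIntegral_pi_eq hB0 hA0 hh
    (fun t => (hh' t).congr_deriv (by rw [hA, hB]; ring)) hypSn_zero
    (by rw [hh0, mul_comm, hAB]) pi_pos hypSn_pi fun _ => hypSn_pos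
  have hα0 : α = 0 := by
    rcases lt_trichotomy A B with hlt | heq | hgt
    · linarith [ellipticIntegral_swap_lt hA0 hlt]
    · linarith
    · linarith [ellipticIntegral_swap_lt hB0 hgt]
  have hAγ : A = γ := by
    rw [← hAB, show B = A by linarith, Real.mul_self_sqrt hA0.le]
  refine ⟨γ, hγ, ?_, g, hg0, hg, fun y => (hg' y).congr_deriv (by rw [hα0]; ring)⟩
  rw [show B = A by linarith, hAγ] at h1
  exact h1

theorem halfNode_natCast (n : ℕ) : halfNode n = ((n : ℝ) + 1 / 2) * π := by
  simp [halfNode]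

/-- The coefficient `e^{-(n+1/2)π} / (1 + e^{-(2n+1)π})` as an alternating geometric series. -/
theorem hasSum_nome_coeff (n : ℕ) :
    HasSum (fun m : ℕ => (-1 : ℝ) ^ m * Real.exp (-((2 * n + 1) * halfNode m)))
      (Real.exp (-((n : ℝ) + 1 / 2) * π) / (1 + Real.exp (-(2 * (n : ℝ) + 1) * π))) := by
  have hlt : Real.exp (-(2 * (n : ℝ) + 1) * π) < 1 := by
    rw [Real.exp_lt_one_iff]
    nlinarith [pi_pos, (Nat.cast_nonneg n : (0 : ℝ) ≤ n)]
  have h := (hasSum_geometric_of_norm_lt_one (ξ := -Real.exp (-(2 * (n : ℝ) + 1) * π))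
    (by rwa [norm_neg, Real.norm_of_nonneg (Real.exp_pos _).le])).mul_left
      (Real.exp (-((n : ℝ) + 1 / 2) * π))
  rw [sub_neg_eq_add, ← div_eq_mul_inv] at h
  refine h.congr_fun fun m => ?_
  rw [neg_pow (Real.exp _), ← Real.exp_nat_mul, mul_left_comm, ← Real.exp_add, halfNode_natCast]
  ring_nf

/-- Expansion of the hyperbolic secant in the right half-plane. -/
theorem hasSum_inv_cosh {w : ℂ} (hw : 0 < w.re) :
    HasSum (fun k : ℕ => 2 * (-1) ^ k * Complex.exp (-((2 * k + 1) * w))) (Complex.cosh w)⁻¹ := by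
  have hlt : ‖-Complex.exp (-(2 * w))‖ < 1 := by
    rw [norm_neg, Complex.norm_exp, Real.exp_lt_one_iff]
    simp [hw]
  have h := (hasSum_geometric_of_norm_lt_one hlt).mul_left (2 * Complex.exp (-w))
  have hval : 2 * Complex.exp (-w) * (1 - -Complex.exp (-(2 * w)))⁻¹ = (Complex.cosh w)⁻¹ := by
    have hexp : Complex.exp (-(2 * w)) = Complex.exp (-w) * Complex.exp (-w) := by
      rw [← Complex.exp_add]; ring_nf
    have hinv : Complex.exp w * Complex.exp (-w) = 1 := by rw [← Complex.exp_add]; simp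
    have hcosh : 1 - -Complex.exp (-(2 * w)) = 2 * Complex.exp (-w) * Complex.cosh w := by
      rw [Complex.cosh, hexp]
      linear_combination -hinv
    rw [hcosh, mul_inv, mul_inv_cancel_left₀ (by simp [Complex.exp_ne_zero])]
  rw [hval] at h
  refine h.congr_fun fun k => ?_
  rw [neg_pow (Complex.exp _), ← Complex.exp_nat_mul,
    show -((2 * (k : ℂ) + 1) * w) = -w + k * -(2 * w) by ring, Complex.exp_add]
  ring

theorem hasSum_inv_cosh_sub_inv_cosh (a y : ℝ) (ha : 0 < a) :
    HasSum (fun k : ℕ => 4 * (-1 : ℂ) ^ k * Real.exp (-((2 * k + 1) * a)) *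
      Real.sin ((2 * k + 1) * y))
      (Complex.I * ((Complex.cosh (Complex.I * y + a))⁻¹ -
        (Complex.cosh (Complex.I * y - a))⁻¹)) := by
  rw [← Complex.cosh_neg (Complex.I * y - a)]
  have h1 := hasSum_inv_cosh (w := Complex.I * y + a) (by simpa)
  have h2 := hasSum_inv_cosh (w := -(Complex.I * y - a)) (by simpa)
  refine ((h1.sub h2).mul_left Complex.I).congr_fun fun k => ?_
  have e1 : Complex.exp (-((2 * k + 1) * (Complex.I * y + a))) =
      Complex.exp (-((2 * k + 1) * a)) * Complex.exp (-((2 * k + 1) * y) * Complex.I) := by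
    rw [← Complex.exp_add]; ring_nf
  have e2 : Complex.exp (-((2 * k + 1) * -(Complex.I * y - a))) =
      Complex.exp (-((2 * k + 1) * a)) * Complex.exp ((2 * k + 1) * y * Complex.I) := by
    rw [← Complex.exp_add]; ring_nf
  push_cast
  rw [e1, e2, Complex.sin]
  ring

theorem summable_exp_double : Summable fun p : ℕ × ℕ =>
    Real.exp (-((2 * (p.2 : ℝ) + 1) * halfNode p.1)) := by
  have hg : Summable fun n : ℕ => Real.exp (-π) ^ n := summable_geometric_of_lt_one
    (Real.exp_pos _).le (Real.exp_zero ▸ Real.exp_lt_exp.2 (neg_lt_zero.2 pi_pos))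
  refine (hg.mul_of_nonneg hg (fun _ => by positivity) (fun _ => by positivity)).of_nonneg_of_le
    (fun _ => (Real.exp_pos _).le) fun p => ?_
  rw [← Real.exp_nat_mul, ← Real.exp_nat_mul, ← Real.exp_add, halfNode_natCast]
  refine Real.exp_le_exp.2 ?_
  have h : (0 : ℝ) ≤ p.1 * p.2 := by positivity
  nlinarith [mul_nonneg h pi_pos.le, pi_pos]

/-- The Fourier series of `circSn`. -/
theorem hasSum_circSn (y : ℝ) :
    HasSum (fun n : ℕ => 4 * ((-1) ^ n * Real.exp (-((n : ℝ) + 1 / 2) * π) /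
      (1 + Real.exp (-(2 * (n : ℝ) + 1) * π))) * Real.sin ((2 * n + 1) * y)) (circSn y) := by
  let F : ℕ × ℕ → ℝ := fun p => (-1) ^ p.1 * (4 * (-1) ^ p.2 *
    Real.exp (-((2 * (p.2 : ℝ) + 1) * halfNode p.1)) * Real.sin ((2 * p.2 + 1) * y))
  have hF : Summable F := by
    refine Summable.of_norm_bounded (summable_exp_double.mul_left 4) fun p => ?_
    simp only [F, norm_mul, norm_pow, norm_neg, norm_one, one_pow, one_mul, mul_one,
      Real.norm_of_nonneg (Real.exp_pos _).le]
    rw [Real.norm_of_nonneg (by norm_num : (0 : ℝ) ≤ 4)]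
    exact mul_le_of_le_one_right (by positivity) (Real.abs_sin_le_one _)
  have hrow : HasSum (fun m : ℕ => ∑' k, F (m, k)) (circSn y) := by
    rw [← Complex.hasSum_ofReal, circSn_eq]
    refine (((coshBound_I_mul y).hasSum_sechSum (by positivity)).mul_left Complex.I).congr_fun
      fun m => ?_
    have h := (hasSum_inv_cosh_sub_inv_cosh (halfNode m) y
      ((by positivity : 0 < π / 2).trans_le (pi_div_two_le_halfNode m))).mul_left ((-1 : ℂ) ^ m)
    rw [mul_left_comm, ← h.tsum_eq, Complex.ofReal_tsum]
    refine tsum_congr fun k => ?_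
    simp only [F]
    push_cast
    rfl
  have htot : HasSum F (circSn y) := by
    have h := hF.hasSum.prod_fiberwise fun m => (hF.prod_factor m).hasSum
    rw [← h.unique hrow]
    exact hF.hasSum
  refine ((Equiv.prodComm ℕ ℕ).hasSum_iff.2 htot).prod_fiberwise fun n => ?_
  have h := (hasSum_nome_coeff n).mul_left (4 * (-1) ^ n * Real.sin ((2 * n + 1) * y))
  convert! h using 1
  · funext m
    simp only [F, Function.comp, Equiv.prodComm_apply, Prod.swap_prod_mk]
    ring
  · ring

theorem ellipticIntegral_self_pi {γ : ℝ} (hγ : 0 < γ) :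
    ellipticIntegral γ γ π =
      2 * (∫ θ in (0 : ℝ)..(π / 2), 1 / √(1 + Real.sin θ ^ 2)) / √γ := by
  have hfun : ∀ θ : ℝ, 1 / √(γ + γ * Real.sin θ ^ 2) =
      (√γ)⁻¹ * (1 / √(1 + Real.sin θ ^ 2)) := fun θ => by
    rw [show γ + γ * Real.sin θ ^ 2 = γ * (1 + Real.sin θ ^ 2) by ring, Real.sqrt_mul hγ.le]
    field_simp
  have hc : Continuous fun θ : ℝ => 1 / √(1 + Real.sin θ ^ 2) := by
    simpa using continuous_ellipticIntegrand one_pos zero_le_one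
  have hrefl : ∫ θ in (π / 2)..π, 1 / √(1 + Real.sin θ ^ 2) =
      ∫ θ in (0 : ℝ)..(π / 2), 1 / √(1 + Real.sin θ ^ 2) := by
    have h := intervalIntegral.integral_comp_sub_left
      (fun θ : ℝ => 1 / √(1 + Real.sin θ ^ 2)) (a := 0) (b := π / 2) π
    rw [sub_zero, sub_half] at h
    rw [← h]
    simp only [Real.sin_pi_sub]
  simp only [ellipticIntegral, hfun]
  rw [intervalIntegral.integral_const_mul, ← intervalIntegral.integral_add_adjacent_intervals
    (hc.intervalIntegrable 0 (π / 2)) (hc.intervalIntegrable (π / 2) π), hrefl]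
  ring

/-- **Fourier (q-series) expansion of `sn(·, i)`.**
With `K = ∫₀^{π/2} dθ/√(1+sin²θ)`, the solution of `s'' = -2 s³`, `s 0 = 0`,
`s' 0 = 1` satisfies, for every `u`,
`s u = (2π/K) Σₙ (-1)ⁿ e^{-(n+1/2)π}/(1+e^{-(2n+1)π}) · sin((2n+1)πu/(2K))`,
the series converging absolutely and uniformly on `ℝ`. -/
theorem snoidal_fourier_expansion (s : ℝ → ℝ)
    (hs : Differentiable ℝ s) (hs' : Differentiable ℝ (deriv s))
    (hode : ∀ u : ℝ, deriv (deriv s) u = -2 * s u ^ 3)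
    (h0 : s 0 = 0) (h1 : deriv s 0 = 1)
    (K : ℝ) (hK : K = ∫ θ in (0:ℝ)..(π / 2), 1 / Real.sqrt (1 + Real.sin θ ^ 2))
    (a : ℕ → ℝ)
    (ha : ∀ n : ℕ, a n =
      (-1) ^ n * Real.exp (-((n : ℝ) + 1 / 2) * π) /
        (1 + Real.exp (-(2 * (n : ℝ) + 1) * π))) :
    (∀ u : ℝ, HasSum
        (fun n : ℕ => (2 * π / K) * a n * Real.sin ((2 * (n : ℝ) + 1) * π * u / (2 * K)))
        (s u)) ∧
    Summable (fun n : ℕ => (2 * π / K) * |a n|) ∧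
    TendstoUniformly
      (fun N : ℕ => fun u : ℝ => ∑ n ∈ Finset.range N,
        (2 * π / K) * a n * Real.sin ((2 * (n : ℝ) + 1) * π * u / (2 * K)))
      s atTop := by
  obtain ⟨γ, hγ, hΦ, g, hg0, hg, hg'⟩ := exists_circSn_lemniscate
  rw [ellipticIntegral_self_pi hγ, ← hK, div_eq_iff (Real.sqrt_pos.2 hγ).ne'] at hΦ
  have hγ0 := Real.sqrt_pos.2 hγ
  have hK0 : 0 < K := by nlinarith [mul_pos pi_pos hγ0]
  have hγK : (π / (2 * K)) ^ 2 * γ = 1 := by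
    rw [hΦ, div_pow, mul_pow, Real.sq_sqrt hγ.le]
    field_simp
  set l := π / (2 * K) with hl
  have hlin : ∀ u : ℝ, HasDerivAt (fun u : ℝ => l * u) l u := fun u => by
    simpa using (hasDerivAt_id u).const_mul l
  have hseq : ∀ u, s u = l * circSn (l * u) := by
    refine eq_of_cubic_ode (a := 0) (b := -2) (v := deriv s) (w := fun u => l ^ 2 * g (l * u))
      (fun u => (hs u).hasDerivAt)
      (fun u => (hs' u).hasDerivAt.congr_deriv (by rw [hode]; ring))
      (fun u => (((hg (l * u)).comp u (hlin u)).const_mul l).congr_deriv (by ring))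
      (fun u => (((hg' (l * u)).comp u (hlin u)).const_mul (l ^ 2)).congr_deriv (by ring))
      ?_ ?_
    · simp [h0, circSn_zero]
    · simp [h1, hg0, hγK]
  have hsum : ∀ u : ℝ, HasSum
      (fun n : ℕ => (2 * π / K) * a n * Real.sin ((2 * (n : ℝ) + 1) * π * u / (2 * K))) (s u) := by
    intro u
    rw [hseq u]
    refine ((hasSum_circSn (l * u)).mul_left l).congr_fun fun n => ?_
    rw [← ha, show (2 * (n : ℝ) + 1) * (l * u) = (2 * (n : ℝ) + 1) * π * u / (2 * K) by
      rw [hl]; ring, hl]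
    ring
  have habs : Summable (fun n : ℕ => (2 * π / K) * |a n|) := by
    refine (Summable.of_nonneg_of_le (fun _ => abs_nonneg _) (fun n => ?_)
      summable_exp_neg_halfNode).mul_left _
    have he := Real.exp_pos (-(2 * (n : ℝ) + 1) * π)
    rw [ha, abs_div, abs_mul, abs_pow, abs_neg, abs_one, one_pow, one_mul, Real.abs_exp,
      abs_of_pos (by positivity), halfNode_natCast, ← neg_mul]
    exact div_le_self (Real.exp_pos _).le (by linarith)
  refine ⟨hsum, habs, ?_⟩
  have hunif := tendstoUniformly_tsum_nat (f := fun (n : ℕ) (u : ℝ) =>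
    (2 * π / K) * a n * Real.sin ((2 * (n : ℝ) + 1) * π * u / (2 * K))) habs fun n u => by
      rw [norm_mul, norm_mul, Real.norm_of_nonneg (by positivity : 0 ≤ 2 * π / K)]
      exact mul_le_of_le_one_right (by positivity) (Real.abs_sin_le_one _)
  simpa only [(hsum _).tsum_eq] using hunif
end

section
/- With K = ∫₀^{π/2} dθ / √(1 + sin²θ), the following q-series identity holds: Σ_{n=0}^∞ (2n+1) · (−1)ⁿ e^{−(n+1/2)π} / (1 + e^{−(2n+1)π}) = K² / π². (This is the normalization condition s'(0) = 1 applied to the Fourier expansion of sn(u, i), and it guarantees that the residues Bₙ of the infrared propagator sum correctly.) -/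
open Real

lemma hasSum_comp_sub_add_of_odd {g k : ℤ → ℝ} (e : ℤ) (hg : ∀ n, g (-1 - n) = -g n)
    (hk : ∀ n, k (-e - n) = -k n) (hlim : Filter.Tendsto g Filter.atTop (nhds 1))
    (hs : ∀ q, Summable fun n => g (q - n) + k n) (q : ℤ) :
    HasSum (fun n => g (q - n) + k n) (2 * q + 1 + e) := by
  set V : ℤ → ℝ := fun q => ∑' n, (g (q - n) + k n) with hV
  have step (q : ℤ) : V (q + 1) - V q = 2 := by
    have h1 := ((hs (q + 1)).hasSum.sub (hs q).hasSum).nat_add_neg_add_one.tendsto_sum_nat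
    have h2 (N : ℕ) : ∑ n ∈ Finset.range N,
        ((g (q + 1 - n) + k n - (g (q - n) + k n)) +
          (g (q + 1 - -((n : ℤ) + 1)) + k (-((n : ℤ) + 1))
            - (g (q - -((n : ℤ) + 1)) + k (-((n : ℤ) + 1)))))
        = g ((N : ℤ) + (-2 - q)) + g ((N : ℤ) + (q + 1)) := by
      induction N with
      | zero =>
        have := hg (q + 1)
        simp only [Finset.range_zero, Finset.sum_empty]
        rw [show ((0 : ℕ) : ℤ) + (-2 - q) = -1 - (q + 1) by push_cast; ring, this]
        simp
      | succ N ih =>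
        rw [Finset.sum_range_succ, ih]
        have e1 := hg (q + 1 - N)
        have e2 := hg (q - N)
        rw [show -1 - (q + 1 - (N : ℤ)) = N + (-2 - q) by ring] at e1
        rw [show -1 - (q - (N : ℤ)) = ((N + 1 : ℕ) : ℤ) + (-2 - q) by push_cast; ring] at e2
        rw [show q + 1 - -((N : ℤ) + 1) = ((N + 1 : ℕ) : ℤ) + (q + 1) by push_cast; ring,
          show q - -((N : ℤ) + 1) = (N : ℤ) + (q + 1) by ring]
        linarith
    have hc (a : ℤ) : Filter.Tendsto (fun N : ℕ => g ((N : ℤ) + a)) Filter.atTop (nhds 1) :=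
      hlim.comp (Filter.tendsto_atTop_add_const_right _ _ tendsto_natCast_atTop_atTop)
    simp only [h2] at h1
    have := tendsto_nhds_unique h1 ((hc (-2 - q)).add (hc (q + 1)))
    rw [hV]
    linarith
  have lin (q : ℤ) : V q = V 0 + 2 * q := by
    induction q using Int.induction_on with
    | zero => simp
    | succ i ih => have := step i; push_cast at *; linarith
    | pred i ih =>
      have := step (-i - 1); rw [sub_add_cancel] at this; push_cast at *; linarith
  have odd (q : ℤ) : V (-1 - e - q) = -V q := by
    rw [hV]
    simp only
    rw [← tsum_neg, ← (Equiv.subLeft (-e)).tsum_eq]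
    refine tsum_congr fun n => ?_
    have := hg (q - n)
    rw [Equiv.subLeft_apply, hk, show -1 - e - q - (-e - n) = -1 - (q - n) by ring, this]
    ring
  have key : V q = 2 * q + 1 + e := by
    have h1 := odd q
    have h2 := lin (-1 - e - q)
    have h3 := lin q
    push_cast at h2
    linarith
  rw [← key]
  exact (hs q).hasSum

lemma tendsto_tanh_atTop : Filter.Tendsto Real.tanh Filter.atTop (nhds 1) := by
  have h (x : ℝ) : Real.tanh x = 1 - 2 / (Real.exp (2 * x) + 1) := by
    have := Real.exp_pos x
    rw [Real.tanh_eq, Real.exp_neg, two_mul, Real.exp_add]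
    field_simp
    ring
  have h2 : Filter.Tendsto (fun x : ℝ => Real.exp (2 * x) + 1) Filter.atTop Filter.atTop :=
    Filter.tendsto_atTop_add_const_right _ _
      (Real.tendsto_exp_atTop.comp (Filter.tendsto_id.const_mul_atTop two_pos))
  simpa [funext h] using (h2.const_div_atTop 2).const_sub 1

/-- Exponential decay of `c n` at the rate of `1 / cosh ((2n+e)π/2)`. -/
def Decays (c : ℤ → ℝ) (e : ℤ) : Prop :=
  ∃ B, ∀ n : ℤ, |c n| ≤ B * Real.exp (-(|2 * (n : ℝ) + e| * (π / 2)))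

/-- Fourier coefficients of the sine-type lemniscatic function. -/
noncomputable def snCoeff (n : ℤ) : ℝ := (-1) ^ n / Real.cosh ((2 * n + 1) * (π / 2))

/-- Fourier coefficients of the cosine-type lemniscatic function. -/
noncomputable def cnCoeff (n : ℤ) : ℝ := (-1) ^ n / Real.sinh ((2 * n + 1) * (π / 2))

/-- Fourier coefficients of the delta-type lemniscatic function. -/
noncomputable def dnCoeff (n : ℤ) : ℝ := (-1) ^ n / Real.cosh (n * π)

lemma one_div_cosh_le (x : ℝ) : 1 / Real.cosh x ≤ 2 * Real.exp (-|x|) := by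
  rw [← Real.cosh_abs, Real.cosh_eq, Real.exp_neg]
  have h := Real.exp_pos |x|
  rw [div_le_iff₀ (by positivity)]
  field_simp
  nlinarith

lemma one_div_abs_sinh_le {x : ℝ} (hx : 1 ≤ |x|) : 1 / |Real.sinh x| ≤ 4 * Real.exp (-|x|) := by
  rw [Real.abs_sinh, Real.sinh_eq, Real.exp_neg]
  have h2 : 2 ≤ Real.exp |x| := by linarith [Real.add_one_le_exp |x|]
  have h3 : 0 < Real.exp |x| - (Real.exp |x|)⁻¹ := by
    have : (Real.exp |x|)⁻¹ < 1 := inv_lt_one_of_one_lt₀ (by linarith)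
    linarith
  rw [div_le_iff₀ (by positivity)]
  field_simp
  nlinarith

lemma one_le_abs_odd_mul (n : ℤ) : 1 ≤ |(2 * (n : ℝ) + 1) * (π / 2)| := by
  have h1 : (1 : ℝ) ≤ |2 * (n : ℝ) + 1| := by
    have : (1 : ℤ) ≤ |2 * n + 1| := Int.one_le_abs (by omega)
    exact_mod_cast this
  rw [abs_mul, abs_of_pos (show 0 < π / 2 by positivity)]
  nlinarith [Real.pi_gt_three]

lemma sinh_odd_ne_zero (n : ℤ) : Real.sinh ((2 * n + 1) * (π / 2)) ≠ 0 := by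
  intro h
  have := one_le_abs_odd_mul n
  rw [Real.sinh_eq_zero.mp h] at this
  norm_num at this

lemma decays_snCoeff : Decays snCoeff 1 := by
  refine ⟨2, fun n => ?_⟩
  have := one_div_cosh_le ((2 * n + 1) * (π / 2))
  rw [abs_mul, abs_of_pos (show 0 < π / 2 by positivity)] at this
  rw [snCoeff, abs_div, abs_neg_one_zpow, abs_of_pos (Real.cosh_pos _)]
  exact_mod_cast this

lemma decays_cnCoeff : Decays cnCoeff 1 := by
  refine ⟨4, fun n => ?_⟩
  have := one_div_abs_sinh_le (one_le_abs_odd_mul n)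
  rw [abs_mul _ (π / 2), abs_of_pos (show 0 < π / 2 by positivity)] at this
  rw [cnCoeff, abs_div, abs_neg_one_zpow]
  exact_mod_cast this

lemma decays_dnCoeff : Decays dnCoeff 0 := by
  refine ⟨2, fun n => ?_⟩
  have := one_div_cosh_le (n * π)
  rw [show (n : ℝ) * π = (2 * n + (0 : ℤ)) * (π / 2) by push_cast; ring, abs_mul,
    abs_of_pos (show 0 < π / 2 by positivity)] at this
  rw [dnCoeff, abs_div, abs_neg_one_zpow, abs_of_pos (Real.cosh_pos _),
    show (n : ℝ) * π = (2 * n + (0 : ℤ)) * (π / 2) by push_cast; ring]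
  exact this

lemma summable_abs_pow_mul_exp (k : ℕ) {r : ℝ} (hr : 0 < r) (e : ℤ) :
    Summable fun n : ℤ => |2 * (n : ℝ) + e| ^ k * Real.exp (-(|2 * (n : ℝ) + e| * r)) := by
  have h : Summable fun j : ℤ => |(j : ℝ)| ^ k * Real.exp (-(|(j : ℝ)| * r)) := by
    have := Real.summable_pow_mul_exp_neg_nat_mul k hr
    apply Summable.of_nat_of_neg <;> simpa [mul_comm r] using this
  have hi : Function.Injective fun n : ℤ => 2 * n + e := fun a b hab => by
    simp only at hab; omega
  simpa [Function.comp_def] using h.comp_injective hi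

lemma Decays.summable_pow_mul {c : ℤ → ℝ} {e : ℤ} (hc : Decays c e) (k : ℕ) {r : ℝ}
    (hr : r < π / 2) :
    Summable fun n : ℤ =>
      |2 * (n : ℝ) + e| ^ k * (|c n| * Real.exp (|2 * (n : ℝ) + e| * r)) := by
  obtain ⟨B, hB⟩ := hc
  refine Summable.of_nonneg_of_le (fun n => by positivity) (fun n => ?_)
    ((summable_abs_pow_mul_exp k (sub_pos.mpr hr) e).mul_left B)
  calc _ ≤ |2 * (n : ℝ) + e| ^ k * (B * Real.exp (-(|2 * (n : ℝ) + e| * (π / 2)))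
            * Real.exp (|2 * (n : ℝ) + e| * r)) := by gcongr; exact hB n
    _ = _ := by
      rw [mul_assoc, ← Real.exp_add]
      ring_nf

lemma Decays.summable_abs {c : ℤ → ℝ} {e : ℤ} (hc : Decays c e) : Summable fun n => |c n| := by
  simpa using hc.summable_pow_mul 0 (r := 0) (by positivity)

lemma Decays.summable_mul_shift {a b : ℤ → ℝ} {e e' : ℤ} (ha : Decays a e) (hb : Decays b e')
    (q : ℤ) : Summable fun n => a (q - n) * b n := by
  obtain ⟨B, hB⟩ := ha
  have hB0 : 0 ≤ B := by
    have := (abs_nonneg _).trans (hB 0)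
    exact nonneg_of_mul_nonneg_left this (Real.exp_pos _)
  refine Summable.of_norm_bounded (hb.summable_abs.mul_left B) fun n => ?_
  rw [Real.norm_eq_abs, abs_mul]
  gcongr
  refine (hB _).trans (mul_le_of_le_one_right hB0 ?_)
  rw [Real.exp_le_one_iff, neg_nonpos]
  positivity

lemma neg_one_zpow_sub_mul (q n : ℤ) : (-1 : ℝ) ^ (q - n) * (-1) ^ n = (-1) ^ q := by
  rw [← zpow_add₀ (by norm_num), sub_add_cancel]

lemma tendsto_odd_mul_atTop :
    Filter.Tendsto (fun n : ℤ => (2 * (n : ℝ) + 1) * (π / 2)) Filter.atTop Filter.atTop :=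
  (Filter.tendsto_atTop_add_const_right _ _
    (tendsto_intCast_atTop_atTop.const_mul_atTop two_pos)).atTop_mul_const (by positivity)

lemma tendsto_tanh_odd :
    Filter.Tendsto (fun n : ℤ => Real.tanh ((2 * n + 1) * (π / 2))) Filter.atTop (nhds 1) :=
  tendsto_tanh_atTop.comp tendsto_odd_mul_atTop

lemma tanh_odd_reflect (n : ℤ) : Real.tanh ((2 * (-1 - n : ℤ) + 1) * (π / 2))
    = -Real.tanh ((2 * n + 1) * (π / 2)) := by
  rw [← Real.tanh_neg]; congr 1; push_cast; ring

lemma hasSum_convolution_of_odd {a b F g k : ℤ → ℝ} {e s t : ℤ} (ha : Decays a s)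
    (hb : Decays b t) (hF : ∀ q, F q ≠ 0) (hg : ∀ n, g (-1 - n) = -g n)
    (hk : ∀ n, k (-e - n) = -k n) (hlim : Filter.Tendsto g Filter.atTop (nhds 1))
    (key : ∀ q n, g (q - n) + k n = F q * (a (q - n) * b n)) (p : ℤ) :
    HasSum (fun n => a (p - n) * b n) ((2 * p + 1 + e) / F p) := by
  have h := hasSum_comp_sub_add_of_odd e hg hk hlim
    (fun q => by simpa only [key] using (ha.summable_mul_shift hb q).mul_left _) p
  simp only [key] at h
  simpa [hF p] using h.div_const (F p)

lemma tanh_add_tanh (x y : ℝ) :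
    Real.tanh x + Real.tanh y = Real.sinh (x + y) * (1 / Real.cosh x * (1 / Real.cosh y)) := by
  have h1 := (Real.cosh_pos x).ne'
  have h2 := (Real.cosh_pos y).ne'
  rw [Real.tanh_eq_sinh_div_cosh, Real.tanh_eq_sinh_div_cosh, Real.sinh_add]
  field_simp

lemma coth_add_tanh {x : ℝ} (y : ℝ) (hx : Real.sinh x ≠ 0) : (Real.tanh x)⁻¹ + Real.tanh y
    = Real.cosh (x + y) * (1 / Real.sinh x * (1 / Real.cosh y)) := by
  have h2 := (Real.cosh_pos y).ne'
  rw [Real.tanh_eq_sinh_div_cosh, Real.tanh_eq_sinh_div_cosh, Real.cosh_add]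
  field_simp

lemma neg_one_zpow_mul_self (n : ℤ) : (-1 : ℝ) ^ n * (-1) ^ n = 1 := by
  rw [← mul_zpow]; simp

lemma one_div_neg_one_zpow (n : ℤ) : 1 / (-1 : ℝ) ^ n = (-1) ^ n :=
  (eq_one_div_of_mul_eq_one_left (neg_one_zpow_mul_self n)).symm

lemma tanh_mul_pi_reflect (n : ℤ) : Real.tanh ((-0 - n : ℤ) * π) = -Real.tanh (n * π) := by
  rw [← Real.tanh_neg]; congr 1; push_cast; ring

lemma hasSum_snCoeff_dnCoeff (p : ℤ) :
    HasSum (fun n => snCoeff (p - n) * dnCoeff n) ((2 * p + 1) * cnCoeff p) := by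
  have h := hasSum_convolution_of_odd decays_snCoeff decays_dnCoeff
    (F := fun q => (-1) ^ q * Real.sinh ((2 * q + 1) * (π / 2)))
    (fun q => mul_ne_zero (zpow_ne_zero _ (by norm_num)) (sinh_odd_ne_zero q))
    tanh_odd_reflect tanh_mul_pi_reflect tendsto_tanh_odd (fun q n => by
      rw [tanh_add_tanh, show (2 * (q - n : ℤ) + 1) * (π / 2) + n * π
        = (2 * (q : ℝ) + 1) * (π / 2) by push_cast; ring, snCoeff, dnCoeff]
      rw [div_eq_mul_one_div ((-1) ^ (q - n)), div_eq_mul_one_div ((-1) ^ n),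
        mul_mul_mul_comm ((-1) ^ (q - n)), neg_one_zpow_sub_mul]
      generalize 1 / Real.cosh ((2 * (q - n : ℤ) + 1) * (π / 2)) * (1 / Real.cosh (n * π)) = c
      linear_combination (-Real.sinh ((2 * q + 1) * (π / 2)) * c) * neg_one_zpow_mul_self q) p
  convert h using 1
  rw [cnCoeff, div_mul_eq_div_div, div_eq_mul_one_div _ ((-1 : ℝ) ^ p),
    one_div_neg_one_zpow]
  push_cast
  ring

lemma hasSum_cnCoeff_dnCoeff (p : ℤ) :
    HasSum (fun n => cnCoeff (p - n) * dnCoeff n) ((2 * p + 1) * snCoeff p) := by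
  have h := hasSum_convolution_of_odd decays_cnCoeff decays_dnCoeff
    (F := fun q => (-1) ^ q * Real.cosh ((2 * q + 1) * (π / 2)))
    (fun q => mul_ne_zero (zpow_ne_zero _ (by norm_num)) (Real.cosh_pos _).ne')
    (g := fun n => (Real.tanh ((2 * n + 1) * (π / 2)))⁻¹)
    (fun n => by rw [tanh_odd_reflect, inv_neg]) tanh_mul_pi_reflect
    (by simpa using tendsto_tanh_odd.inv₀ one_ne_zero) (fun q n => by
      rw [coth_add_tanh _ (sinh_odd_ne_zero _), show (2 * (q - n : ℤ) + 1) * (π / 2) + n * π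
        = (2 * (q : ℝ) + 1) * (π / 2) by push_cast; ring, cnCoeff, dnCoeff]
      rw [div_eq_mul_one_div ((-1) ^ (q - n)), div_eq_mul_one_div ((-1) ^ n),
        mul_mul_mul_comm ((-1) ^ (q - n)), neg_one_zpow_sub_mul]
      generalize 1 / Real.sinh ((2 * (q - n : ℤ) + 1) * (π / 2)) * (1 / Real.cosh (n * π)) = c
      linear_combination (-Real.cosh ((2 * q + 1) * (π / 2)) * c) * neg_one_zpow_mul_self q) p
  convert h using 1
  rw [snCoeff, div_mul_eq_div_div, div_eq_mul_one_div _ ((-1 : ℝ) ^ p),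
    one_div_neg_one_zpow]
  push_cast
  ring

lemma hasSum_snCoeff_cnCoeff (p : ℤ) :
    HasSum (fun n => snCoeff (p - 1 - n) * cnCoeff n) (-(2 * p * dnCoeff p)) := by
  have h := hasSum_convolution_of_odd decays_snCoeff decays_cnCoeff (e := 1)
    (F := fun q => (-1) ^ q * Real.cosh ((q + 1 : ℤ) * π))
    (fun q => mul_ne_zero (zpow_ne_zero _ (by norm_num)) (Real.cosh_pos _).ne')
    (k := fun n => (Real.tanh ((2 * n + 1) * (π / 2)))⁻¹) tanh_odd_reflect
    (fun n => by rw [tanh_odd_reflect, inv_neg]) tendsto_tanh_odd (fun q n => by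
      rw [add_comm, coth_add_tanh _ (sinh_odd_ne_zero _),
        show (2 * (n : ℝ) + 1) * (π / 2) + (2 * (q - n : ℤ) + 1) * (π / 2)
        = (q + 1 : ℤ) * π by push_cast; ring, snCoeff, cnCoeff]
      rw [div_eq_mul_one_div ((-1) ^ (q - n)), div_eq_mul_one_div ((-1) ^ n),
        mul_mul_mul_comm ((-1) ^ (q - n)), neg_one_zpow_sub_mul,
        mul_comm (1 / Real.sinh _)]
      generalize 1 / Real.cosh ((2 * (q - n : ℤ) + 1) * (π / 2)) *
        (1 / Real.sinh ((2 * n + 1) * (π / 2))) = c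
      linear_combination (-Real.cosh ((q + 1 : ℤ) * π) * c) * neg_one_zpow_mul_self q) (p - 1)
  convert h using 1
  rw [dnCoeff, div_mul_eq_div_div, div_eq_mul_one_div _ ((-1 : ℝ) ^ (p - 1)),
    one_div_neg_one_zpow, sub_add_cancel, zpow_sub_one₀ (by norm_num)]
  push_cast
  ring

/-- The two-sided exponential series `∑ₙ c n e^{(2n+e)w}`. -/
noncomputable def bilateral (c : ℤ → ℝ) (e : ℤ) (w : ℂ) : ℂ :=
  ∑' n : ℤ, (c n : ℂ) * Complex.exp ((2 * (n : ℂ) + e) * w)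

/-- The strip `|Re w| < r`. -/
def strip (r : ℝ) : Set ℂ := Complex.re ⁻¹' Set.Ioo (-r) r

lemma mem_strip {r : ℝ} {w : ℂ} : w ∈ strip r ↔ |w.re| < r := by
  rw [abs_lt]; rfl

lemma isOpen_strip (r : ℝ) : IsOpen (strip r) := isOpen_Ioo.preimage Complex.continuous_re

lemma isPreconnected_strip (r : ℝ) : IsPreconnected (strip r) :=
  ((convex_Ioo (-r) r).linear_preimage Complex.reLm).isPreconnected

lemma norm_term_le (c : ℤ → ℝ) (e n : ℤ) {w : ℂ} {r : ℝ} (hw : |w.re| ≤ r) :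
    ‖(c n : ℂ) * Complex.exp ((2 * (n : ℂ) + e) * w)‖
      ≤ |c n| * Real.exp (|2 * (n : ℝ) + e| * r) := by
  rw [norm_mul, Complex.norm_real, Real.norm_eq_abs, Complex.norm_exp]
  gcongr
  have : ((2 * (n : ℂ) + e) * w).re = (2 * (n : ℝ) + e) * w.re := by
    rw [show (2 * (n : ℂ) + e) = ((2 * (n : ℝ) + e : ℝ) : ℂ) by push_cast; ring,
      Complex.re_ofReal_mul]
  rw [this]
  refine (le_abs_self _).trans ?_
  rw [abs_mul]
  gcongr

lemma Decays.summable_norm_term {c : ℤ → ℝ} {e : ℤ} (hc : Decays c e) {w : ℂ}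
    (hw : w ∈ strip (π / 2)) :
    Summable fun n : ℤ => ‖(c n : ℂ) * Complex.exp ((2 * (n : ℂ) + e) * w)‖ := by
  refine Summable.of_nonneg_of_le (fun n => norm_nonneg _)
    (fun n => norm_term_le c e n le_rfl) ?_
  simpa using hc.summable_pow_mul 0 (mem_strip.mp hw)

lemma Decays.hasDerivAt_bilateral {c : ℤ → ℝ} {e : ℤ} (hc : Decays c e) {w : ℂ}
    (hw : w ∈ strip (π / 2)) :
    HasDerivAt (bilateral c e) (bilateral (fun n => (2 * n + e) * c n) e w) w := by
  obtain ⟨r, hr1, hr2⟩ := exists_between (mem_strip.mp hw)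
  have hwr : w ∈ strip r := mem_strip.mpr hr1
  refine hasDerivAt_tsum_of_isPreconnected
    (g := fun (n : ℤ) (z : ℂ) => (c n : ℂ) * Complex.exp ((2 * (n : ℂ) + e) * z))
    (g' := fun (n : ℤ) (z : ℂ) =>
      (((2 * n + e) * c n : ℝ) : ℂ) * Complex.exp ((2 * (n : ℂ) + e) * z))
    (hc.summable_pow_mul 1 hr2) (isOpen_strip r)
    (isPreconnected_strip r) (fun n y _ => ?_) (fun n y hy => ?_) hwr
    (hc.summable_norm_term hw).of_norm hwr
  · have h := (((hasDerivAt_id' y).const_mul (2 * (n : ℂ) + e)).cexp).const_mul (c n : ℂ)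
    refine h.congr_deriv ?_
    push_cast
    ring
  · refine (norm_term_le (fun n => (2 * n + e) * c n) e n (mem_strip.mp hy).le).trans
      (le_of_eq ?_)
    rw [abs_mul]
    ring

lemma bilateral_mul_bilateral {a b c : ℤ → ℝ} {e e' e'' k : ℤ} (ha : Decays a e)
    (hb : Decays b e') (he : e + e' = e'' + 2 * k)
    (hc : ∀ p, HasSum (fun n => a (p - k - n) * b n) (c p)) {w : ℂ} (hw : w ∈ strip (π / 2)) :
    bilateral a e w * bilateral b e' w = bilateral c e'' w := by
  have ha' := ha.summable_norm_term hw
  have hb' := hb.summable_norm_term hw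
  rw [bilateral, bilateral, tsum_mul_tsum_of_summable_norm ha' hb']
  have hs := (summable_mul_of_summable_norm ha' hb').hasSum
  let φ : ℤ × ℤ ≃ ℤ × ℤ :=
    { toFun := fun z => (z.1 - k - z.2, z.2)
      invFun := fun z => (z.1 + z.2 + k, z.2)
      left_inv := fun z => by ext <;> simp
      right_inv := fun z => by ext <;> simp }
  rw [← φ.hasSum_iff] at hs
  refine (hs.prod_fiberwise fun p => ?_).tsum_eq.symm
  have h := ((Complex.hasSum_ofReal.mpr (hc p)).mul_right
    (Complex.exp ((2 * (p : ℂ) + e'') * w)))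
  refine h.congr_fun fun n => ?_
  have he' : (e : ℂ) + e' = e'' + 2 * k := by exact_mod_cast he
  simp only [Function.comp_apply, φ, Equiv.coe_fn_mk]
  rw [mul_mul_mul_comm, ← Complex.exp_add]
  push_cast
  congr 2
  linear_combination w * he'

lemma Decays.div {c : ℤ → ℝ} {e : ℤ} (hc : Decays c e) :
    Decays (fun n => c n / (2 * n + e)) e := by
  obtain ⟨B, hB⟩ := hc
  refine ⟨B, fun n => le_trans ?_ (hB n)⟩
  rw [abs_div]
  rcases eq_or_ne (2 * n + e) 0 with h | h
  · have : (2 * (n : ℝ) + e) = 0 := by exact_mod_cast h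
    simp [this]
  · have : (1 : ℝ) ≤ |2 * (n : ℝ) + e| := by exact_mod_cast Int.one_le_abs h
    exact div_le_self (abs_nonneg _) this

lemma bilateral_neg {c : ℤ → ℝ} {e : ℤ} {ε : ℝ} (hc : ∀ n, c (-e - n) = ε * c n) (w : ℂ) :
    bilateral c e (-w) = ε * bilateral c e w := by
  rw [bilateral, bilateral, ← tsum_mul_left, ← (Equiv.subLeft (-e)).tsum_eq]
  refine tsum_congr fun n => ?_
  rw [Equiv.subLeft_apply, hc]
  push_cast
  rw [mul_assoc]
  congr 3
  ring

lemma bilateral_conj (c : ℤ → ℝ) (e : ℤ) (w : ℂ) :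
    bilateral c e (starRingEnd ℂ w) = starRingEnd ℂ (bilateral c e w) := by
  rw [bilateral, bilateral, Complex.conj_tsum]
  refine tsum_congr fun n => ?_
  rw [map_mul, ← Complex.exp_conj, map_mul, Complex.conj_ofReal, map_add, map_mul, map_ofNat,
    map_intCast, map_intCast]

lemma bilateral_zero_arg (c : ℤ → ℝ) (e : ℤ) : bilateral c e 0 = (∑' n, c n : ℝ) := by
  simp [bilateral, Complex.ofReal_tsum]

lemma bilateral_add_pi_mul_I (c : ℤ → ℝ) (w : ℂ) :
    bilateral c 0 (w + π * Complex.I) = bilateral c 0 w := by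
  refine tsum_congr fun n => ?_
  congr 1
  rw [Complex.exp_eq_exp_iff_exists_int]
  exact ⟨n, by push_cast; ring⟩

/-- The lemniscatic sine series (up to scaling and rotation). -/
noncomputable def snSeries : ℂ → ℂ := bilateral snCoeff 1

/-- The lemniscatic cosine series (up to scaling and rotation). -/
noncomputable def cnSeries : ℂ → ℂ := bilateral cnCoeff 1

/-- The lemniscatic delta series (up to scaling and rotation). -/
noncomputable def dnSeries : ℂ → ℂ := bilateral dnCoeff 0

/-- The primitive of `dnSeries` vanishing at the origin. -/
noncomputable def dnPrimitive (w : ℂ) : ℂ :=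
  w + bilateral (fun n => dnCoeff n / (2 * n + (0 : ℤ))) 0 w

/-- The primitive of `cnSeries` vanishing at the origin. -/
noncomputable def cnPrimitive : ℂ → ℂ :=
  bilateral (fun n => cnCoeff n / (2 * n + (1 : ℤ))) 1

lemma neg_one_zpow_reflect_odd (n : ℤ) : (-1 : ℝ) ^ (-1 - n) = -(-1) ^ n := by
  rw [zpow_sub₀ (by norm_num), div_eq_mul_one_div, one_div_neg_one_zpow]
  norm_num

lemma snCoeff_reflect (n : ℤ) : snCoeff (-1 - n) = -1 * snCoeff n := by
  rw [snCoeff, snCoeff, neg_one_zpow_reflect_odd, ← Real.cosh_neg]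
  push_cast
  ring_nf

lemma cnCoeff_reflect (n : ℤ) : cnCoeff (-1 - n) = cnCoeff n := by
  rw [cnCoeff, cnCoeff, neg_one_zpow_reflect_odd,
    show (2 * ((-1 - n : ℤ) : ℝ) + 1) * (π / 2) = -((2 * n + 1) * (π / 2)) by push_cast; ring,
    Real.sinh_neg, neg_div_neg_eq]

lemma dnCoeff_neg (n : ℤ) : dnCoeff (-n) = dnCoeff n := by
  rw [dnCoeff, dnCoeff, zpow_neg, ← one_div, one_div_neg_one_zpow]
  push_cast
  rw [neg_mul, Real.cosh_neg]

lemma snSeries_neg (w : ℂ) : snSeries (-w) = -snSeries w := by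
  simpa [snSeries] using bilateral_neg (e := 1) snCoeff_reflect w

lemma dnSeries_neg (w : ℂ) : dnSeries (-w) = dnSeries w := by
  have := bilateral_neg (c := dnCoeff) (e := 0) (ε := 1) (fun n => by simp [dnCoeff_neg]) w
  simpa [dnSeries] using this

lemma dnPrimitive_bilateral_neg (w : ℂ) :
    bilateral (fun n => dnCoeff n / (2 * n + (0 : ℤ))) 0 (-w)
      = -bilateral (fun n => dnCoeff n / (2 * n + (0 : ℤ))) 0 w := by
  have := bilateral_neg (c := fun n => dnCoeff n / (2 * n + (0 : ℤ))) (e := 0) (ε := -1)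
    (fun n => by simp [dnCoeff_neg, div_neg]) w
  simpa using this

lemma dnPrimitive_neg (w : ℂ) : dnPrimitive (-w) = -dnPrimitive w := by
  rw [dnPrimitive, dnPrimitive, dnPrimitive_bilateral_neg]
  ring

lemma cnPrimitive_neg (w : ℂ) : cnPrimitive (-w) = -cnPrimitive w := by
  have := bilateral_neg (c := fun n => cnCoeff n / (2 * n + (1 : ℤ))) (e := 1) (ε := -1)
    (fun n => by
      rw [cnCoeff_reflect, show (2 * ((-1 - n : ℤ) : ℝ) + (1 : ℤ)) = -(2 * n + (1 : ℤ)) by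
        push_cast; ring, div_neg]
      ring) w
  simpa [cnPrimitive] using this

lemma dnPrimitive_pi_div_two : dnPrimitive (π / 2 * Complex.I) = π / 2 * Complex.I := by
  have h1 := dnPrimitive_bilateral_neg (π / 2 * Complex.I)
  rw [← bilateral_add_pi_mul_I, show -((π : ℂ) / 2 * Complex.I) + π * Complex.I
    = π / 2 * Complex.I by ring] at h1
  rw [dnPrimitive, self_eq_neg.mp h1, add_zero]

lemma hasDerivAt_snSeries {w : ℂ} (hw : w ∈ strip (π / 2)) :
    HasDerivAt snSeries (cnSeries w * dnSeries w) w := by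
  have h := decays_snCoeff.hasDerivAt_bilateral hw
  rwa [← bilateral_mul_bilateral (k := 0) decays_cnCoeff decays_dnCoeff (by norm_num)
    (fun p => by simpa using hasSum_cnCoeff_dnCoeff p) hw] at h

lemma hasDerivAt_cnSeries {w : ℂ} (hw : w ∈ strip (π / 2)) :
    HasDerivAt cnSeries (snSeries w * dnSeries w) w := by
  have h := decays_cnCoeff.hasDerivAt_bilateral hw
  rwa [← bilateral_mul_bilateral (k := 0) decays_snCoeff decays_dnCoeff (by norm_num)
    (fun p => by simpa using hasSum_snCoeff_dnCoeff p) hw] at h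

lemma hasDerivAt_dnSeries {w : ℂ} (hw : w ∈ strip (π / 2)) :
    HasDerivAt dnSeries (-(snSeries w * cnSeries w)) w := by
  have h := decays_dnCoeff.hasDerivAt_bilateral hw
  refine h.congr_deriv ?_
  rw [snSeries, cnSeries, bilateral_mul_bilateral (k := 1) (e'' := 0) decays_snCoeff
    decays_cnCoeff (by norm_num) hasSum_snCoeff_cnCoeff hw, bilateral, bilateral, ← tsum_neg]
  refine tsum_congr fun n => ?_
  push_cast
  ring

lemma hasDerivAt_cnPrimitive {w : ℂ} (hw : w ∈ strip (π / 2)) :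
    HasDerivAt cnPrimitive (cnSeries w) w := by
  refine (decays_cnCoeff.div.hasDerivAt_bilateral hw).congr_deriv ?_
  refine tsum_congr fun n => ?_
  have : (2 * (n : ℝ) + (1 : ℤ)) ≠ 0 := by
    have : 2 * n + 1 ≠ 0 := by omega
    exact_mod_cast this
  simp only [mul_div_cancel₀ _ this]

lemma hasDerivAt_dnPrimitive {w : ℂ} (hw : w ∈ strip (π / 2)) :
    HasDerivAt dnPrimitive (dnSeries w) w := by
  refine ((hasDerivAt_id' w).add (decays_dnCoeff.div.hasDerivAt_bilateral hw)).congr_deriv ?_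
  rw [dnSeries, bilateral, bilateral,
    (decays_dnCoeff.summable_norm_term hw).of_norm.tsum_eq_add_tsum_ite 0]
  congr 1
  · simp [dnCoeff]
  · refine tsum_congr fun n => ?_
    split_ifs with h
    · simp [h]
    · have : (2 * (n : ℝ) + (0 : ℤ)) ≠ 0 := by simpa using h
      rw [mul_div_cancel₀ _ this]

lemma zero_mem_strip : (0 : ℂ) ∈ strip (π / 2) := mem_strip.mpr (by simp; positivity)

/-- Solutions of `P' = QR`, `Q' = PR` are hyperbolic functions of a primitive of `R`. -/
lemma eq_sinh_of_hasDerivAt {P Q R Ψ : ℂ → ℂ} {s : Set ℂ} (hs : IsOpen s)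
    (hs' : IsPreconnected s) (h0 : (0 : ℂ) ∈ s)
    (hP : ∀ w ∈ s, HasDerivAt P (Q w * R w) w) (hQ : ∀ w ∈ s, HasDerivAt Q (P w * R w) w)
    (hΨ : ∀ w ∈ s, HasDerivAt Ψ (R w) w) (hP0 : P 0 = 0) (hΨ0 : Ψ 0 = 0) {w : ℂ} (hw : w ∈ s) :
    P w = Q 0 * Complex.sinh (Ψ w) ∧ Q w = Q 0 * Complex.cosh (Ψ w) := by
  have h1 (z : ℂ) (hz : z ∈ s) : HasDerivAt (fun z => (Q z + P z) * Complex.exp (-Ψ z)) 0 z := by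
    refine (((hQ z hz).add (hP z hz)).mul (hΨ z hz).neg.cexp).congr_deriv ?_
    simp only [Pi.add_apply, Pi.neg_apply]
    ring
  have h2 (z : ℂ) (hz : z ∈ s) : HasDerivAt (fun z => (Q z - P z) * Complex.exp (Ψ z)) 0 z := by
    refine (((hQ z hz).sub (hP z hz)).mul (hΨ z hz).cexp).congr_deriv ?_
    simp only [Pi.sub_apply]
    ring
  have e1 := hs.is_const_of_deriv_eq_zero hs'
    (fun z hz => (h1 z hz).differentiableAt.differentiableWithinAt)
    (fun z hz => (h1 z hz).deriv) hw h0
  have e2 := hs.is_const_of_deriv_eq_zero hs'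
    (fun z hz => (h2 z hz).differentiableAt.differentiableWithinAt)
    (fun z hz => (h2 z hz).deriv) hw h0
  simp only [hP0, hΨ0, neg_zero, Complex.exp_zero, mul_one, add_zero, sub_zero] at e1 e2
  have e3 : Complex.exp (Ψ w) * Complex.exp (-Ψ w) = 1 := by
    rw [← Complex.exp_add, add_neg_cancel, Complex.exp_zero]
  rw [Complex.sinh, Complex.cosh]
  constructor
  · linear_combination (Complex.exp (Ψ w) / 2) * e1 - (Complex.exp (-Ψ w) / 2) * e2 - P w * e3
  · linear_combination (Complex.exp (Ψ w) / 2) * e1 + (Complex.exp (-Ψ w) / 2) * e2 - Q w * e3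

lemma snSeries_zero : snSeries 0 = 0 := by
  have := snSeries_neg 0
  rw [neg_zero] at this
  exact self_eq_neg.mp this

lemma dnPrimitive_zero : dnPrimitive 0 = 0 := by
  have := dnPrimitive_neg 0
  rw [neg_zero] at this
  exact self_eq_neg.mp this

lemma cnPrimitive_zero : cnPrimitive 0 = 0 := by
  have := cnPrimitive_neg 0
  rw [neg_zero] at this
  exact self_eq_neg.mp this

lemma snSeries_eq_sinh {w : ℂ} (hw : w ∈ strip (π / 2)) :
    snSeries w = cnSeries 0 * Complex.sinh (dnPrimitive w) ∧
      cnSeries w = cnSeries 0 * Complex.cosh (dnPrimitive w) :=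
  eq_sinh_of_hasDerivAt (isOpen_strip _) (isPreconnected_strip _) zero_mem_strip
    (fun _ => hasDerivAt_snSeries) (fun _ => hasDerivAt_cnSeries)
    (fun _ => hasDerivAt_dnPrimitive) snSeries_zero dnPrimitive_zero hw

lemma snSeries_eq_sin {w : ℂ} (hw : w ∈ strip (π / 2)) :
    snSeries w = dnSeries 0 * Complex.sin (cnPrimitive w) ∧
      dnSeries w = dnSeries 0 * Complex.cos (cnPrimitive w) := by
  have h := eq_sinh_of_hasDerivAt (P := fun z => Complex.I * snSeries z) (Q := dnSeries)
    (R := fun z => Complex.I * cnSeries z) (Ψ := fun z => cnPrimitive z * Complex.I)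
    (isOpen_strip (π / 2))
    (isPreconnected_strip _) zero_mem_strip
    (fun _ h => ((hasDerivAt_snSeries h).const_mul _).congr_deriv (by ring))
    (fun _ h => (hasDerivAt_dnSeries h).congr_deriv (by
      linear_combination (-(snSeries _ * cnSeries _)) * Complex.I_mul_I))
    (fun _ h => ((hasDerivAt_cnPrimitive h).mul_const _).congr_deriv (by ring))
    (by simp [snSeries_zero]) (by simp [cnPrimitive_zero]) hw
  simp only [Complex.sinh_mul_I, Complex.cosh_mul_I] at h
  refine ⟨mul_left_cancel₀ Complex.I_ne_zero ?_, h.2⟩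
  linear_combination h.1

lemma dnSeries_sq {w : ℂ} (hw : w ∈ strip (π / 2)) :
    dnSeries w ^ 2 = dnSeries 0 ^ 2 - cnSeries 0 ^ 2 * Complex.sinh (dnPrimitive w) ^ 2 := by
  have h1 := (snSeries_eq_sinh hw).1
  obtain ⟨h2, h3⟩ := snSeries_eq_sin hw
  rw [← mul_pow, ← h1, h2, h3]
  linear_combination dnSeries 0 ^ 2 * Complex.sin_sq_add_cos_sq (cnPrimitive w)

lemma cnSeries_sq {w : ℂ} (hw : w ∈ strip (π / 2)) :
    cnSeries w ^ 2 = cnSeries 0 ^ 2 + dnSeries 0 ^ 2 * Complex.sin (cnPrimitive w) ^ 2 := by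
  have h1 := (snSeries_eq_sin hw).1
  obtain ⟨h2, h3⟩ := snSeries_eq_sinh hw
  rw [← mul_pow, ← h1, h2, h3]
  linear_combination cnSeries 0 ^ 2 * Complex.cosh_sq_sub_sinh_sq (dnPrimitive w)

lemma le_of_hasSum_alternating {f : ℕ → ℝ} (hf : Antitone f) {l : ℝ}
    (hl : HasSum (fun n => (-1) ^ n * f n) l) : f 0 - f 1 ≤ l := by
  have := hf.alternating_series_le_tendsto hl.tendsto_sum_nat 1
  simpa [Finset.sum_range_succ, sub_eq_add_neg] using this

lemma tsum_cnCoeff_pos : 0 < ∑' n, cnCoeff n := by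
  have h := decays_cnCoeff.summable_abs.of_abs.hasSum.nat_add_neg_add_one
  have hpos (n : ℕ) : 0 < Real.sinh ((2 * n + 1) * (π / 2)) :=
    Real.sinh_pos_iff.mpr (by positivity)
  have h2 : HasSum (fun n : ℕ => (-1) ^ n * (2 / Real.sinh ((2 * n + 1) * (π / 2))))
      (∑' n, cnCoeff n) := by
    refine h.congr_fun fun n => ?_
    rw [show -((n : ℤ) + 1) = -1 - n by ring, cnCoeff_reflect, cnCoeff]
    simp only [zpow_natCast, Int.cast_natCast]
    ring
  have h3 : Antitone fun n : ℕ => 2 / Real.sinh ((2 * n + 1) * (π / 2)) := fun m n hmn => by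
    have := hpos m
    simp only
    gcongr
    exact Real.sinh_le_sinh.mpr (by gcongr)
  refine lt_of_lt_of_le ?_ (le_of_hasSum_alternating h3 h2)
  have := hpos 0
  rw [sub_pos]
  gcongr
  exact Real.sinh_lt_sinh.mpr (by gcongr; norm_num)

lemma tsum_dnCoeff_pos : 0 < ∑' n, dnCoeff n := by
  have hs := decays_dnCoeff.summable_abs.of_abs
  have h := hs.hasSum.nat_add_neg
  have h2 : HasSum (fun n : ℕ => (-1) ^ n * (2 / Real.cosh (n * π)))
      (∑' n, dnCoeff n + dnCoeff 0) := by
    refine h.congr_fun fun n => ?_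
    rw [dnCoeff_neg, dnCoeff]
    simp only [zpow_natCast, Int.cast_natCast]
    ring
  have h3 : Antitone fun n : ℕ => 2 / Real.cosh (n * π) := fun m n hmn => by
    have := Real.cosh_pos (m * π)
    simp only
    gcongr
    rw [Real.cosh_le_cosh, abs_of_nonneg (by positivity), abs_of_nonneg (by positivity)]
    gcongr
  have h4 : 2 - 2 / Real.cosh π ≤ ∑' n, dnCoeff n + dnCoeff 0 := by
    simpa using le_of_hasSum_alternating h3 h2
  have h5 : 2 < Real.cosh π := by
    have := Real.add_one_le_exp π
    rw [Real.cosh_eq]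
    have := Real.exp_pos (-π)
    have h6 := Real.quadratic_le_exp_of_nonneg Real.pi_pos.le
    nlinarith [Real.pi_gt_three]
  have h6 : 2 / Real.cosh π < 1 := by rw [div_lt_one] <;> linarith
  have h7 : dnCoeff 0 = 1 := by simp [dnCoeff]
  linarith

lemma integral_inv_sqrt_eq {θ d : ℝ → ℝ} {A B b : ℝ} (hA : 0 ≤ A) (hB : 0 < B) (hb : 0 ≤ b)
    (hθ : ∀ x ∈ Set.Icc 0 b, HasDerivAt θ (d x) x) (hd : ContinuousOn d (Set.Icc 0 b))
    (hd2 : ∀ x ∈ Set.Icc 0 b, d x ^ 2 = B + A * Real.sin (θ x) ^ 2) (hd0 : 0 < d 0) :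
    ∫ t in θ 0..θ b, 1 / √(B + A * Real.sin t ^ 2) = b := by
  have hpos (t : ℝ) : 0 < B + A * Real.sin t ^ 2 := by positivity
  have hg : Continuous fun t => √(B + A * Real.sin t ^ 2) := by fun_prop
  have hθc : ContinuousOn θ (Set.Icc 0 b) := fun x hx => (hθ x hx).continuousAt.continuousWithinAt
  have h0 : (0 : ℝ) ∈ Set.Icc 0 b := ⟨le_rfl, hb⟩
  have hEq : Set.EqOn d (fun x => √(B + A * Real.sin (θ x) ^ 2)) (Set.Icc 0 b) := by
    refine isPreconnected_Icc.eq_of_sq_eq hd (hg.comp_continuousOn hθc) (fun x hx => ?_)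
      (fun {x} _ => (Real.sqrt_pos.mpr (hpos _)).ne') h0 ?_
    · simp only [Pi.pow_apply]
      rw [Real.sq_sqrt (hpos _).le, hd2 x hx]
    · rw [← hd2 0 h0, Real.sqrt_sq hd0.le]
  have h := intervalIntegral.integral_comp_mul_deriv (a := 0) (b := b) (f := θ) (f' := d)
    (g := fun t => 1 / √(B + A * Real.sin t ^ 2)) (by rwa [Set.uIcc_of_le hb])
    (by rwa [Set.uIcc_of_le hb])
    (continuous_const.div hg fun t => (Real.sqrt_pos.mpr (hpos t)).ne')
  rw [← h, intervalIntegral.integral_congr (g := fun _ => (1 : ℝ))]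
  · simp
  · intro x hx
    rw [Set.uIcc_of_le hb] at hx
    simp only [Function.comp_apply]
    rw [hEq hx, one_div_mul_cancel (Real.sqrt_pos.mpr (hpos _)).ne']

lemma mul_I_mem_strip (x : ℝ) : (x : ℂ) * Complex.I ∈ strip (π / 2) :=
  mem_strip.mpr (by simp; positivity)

lemma ofReal_mem_strip {x : ℝ} (hx : |x| < π / 2) : (x : ℂ) ∈ strip (π / 2) :=
  mem_strip.mpr (by simpa using hx)

lemma conj_mul_I (x : ℝ) : starRingEnd ℂ ((x : ℂ) * Complex.I) = -((x : ℂ) * Complex.I) := by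
  simp

lemma ofReal_re_dnSeries (x : ℝ) :
    (((dnSeries (x * Complex.I)).re : ℝ) : ℂ) = dnSeries (x * Complex.I) := by
  rw [← Complex.conj_eq_iff_re, dnSeries, ← bilateral_conj, conj_mul_I]
  exact dnSeries_neg _

lemma dnPrimitive_mul_I (x : ℝ) :
    dnPrimitive (x * Complex.I) = (((dnPrimitive (x * Complex.I)).im : ℝ) : ℂ) * Complex.I := by
  have h : starRingEnd ℂ (dnPrimitive (x * Complex.I)) = -dnPrimitive (x * Complex.I) := by
    rw [← dnPrimitive_neg, ← conj_mul_I, dnPrimitive, dnPrimitive, bilateral_conj, map_add]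
  have h2 := congrArg Complex.re h
  rw [Complex.conj_re, Complex.neg_re] at h2
  apply Complex.ext
  · simpa using self_eq_neg.mp h2
  · simp

lemma integral_dn : ∫ t in (0 : ℝ)..(π / 2),
    1 / √((∑' n, dnCoeff n) ^ 2 + (∑' n, cnCoeff n) ^ 2 * Real.sin t ^ 2) = π / 2 := by
  have hline (x : ℝ) : HasDerivAt (fun x : ℝ => (x : ℂ) * Complex.I) Complex.I x := by
    simpa using (Complex.ofRealCLM.hasDerivAt (x := x)).mul_const Complex.I
  have hd (x : ℝ) : HasDerivAt (fun x : ℝ => dnSeries (x * Complex.I))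
      (-(snSeries (x * Complex.I) * cnSeries (x * Complex.I)) * Complex.I) x :=
    (hasDerivAt_dnSeries (mul_I_mem_strip x)).comp x (hline x)
  have h := integral_inv_sqrt_eq (θ := fun x => (dnPrimitive (x * Complex.I)).im)
    (d := fun x => (dnSeries (x * Complex.I)).re) (A := (∑' n, cnCoeff n) ^ 2)
    (B := (∑' n, dnCoeff n) ^ 2) (b := π / 2) (by positivity) (pow_pos tsum_dnCoeff_pos 2)
    (by positivity) (fun x _ => ?_) (fun x _ => ?_) (fun x _ => ?_) ?_
  · have h1 : (dnPrimitive (((π / 2 : ℝ) : ℂ) * Complex.I)).im = π / 2 := by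
      have := dnPrimitive_pi_div_two
      push_cast
      rw [this]
      norm_cast
      simp
    simpa only [h1, Complex.ofReal_zero, zero_mul, dnPrimitive_zero, Complex.zero_im] using h
  · have h1 : HasDerivAt (fun x : ℝ => dnPrimitive (x * Complex.I))
        (dnSeries (x * Complex.I) * Complex.I) x :=
      HasDerivAt.comp (h₂ := dnPrimitive) x (hasDerivAt_dnPrimitive (mul_I_mem_strip x)) (hline x)
    have h2 := Complex.imCLM.hasFDerivAt.comp_hasDerivAt x h1
    simpa [Function.comp_def] using h2
  · exact (Complex.continuous_re.continuousAt.comp (hd x).continuousAt).continuousWithinAt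
  · have h1 := dnSeries_sq (mul_I_mem_strip x)
    rw [dnPrimitive_mul_I, Complex.sinh_mul_I, ← ofReal_re_dnSeries, dnSeries, cnSeries,
      bilateral_zero_arg, bilateral_zero_arg, mul_pow _ Complex.I, Complex.I_sq] at h1
    have h2 : ((((dnSeries (x * Complex.I)).re) ^ 2 : ℝ) : ℂ) = (((∑' n, dnCoeff n) ^ 2
        + (∑' n, cnCoeff n) ^ 2 * Real.sin (dnPrimitive (x * Complex.I)).im ^ 2 : ℝ) : ℂ) := by
      simp only [Complex.ofReal_add, Complex.ofReal_mul, Complex.ofReal_pow, Complex.ofReal_sin]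
      rw [dnSeries]
      linear_combination h1
    exact_mod_cast h2
  · simp only [Complex.ofReal_zero, zero_mul]
    rw [dnSeries, bilateral_zero_arg, Complex.ofReal_re]
    exact tsum_dnCoeff_pos

lemma ofReal_re_bilateral (c : ℤ → ℝ) (e : ℤ) (x : ℝ) :
    (((bilateral c e x).re : ℝ) : ℂ) = bilateral c e x := by
  rw [← Complex.conj_eq_iff_re, ← bilateral_conj, Complex.conj_ofReal]

lemma integral_cn {b : ℝ} (hb0 : 0 ≤ b) (hb : b < π / 2) :
    ∫ t in (0 : ℝ)..(cnPrimitive b).re,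
      1 / √((∑' n, cnCoeff n) ^ 2 + (∑' n, dnCoeff n) ^ 2 * Real.sin t ^ 2) = b := by
  have hmem {x : ℝ} (hx : x ∈ Set.Icc 0 b) : (x : ℂ) ∈ strip (π / 2) :=
    ofReal_mem_strip (by rw [abs_of_nonneg hx.1]; linarith [hx.2])
  have h := integral_inv_sqrt_eq (θ := fun x => (cnPrimitive x).re)
    (d := fun x => (cnSeries x).re) (A := (∑' n, dnCoeff n) ^ 2)
    (B := (∑' n, cnCoeff n) ^ 2) (b := b) (by positivity) (pow_pos tsum_cnCoeff_pos 2)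
    hb0 (fun x hx => ?_) (fun x hx => ?_) (fun x hx => ?_) ?_
  · simpa [cnPrimitive_zero] using h
  · exact (hasDerivAt_cnPrimitive (hmem hx)).real_of_complex
  · exact (hasDerivAt_cnSeries (hmem hx)).real_of_complex.continuousAt.continuousWithinAt
  · have h1 := cnSeries_sq (hmem hx)
    have h2 : (((cnPrimitive x).re : ℝ) : ℂ) = cnPrimitive x := ofReal_re_bilateral _ _ _
    have h3 : (((cnSeries x).re : ℝ) : ℂ) = cnSeries x := ofReal_re_bilateral _ _ _
    rw [← h2, ← h3, dnSeries, show cnSeries 0 = _ from bilateral_zero_arg _ _,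
      bilateral_zero_arg] at h1
    exact_mod_cast h1
  · simp only [Complex.ofReal_zero]
    rw [cnSeries, bilateral_zero_arg, Complex.ofReal_re]
    exact tsum_cnCoeff_pos

lemma Decays.hasSum_re_bilateral {c : ℤ → ℝ} {e : ℤ} (hc : Decays c e) {x : ℝ}
    (hx : |x| < π / 2) :
    HasSum (fun n : ℤ => c n * Real.exp ((2 * n + e) * x)) (bilateral c e x).re := by
  have h := Complex.reCLM.hasSum
    (hc.summable_norm_term (ofReal_mem_strip hx)).of_norm.hasSum
  refine h.congr_fun fun n => ?_
  rw [Complex.reCLM_apply, ← Complex.ofReal_re (c n * Real.exp ((2 * n + e) * x))]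
  push_cast
  rfl

lemma cnCoeff_mul_exp (n : ℕ) (x : ℝ) : cnCoeff n * Real.exp ((2 * n + 1) * x)
    = 2 * ((-1) ^ n * Real.exp (x - π / 2) ^ (2 * n + 1))
      + cnCoeff n * Real.exp ((2 * n + 1) * (x - π)) := by
  have h := sinh_odd_ne_zero n
  have h1 : Real.exp (x - π / 2) ^ (2 * n + 1) = Real.exp ((2 * n + 1) * (x - π / 2)) := by
    rw [← Real.exp_nat_mul]; push_cast; rfl
  have h2 : Real.exp ((2 * n + 1) * x)
      = Real.exp ((2 * n + 1) * (x - π / 2)) * Real.exp ((2 * n + 1) * (π / 2)) := by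
    rw [← Real.exp_add]; ring_nf
  have h3 : Real.exp ((2 * n + 1) * (x - π))
      = Real.exp ((2 * n + 1) * (x - π / 2)) * Real.exp (-((2 * n + 1) * (π / 2))) := by
    rw [← Real.exp_add]; ring_nf
  have h4 := Real.sinh_eq ((2 * n + 1) * (π / 2))
  rw [h1, h2, h3, cnCoeff, zpow_natCast]
  rw [Int.cast_natCast] at h ⊢
  generalize (2 * (n : ℝ) + 1) * (π / 2) = y at h h4 ⊢
  field_simp
  linear_combination (-2) * h4

lemma hasSum_cnPrimitive {x : ℝ} (hx : |x| < π / 2) :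
    HasSum (fun n : ℕ => cnCoeff n / (2 * n + 1) *
      (Real.exp ((2 * n + 1) * (x - π)) - Real.exp (-((2 * n + 1) * x))))
      ((cnPrimitive x).re - 2 * Real.arctan (Real.exp (x - π / 2))) := by
  have h := (decays_cnCoeff.div.hasSum_re_bilateral hx).nat_add_neg_add_one
  have hlt : ‖Real.exp (x - π / 2)‖ < 1 := by
    rw [Real.norm_eq_abs, Real.abs_exp, Real.exp_lt_one_iff]
    linarith [(abs_lt.mp hx).2]
  refine (h.sub ((Real.hasSum_arctan hlt).mul_left 2)).congr_fun fun n => ?_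
  have h1 := cnCoeff_mul_exp n x
  rw [show -((n : ℤ) + 1) = -1 - n by ring, cnCoeff_reflect]
  push_cast
  rw [show (2 * (-1 - (n : ℝ)) + 1) = -(2 * n + 1) by ring, neg_mul, mul_comm (cnCoeff n / _),
    div_mul_eq_mul_div, h1]
  have : (2 * (n : ℝ) + 1) ≠ 0 := by positivity
  field_simp
  ring

lemma tendsto_cnPrimitive :
    Filter.Tendsto (fun x : ℝ => (cnPrimitive x).re) (nhdsWithin (π / 2) (Set.Iio (π / 2)))
      (nhds (π / 2)) := by
  have hpi := Real.pi_pos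
  have hev : ∀ᶠ x : ℝ in nhdsWithin (π / 2) (Set.Iio (π / 2)), x ∈ Set.Ioo 0 (π / 2) :=
    Ioo_mem_nhdsLT (by positivity)
  have h1 : Filter.Tendsto (fun x : ℝ => ∑' n : ℕ, cnCoeff n / (2 * n + 1) *
      (Real.exp ((2 * n + 1) * (x - π)) - Real.exp (-((2 * n + 1) * x))))
      (nhdsWithin (π / 2) (Set.Iio (π / 2))) (nhds (∑' n : ℕ, cnCoeff n / (2 * n + 1) *
      (Real.exp ((2 * n + 1) * (π / 2 - π)) - Real.exp (-((2 * n + 1) * (π / 2)))))) := by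
    refine tendsto_tsum_of_dominated_convergence (bound := fun n : ℕ => |cnCoeff n|)
      (decays_cnCoeff.summable_abs.comp_injective Nat.cast_injective) (fun n => ?_) ?_
    · exact Filter.Tendsto.mono_left (Continuous.tendsto (by fun_prop) _) nhdsWithin_le_nhds
    · filter_upwards [hev] with x hx n
      rw [Real.norm_eq_abs, abs_mul, abs_div]
      have e1 : |cnCoeff n| / |2 * (n : ℝ) + 1| ≤ |cnCoeff n| := by
        refine div_le_self (abs_nonneg _) ?_
        rw [abs_of_nonneg (by positivity)]
        linarith [(Nat.cast_nonneg n : (0 : ℝ) ≤ n)]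
      have e2 : Real.exp ((2 * n + 1) * (x - π)) ≤ 1 := by
        rw [Real.exp_le_one_iff]
        exact mul_nonpos_of_nonneg_of_nonpos (by positivity) (by linarith [hx.2])
      have e3 : Real.exp (-((2 * n + 1) * x)) ≤ 1 := by
        have := hx.1
        rw [Real.exp_le_one_iff, neg_nonpos]
        positivity
      have e4 : |Real.exp ((2 * n + 1) * (x - π)) - Real.exp (-((2 * n + 1) * x))| ≤ 1 := by
        rw [abs_le]
        constructor <;> linarith [Real.exp_pos ((2 * n + 1) * (x - π)),
          Real.exp_pos (-((2 * n + 1) * x))]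
      exact (mul_le_mul e1 e4 (abs_nonneg _) (abs_nonneg _)).trans_eq (mul_one _)
  have h2 : ∀ n : ℕ, cnCoeff n / (2 * n + 1) *
      (Real.exp ((2 * n + 1) * (π / 2 - π)) - Real.exp (-((2 * n + 1) * (π / 2)))) = 0 :=
    fun n => by
      rw [show (2 * (n : ℝ) + 1) * (π / 2 - π) = -((2 * n + 1) * (π / 2)) by ring, sub_self,
        mul_zero]
  simp only [h2, tsum_zero] at h1
  have h3 : Filter.Tendsto (fun x : ℝ => 2 * Real.arctan (Real.exp (x - π / 2)))
      (nhdsWithin (π / 2) (Set.Iio (π / 2))) (nhds (2 * Real.arctan (Real.exp (π / 2 - π / 2)))) :=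
    Filter.Tendsto.mono_left (Continuous.tendsto (by fun_prop) _) nhdsWithin_le_nhds
  have h4 := h1.add h3
  rw [sub_self, Real.exp_zero, Real.arctan_one, zero_add, show 2 * (π / 4) = π / 2 by ring] at h4
  refine h4.congr' ?_
  filter_upwards [hev] with x hx
  rw [(hasSum_cnPrimitive (abs_lt.mpr ⟨by linarith [hx.1], hx.2⟩)).tsum_eq]
  ring

lemma continuous_one_div_sqrt_add {A B : ℝ} (hA : 0 < A) :
    Continuous fun t : ℝ => 1 / √(A ^ 2 + B ^ 2 * Real.sin t ^ 2) :=
  continuous_const.div (by fun_prop) fun _ => (Real.sqrt_pos.mpr (by positivity)).ne'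

lemma integral_cn_pi_div_two : ∫ t in (0 : ℝ)..(π / 2),
    1 / √((∑' n, cnCoeff n) ^ 2 + (∑' n, dnCoeff n) ^ 2 * Real.sin t ^ 2) = π / 2 := by
  have hcont := (intervalIntegral.continuous_primitive (μ := MeasureTheory.volume)
    (fun a b => (continuous_one_div_sqrt_add (B := ∑' n, dnCoeff n)
      tsum_cnCoeff_pos).intervalIntegrable a b) 0).tendsto (π / 2)
  have h1 := hcont.comp tendsto_cnPrimitive
  refine tendsto_nhds_unique h1 ((Filter.tendsto_id.mono_left nhdsWithin_le_nhds).congr' ?_)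
  filter_upwards [Ioo_mem_nhdsLT (show (0 : ℝ) < π / 2 by positivity)] with x hx
  exact (integral_cn hx.1.le hx.2).symm

lemma integral_lt_integral_swap {A B : ℝ} (hA : 0 < A) (hAB : A < B) :
    ∫ t in (0 : ℝ)..(π / 2), 1 / √(B ^ 2 + A ^ 2 * Real.sin t ^ 2)
      < ∫ t in (0 : ℝ)..(π / 2), 1 / √(A ^ 2 + B ^ 2 * Real.sin t ^ 2) := by
  have hB := hA.trans hAB
  have hsq : A ^ 2 < B ^ 2 := by gcongr
  refine intervalIntegral.integral_lt_integral_of_continuousOn_of_le_of_exists_lt (by positivity)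
    (continuous_one_div_sqrt_add hB).continuousOn (continuous_one_div_sqrt_add hA).continuousOn
    (fun t _ => ?_) ⟨0, ⟨le_rfl, by positivity⟩, ?_⟩
  · refine one_div_le_one_div_of_le (by positivity) (Real.sqrt_le_sqrt ?_)
    nlinarith [Real.sin_sq_le_one t]
  · refine one_div_lt_one_div_of_lt (by positivity) (Real.sqrt_lt_sqrt (by positivity) ?_)
    simpa using hsq

lemma tsum_cnCoeff_eq_tsum_dnCoeff : ∑' n, cnCoeff n = ∑' n, dnCoeff n := by
  have h1 := integral_dn
  have h2 := integral_cn_pi_div_two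
  rcases lt_trichotomy (∑' n, cnCoeff n) (∑' n, dnCoeff n) with h | h | h
  · exact absurd (integral_lt_integral_swap tsum_cnCoeff_pos h) (by rw [h1, h2]; exact lt_irrefl _)
  · exact h
  · exact absurd (integral_lt_integral_swap tsum_dnCoeff_pos h) (by rw [h1, h2]; exact lt_irrefl _)

lemma tsum_cnCoeff_mul_pi : (∑' n, cnCoeff n) * π
    = 2 * ∫ t in (0 : ℝ)..(π / 2), 1 / √(1 + Real.sin t ^ 2) := by
  have hpos := tsum_cnCoeff_pos
  have h := integral_dn
  rw [← tsum_cnCoeff_eq_tsum_dnCoeff] at h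
  have h1 (t : ℝ) : 1 / √((∑' n, cnCoeff n) ^ 2 + (∑' n, cnCoeff n) ^ 2 * Real.sin t ^ 2)
      = (∑' n, cnCoeff n)⁻¹ * (1 / √(1 + Real.sin t ^ 2)) := by
    rw [← mul_one_add, Real.sqrt_mul (by positivity), Real.sqrt_sq hpos.le, one_div, mul_inv,
      one_div]
  simp only [h1] at h
  rw [intervalIntegral.integral_const_mul, inv_mul_eq_iff_eq_mul₀ hpos.ne'] at h
  rw [h]
  ring

lemma hasSum_odd_mul_snCoeff :
    HasSum (fun n : ℤ => (2 * n + 1) * snCoeff n) ((∑' n, cnCoeff n) * ∑' n, dnCoeff n) := by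
  have hs : Summable fun n : ℤ => (2 * n + 1) * snCoeff n := by
    refine Summable.of_norm ((decays_snCoeff.summable_pow_mul 1 (r := 0) (by positivity)).congr
      fun n => ?_)
    simp
  have h := bilateral_mul_bilateral (k := 0) decays_cnCoeff decays_dnCoeff (e'' := 1)
    (c := fun p => (2 * p + 1) * snCoeff p) (by norm_num) (fun p => by
      simpa using hasSum_cnCoeff_dnCoeff p) zero_mem_strip
  rw [bilateral_zero_arg, bilateral_zero_arg, bilateral_zero_arg] at h
  have h2 : (∑' n, cnCoeff n) * ∑' n, dnCoeff n = ∑' n : ℤ, (2 * (n : ℝ) + 1) * snCoeff n := by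
    exact_mod_cast h
  rw [h2]
  exact hs.hasSum

lemma one_div_cosh_eq (x : ℝ) :
    1 / Real.cosh x = 2 * (Real.exp (-x) / (1 + Real.exp (-(2 * x)))) := by
  have h : Real.exp (-(2 * x)) = Real.exp (-x) * Real.exp (-x) := by
    rw [← Real.exp_add]; ring_nf
  have h1 : Real.exp x * Real.exp (-x) = 1 := by rw [← Real.exp_add]; simp
  rw [Real.cosh_eq, h]
  have := Real.exp_pos x
  have := Real.exp_pos (-x)
  rw [← mul_div_assoc, div_eq_div_iff (by positivity) (by positivity)]
  linear_combination (-1) * h1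

/-- **Normalization (`s'(0) = 1`) of the q-series of `sn(·, i)`:**
`Σₙ (2n+1)(-1)ⁿ e^{-(n+1/2)π}/(1+e^{-(2n+1)π}) = K²/π²`
with `K = ∫₀^{π/2} dθ/√(1+sin²θ)`. -/
theorem snoidal_qseries_normalization
    (K : ℝ) (hK : K = ∫ θ in (0:ℝ)..(π / 2), 1 / Real.sqrt (1 + Real.sin θ ^ 2)) :
    HasSum
      (fun n : ℕ => (2 * (n : ℝ) + 1) * (-1) ^ n *
        Real.exp (-((n : ℝ) + 1 / 2) * π) / (1 + Real.exp (-(2 * (n : ℝ) + 1) * π)))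
      (K ^ 2 / π ^ 2) := by
  have hM := tsum_cnCoeff_mul_pi
  rw [← hK] at hM
  have h := hasSum_odd_mul_snCoeff.nat_add_neg_add_one.div_const 4
  rw [← tsum_cnCoeff_eq_tsum_dnCoeff] at h
  have hval : (∑' n, cnCoeff n) * (∑' n, cnCoeff n) / 4 = K ^ 2 / π ^ 2 := by
    rw [← eq_div_iff Real.pi_ne_zero] at hM
    rw [hM]
    ring
  rw [hval] at h
  refine h.congr_fun fun n => ?_
  have h1 := one_div_cosh_eq ((2 * n + 1) * (π / 2))
  rw [show -((n : ℤ) + 1) = -1 - n by ring, snCoeff_reflect, snCoeff, zpow_natCast,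
    div_eq_mul_one_div _ (Real.cosh _), Int.cast_natCast, h1,
    show -((2 * (n : ℝ) + 1) * (π / 2)) = -((n : ℝ) + 1 / 2) * π by ring,
    show -(2 * ((2 * (n : ℝ) + 1) * (π / 2))) = -(2 * (n : ℝ) + 1) * π by ring]
  push_cast
  ring
end

section
/- Let s : ℝ → ℝ be twice differentiable with s''(u) = -2 s(u)^3 for all u, s(0) = 0, s'(0) = 1, let λ > 0, and define G : ℝ → ℝ by G(t) = (2/λ)^{1/4} s( (λ/2)^{1/4} t ) for t > 0 and G(t) = 0 for t ≤ 0. Then G is a Green function for the nonlinear operator ∂ₜ² + λ(·)³ in the distributional sense: for every smooth compactly supported test function f : ℝ → ℝ one has ∫_ℝ G(t) f''(t) dt + λ ∫_ℝ G(t)³ f(t) dt = f(0). -/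
open MeasureTheory

/-- Green's identity on the half-line `(0, ∞)` against a compactly supported test function. -/
theorem integral_Ioi_mul_deriv_deriv_sub {g g' g'' f : ℝ → ℝ}
    (hg : ∀ t, HasDerivAt g (g' t) t) (hg' : ∀ t, HasDerivAt g' (g'' t) t)
    (hcont : Continuous g'') (hf : ContDiff ℝ 2 f) (hsupp : HasCompactSupport f) :
    (∫ t in Set.Ioi 0, g t * deriv (deriv f) t) - ∫ t in Set.Ioi 0, g'' t * f t =
      g' 0 * f 0 - g 0 * deriv f 0 := by
  have hgc : Continuous g := continuous_iff_continuousAt.2 fun t => (hg t).continuousAt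
  have hf' : ContDiff ℝ 1 (deriv f) := hf.deriv' (n := 1)
  have hf'' : Continuous (deriv (deriv f)) := hf'.continuous_deriv le_rfl
  have hint : Integrable fun t => g t * deriv (deriv f) t :=
    (hgc.mul hf'').integrable_of_hasCompactSupport hsupp.deriv.deriv.mul_left
  have hint' : Integrable fun t => g'' t * f t :=
    (hcont.mul hf.continuous).integrable_of_hasCompactSupport hsupp.mul_left
  have hderiv (t : ℝ) : HasDerivAt (fun t => g t * deriv f t - g' t * f t)
      (g t * deriv (deriv f) t - g'' t * f t) t := by
    have hft := (hf.differentiable two_ne_zero t).hasDerivAt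
    have hft' := (hf'.differentiable one_ne_zero t).hasDerivAt
    exact (((hg t).mul hft').sub ((hg' t).mul hft)).congr_deriv (by ring)
  have hlim : Filter.Tendsto (fun t => g t * deriv f t - g' t * f t) Filter.atTop (nhds 0) := by
    have hc : HasCompactSupport fun t => g t * deriv f t - g' t * f t :=
      hsupp.deriv.mul_left.sub hsupp.mul_left
    exact hc.is_zero_at_infty.mono_left atTop_le_cocompact
  rw [← integral_sub hint.integrableOn hint'.integrableOn,
    integral_Ioi_of_hasDerivAt_of_tendsto' (fun t _ => hderiv t)
      (hint.sub hint').integrableOn hlim]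
  ring

/-- **The causal rescaled snoidal function is a Green function of
`∂ₜ² + λ(·)³` in the distributional sense:** for every smooth compactly
supported test function `f`, `∫ G f'' + λ ∫ G³ f = f 0`. -/
theorem snoidal_green_function_distributional
    (s : ℝ → ℝ)
    (hs : Differentiable ℝ s) (hs' : Differentiable ℝ (deriv s))
    (hode : ∀ u : ℝ, deriv (deriv s) u = -2 * s u ^ 3)
    (h0 : s 0 = 0) (h1 : deriv s 0 = 1)
    (lam : ℝ) (hlam : 0 < lam)
    (G : ℝ → ℝ)
    (hGpos : ∀ t : ℝ, 0 < t → G t = (2 / lam) ^ ((1:ℝ)/4) * s ((lam / 2) ^ ((1:ℝ)/4) * t))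
    (hGneg : ∀ t : ℝ, t ≤ 0 → G t = 0) :
    ∀ f : ℝ → ℝ, ContDiff ℝ (⊤ : ℕ∞) f → HasCompactSupport f →
      (∫ t : ℝ, G t * deriv (deriv f) t) + lam * (∫ t : ℝ, G t ^ 3 * f t) = f 0 := by
  intro f hf hsupp
  set a := (2 / lam) ^ ((1 : ℝ) / 4) with ha
  set b := (lam / 2) ^ ((1 : ℝ) / 4) with hb
  have hab : a * b = 1 := by
    rw [ha, hb, ← Real.mul_rpow (by positivity) (by positivity),
      div_mul_div_cancel₀ hlam.ne', div_self two_ne_zero, Real.one_rpow]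
  have hb4 : b ^ 4 = lam / 2 := by
    rw [hb, ← Real.rpow_natCast, ← Real.rpow_mul (by positivity)]
    norm_num
  have hlb : lam * a ^ 3 = 2 * b := by
    have hl : lam = 2 * b ^ 4 := by linarith
    calc lam * a ^ 3 = 2 * b * (a * b) ^ 3 := by rw [hl]; ring
      _ = 2 * b := by rw [hab]; ring
  have hlin (t : ℝ) : HasDerivAt (fun t => b * t) b t := by
    simpa using (hasDerivAt_id t).const_mul b
  have hg (t : ℝ) : HasDerivAt (fun t => a * s (b * t)) (deriv s (b * t)) t := by
    refine (((hs (b * t)).hasDerivAt.comp t (hlin t)).const_mul a).congr_deriv ?_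
    linear_combination deriv s (b * t) * hab
  have hg' (t : ℝ) :
      HasDerivAt (fun t => deriv s (b * t)) (-lam * (a * s (b * t)) ^ 3) t := by
    refine ((hs' (b * t)).hasDerivAt.comp t (hlin t)).congr_deriv ?_
    rw [hode]
    linear_combination s (b * t) ^ 3 * hlb
  have hsc : Continuous s := hs.continuous
  have key := integral_Ioi_mul_deriv_deriv_sub hg hg' (by fun_prop)
    (contDiff_infty.1 hf 2) hsupp
  have hG : G = (Set.Ioi 0).indicator fun t => a * s (b * t) := by
    ext t
    by_cases ht : 0 < t
    · simp [ht, hGpos t ht]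
    · simp [ht, hGneg t (not_lt.1 ht)]
  have hI : ∫ t, G t * deriv (deriv f) t =
      ∫ t in Set.Ioi 0, a * s (b * t) * deriv (deriv f) t := by
    rw [← integral_indicator measurableSet_Ioi]
    congr 1 with t
    by_cases ht : 0 < t <;> simp [hG, ht]
  have hJ : ∫ t, G t ^ 3 * f t = ∫ t in Set.Ioi 0, (a * s (b * t)) ^ 3 * f t := by
    rw [← integral_indicator measurableSet_Ioi]
    congr 1 with t
    by_cases ht : 0 < t <;> simp [hG, ht]
  simp only [mul_assoc (-lam), integral_const_mul] at key
  rw [hI, hJ]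
  simp only [mul_zero, h0, h1] at key
  linarith
end

section
/- Let s : ℝ → ℝ be twice differentiable with s''(u) = -2 s(u)^3 for all u, s(0) = 0, s'(0) = 1. Let λ > 0, μ > 0, θ₀ ∈ ℝ, and let p = (p₀, p₁, p₂, p₃) ∈ ℝ⁴ satisfy the dispersion relation p₀² − p₁² − p₂² − p₃² = μ² √(λ/2). Then the field φ : ℝ⁴ → ℝ defined by φ(x) = μ (2/λ)^{1/4} s( p₀ x₀ − p₁ x₁ − p₂ x₂ − p₃ x₃ + θ₀ ) is an exact solution of the massless quartic scalar field equation ∂₀²φ − ∂₁²φ − ∂₂²φ − ∂₃²φ + λ φ³ = 0 on all of ℝ⁴; in particular the massless self-interacting scalar field admits exact massive (nonzero p²) wave solutions. -/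
/-- Partial derivative of a function on `ℝ⁴ = Fin 4 → ℝ` in the `i`-th
coordinate direction. -/
noncomputable def pdiff (i : Fin 4) (f : (Fin 4 → ℝ) → ℝ) : (Fin 4 → ℝ) → ℝ :=
  fun x => deriv (fun z : ℝ => f (Function.update x i z)) (x i)

/-- Chain rule for the partial derivatives of a plane wave `x ↦ a * f (k ⬝ᵥ x + θ)`. -/
theorem pdiff_planeWave (i : Fin 4) (a θ : ℝ) (k : Fin 4 → ℝ) {f : ℝ → ℝ}
    (hf : Differentiable ℝ f) :
    pdiff i (fun x => a * f (k ⬝ᵥ x + θ)) =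
      fun x => a * k i * deriv f (k ⬝ᵥ x + θ) := by
  funext x
  have hphase : HasDerivAt (fun z : ℝ => k ⬝ᵥ Function.update x i z + θ) (k i) (x i) := by
    have h := HasDerivAt.fun_sum (u := Finset.univ) fun j _ =>
      (hasDerivAt_pi.1 (hasDerivAt_update x i (x i)) j).const_mul (k j)
    simpa [dotProduct, Pi.single_apply] using h.add_const θ
  have hcomp := (HasDerivAt.comp (x i) (hf _).hasDerivAt hphase).const_mul a
  simp only [Function.update_eq_self] at hcomp
  rw [mul_assoc, mul_comm (k i)]
  exact hcomp.deriv

/-- The amplitude-frequency relation `λ A² = 2 μ² √(λ/2)` for `A = μ (2/λ)^{1/4}`. -/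
theorem mul_amplitude_sq {lam : ℝ} (μ : ℝ) (hlam : 0 < lam) :
    lam * (μ * (2 / lam) ^ ((1:ℝ)/4)) ^ 2 = 2 * (μ ^ 2 * Real.sqrt (lam / 2)) := by
  have hroot : ((2 / lam) ^ ((1:ℝ)/4)) ^ 2 = (Real.sqrt (lam / 2))⁻¹ := by
    rw [← Real.rpow_mul_natCast (by positivity), ← Real.sqrt_inv, inv_div,
      Real.sqrt_eq_rpow]
    norm_num
  have hsq : Real.sqrt (lam / 2) ^ 2 = lam / 2 := Real.sq_sqrt (by positivity)
  have hpos : 0 < Real.sqrt (lam / 2) := by positivity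
  rw [mul_pow, hroot]
  field_simp
  rw [hsq]
  ring

/-- **Exact massive wave solutions of the massless quartic scalar field.**
If `s'' = -2 s³`, `s 0 = 0`, `s' 0 = 1`, `λ, μ > 0`, and `p ∈ ℝ⁴` satisfies
`p₀² - p₁² - p₂² - p₃² = μ²√(λ/2)`, then
`φ(x) = μ (2/λ)^{1/4} s(p·x + θ₀)` solves `∂₀²φ - ∂₁²φ - ∂₂²φ - ∂₃²φ + λφ³ = 0`
on all of `ℝ⁴`. -/
theorem massless_quartic_exact_massive_solution
    (s : ℝ → ℝ)
    (hs : Differentiable ℝ s) (hs' : Differentiable ℝ (deriv s))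
    (hode : ∀ u : ℝ, deriv (deriv s) u = -2 * s u ^ 3)
    (h0 : s 0 = 0) (h1 : deriv s 0 = 1)
    (lam μ θ₀ : ℝ) (hlam : 0 < lam) (hμ : 0 < μ)
    (p : Fin 4 → ℝ)
    (hdisp : p 0 ^ 2 - p 1 ^ 2 - p 2 ^ 2 - p 3 ^ 2 = μ ^ 2 * Real.sqrt (lam / 2))
    (φ : (Fin 4 → ℝ) → ℝ)
    (hφ : ∀ x : Fin 4 → ℝ, φ x =
      μ * (2 / lam) ^ ((1:ℝ)/4) *
        s (p 0 * x 0 - p 1 * x 1 - p 2 * x 2 - p 3 * x 3 + θ₀)) :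
    ∀ x : Fin 4 → ℝ,
      pdiff 0 (pdiff 0 φ) x - pdiff 1 (pdiff 1 φ) x - pdiff 2 (pdiff 2 φ) x -
        pdiff 3 (pdiff 3 φ) x + lam * φ x ^ 3 = 0 := by
  intro x
  set A := μ * (2 / lam) ^ ((1:ℝ)/4)
  have hwave : φ = fun x => A * s (![p 0, -p 1, -p 2, -p 3] ⬝ᵥ x + θ₀) := by
    funext y
    rw [hφ]
    simp [dotProduct, Fin.sum_univ_four, sub_eq_add_neg]
  have hamp : lam * A ^ 2 = 2 * (μ ^ 2 * Real.sqrt (lam / 2)) := mul_amplitude_sq μ hlam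
  rw [← hdisp] at hamp
  simp only [hwave, pdiff_planeWave _ _ _ _ hs, pdiff_planeWave _ _ _ _ hs', hode]
  simp only [Matrix.cons_val]
  linear_combination A * s (![p 0, -p 1, -p 2, -p 3] ⬝ᵥ x + θ₀) ^ 3 * hamp
end

section
/- Let K = ∫₀^{π/2} dθ / √(1 + sin²θ), let λ > 0, Λ > 0, and define the residues Bₙ = (2n+1) (π²/K²) (−1)^{n+1} e^{−(n+1/2)π} / (1 + e^{−(2n+1)π}) and the mass spectrum ωₙ = (n + 1/2) (π/K) (λ/2)^{1/4} Λ for n ∈ ℕ. Then the series F(0) := Σ_{n=0}^∞ Bₙ / (0 − ωₙ²) = Σ_{n=0}^∞ (−Bₙ)/ωₙ² converges absolutely and its sum is strictly positive; in particular the infrared (gluon) propagator is finite and nonvanishing at zero momentum. -/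
open Real

/-- The absolute value of the `n`-th term of the propagator series at zero momentum,
up to a factor that does not depend on `n`. -/
noncomputable def residueProfile (n : ℕ) : ℝ :=
  1 / ((2 * (n : ℝ) + 1) * Real.cosh (((n : ℝ) + 1 / 2) * π))

lemma residueProfile_pos (n : ℕ) : 0 < residueProfile n := by
  have := Real.cosh_pos (((n : ℝ) + 1 / 2) * π)
  unfold residueProfile
  positivity

lemma residueProfile_strictAnti : StrictAnti residueProfile := by
  intro m n hmn
  have hc := Real.cosh_pos (((m : ℝ) + 1 / 2) * π)
  have hmn' : (m : ℝ) < n := by exact_mod_cast hmn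
  have hcosh : Real.cosh (((m : ℝ) + 1 / 2) * π) ≤ Real.cosh (((n : ℝ) + 1 / 2) * π) := by
    rw [Real.cosh_le_cosh, abs_of_pos (by positivity), abs_of_pos (by positivity)]
    gcongr
  unfold residueProfile
  apply one_div_lt_one_div_of_lt (by positivity)
  apply mul_lt_mul _ hcosh hc (by positivity)
  linarith

lemma summable_residueProfile : Summable residueProfile := by
  have hr : Real.exp (-π) < 1 := Real.exp_lt_one_iff.mpr (by linarith [Real.pi_pos])
  refine Summable.of_nonneg_of_le (fun n => (residueProfile_pos n).le) (fun n => ?_)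
    ((summable_geometric_of_lt_one (Real.exp_pos _).le hr).mul_left 2)
  have hexp : Real.exp (n * π) ≤ Real.exp (((n : ℝ) + 1 / 2) * π) := by
    apply Real.exp_le_exp.mpr
    nlinarith [Real.pi_pos]
  have hcosh : Real.exp (n * π) / 2 ≤ Real.cosh (((n : ℝ) + 1 / 2) * π) := by
    rw [Real.cosh_eq]
    linarith [Real.exp_pos (-(((n : ℝ) + 1 / 2) * π))]
  have hle : Real.exp (n * π) / 2 ≤
      (2 * (n : ℝ) + 1) * Real.cosh (((n : ℝ) + 1 / 2) * π) := by
    nlinarith [Real.cosh_pos (((n : ℝ) + 1 / 2) * π), (Nat.cast_nonneg n : (0 : ℝ) ≤ n)]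
  calc residueProfile n ≤ 1 / (Real.exp (n * π) / 2) :=
        one_div_le_one_div_of_le (by positivity) hle
    _ = 2 * Real.exp (-π) ^ n := by
        rw [← Real.exp_nat_mul, mul_neg, Real.exp_neg]
        field_simp

lemma summable_alternating_residueProfile :
    Summable (fun n : ℕ => (-1) ^ n * residueProfile n) := by
  refine Summable.of_norm (summable_residueProfile.congr fun n => ?_)
  simp [abs_of_pos (residueProfile_pos n)]

lemma tsum_alternating_residueProfile_pos :
    0 < ∑' n : ℕ, (-1) ^ n * residueProfile n := by
  have h := residueProfile_strictAnti.antitone.alternating_series_le_tendsto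
    summable_alternating_residueProfile.hasSum.tendsto_sum_nat 1
  simp only [mul_one, Finset.sum_range_succ, Finset.sum_range_zero] at h
  linarith [residueProfile_strictAnti zero_lt_one]

lemma exp_neg_div_one_add_exp (x : ℝ) :
    Real.exp (-x) / (1 + Real.exp (-(2 * x))) = 1 / (2 * Real.cosh x) := by
  have h : Real.exp (-(2 * x)) = Real.exp (-x) * Real.exp (-x) := by
    rw [← Real.exp_add]; ring_nf
  have h1 : Real.exp x * Real.exp (-x) = 1 := by
    rw [← Real.exp_add]; simp
  have hp := Real.exp_pos x
  have hq := Real.exp_pos (-x)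
  rw [Real.cosh_eq, h, div_eq_div_iff (by positivity) (by positivity)]
  linear_combination h1

lemma integral_one_div_sqrt_one_add_sin_sq_pos :
    0 < ∫ θ in (0 : ℝ)..(π / 2), 1 / Real.sqrt (1 + Real.sin θ ^ 2) := by
  have hpos : ∀ θ : ℝ, 0 < Real.sqrt (1 + Real.sin θ ^ 2) := fun θ => by positivity
  have hcont : Continuous fun θ : ℝ => 1 / Real.sqrt (1 + Real.sin θ ^ 2) :=
    continuous_const.div (by fun_prop) fun θ => (hpos θ).ne'
  exact intervalIntegral.intervalIntegral_pos_of_pos (hcont.intervalIntegrable _ _)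
    (fun θ => one_div_pos.mpr (hpos θ)) (by positivity)

/-- **The infrared propagator is finite and nonvanishing at zero momentum.**
With `K = ∫₀^{π/2} dθ/√(1+sin²θ)`, residues
`Bₙ = (2n+1)(π²/K²)(-1)^{n+1} e^{-(n+1/2)π}/(1+e^{-(2n+1)π})` and masses
`ωₙ = (n+1/2)(π/K)(λ/2)^{1/4} Λ`, the series `Σₙ Bₙ/(0 - ωₙ²)` converges
absolutely and its sum is strictly positive. -/
theorem infrared_propagator_finite_at_zero
    (K : ℝ) (hK : K = ∫ θ in (0:ℝ)..(π / 2), 1 / Real.sqrt (1 + Real.sin θ ^ 2))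
    (lam Λ : ℝ) (hlam : 0 < lam) (hΛ : 0 < Λ)
    (B ω : ℕ → ℝ)
    (hB : ∀ n : ℕ, B n = (2 * (n : ℝ) + 1) * (π ^ 2 / K ^ 2) * (-1) ^ (n + 1) *
      Real.exp (-((n : ℝ) + 1 / 2) * π) / (1 + Real.exp (-(2 * (n : ℝ) + 1) * π)))
    (hω : ∀ n : ℕ, ω n = ((n : ℝ) + 1 / 2) * (π / K) * (lam / 2) ^ ((1:ℝ)/4) * Λ) :
    Summable (fun n : ℕ => |B n / (0 - ω n ^ 2)|) ∧
      0 < ∑' n : ℕ, B n / (0 - ω n ^ 2) := by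
  have hKpos : 0 < K := hK ▸ integral_one_div_sqrt_one_add_sin_sq_pos
  have hs : 0 < (lam / 2) ^ ((1 : ℝ) / 4) := by positivity
  have hterm : ∀ n : ℕ, B n / (0 - ω n ^ 2) =
      2 / ((lam / 2) ^ ((1 : ℝ) / 4) * Λ) ^ 2 * ((-1) ^ n * residueProfile n) := by
    intro n
    have hc := Real.cosh_pos (((n : ℝ) + 1 / 2) * π)
    have he := exp_neg_div_one_add_exp (((n : ℝ) + 1 / 2) * π)
    rw [show -(((n : ℝ) + 1 / 2) * π) = -((n : ℝ) + 1 / 2) * π by ring,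
      show -(2 * (((n : ℝ) + 1 / 2) * π)) = -(2 * (n : ℝ) + 1) * π by ring] at he
    rw [hB, hω, mul_div_assoc, he, residueProfile, pow_succ (-1 : ℝ),
      show (n : ℝ) + 1 / 2 = (2 * n + 1) / 2 by ring]
    rw [show (n : ℝ) + 1 / 2 = (2 * n + 1) / 2 by ring] at hc
    generalize Real.cosh ((2 * (n : ℝ) + 1) / 2 * π) = c at hc ⊢
    generalize (lam / 2) ^ ((1 : ℝ) / 4) = s at hs ⊢
    have hn : 0 < 2 * (n : ℝ) + 1 := by positivity
    generalize 2 * (n : ℝ) + 1 = m at hn ⊢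
    rw [zero_sub]
    field_simp
  simp_rw [hterm]
  refine ⟨(summable_alternating_residueProfile.mul_left _).abs, ?_⟩
  rw [tsum_mul_left]
  exact mul_pos (by positivity) tsum_alternating_residueProfile_pos
end
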